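/- arXiv:2202.02509 — 2 statements merged into one kernel-verified Lean document; each statement's English description precedes it below -/
import Mathlib

section
/- Let Ω ⊂ ℝ² be a compact convex region of unit area with nonempty interior whose frontier ∂Ω has length ℓ, k ≥ 1 an integer, c > 0 a constant, and r_n = √((log n + (2k−1)·log log n + ξ)/(π·n)), where ξ = −2·log(√(e^{−c} + π·ℓ²/64) − ℓ·√π/8) if k = 1, and ξ = 2·log(ℓ·√π/(2^{k+1}·k!)) + 2c if k > 1. Then lim_{n→∞} (n/k!) ∫_Ω (n·|B(x, r_n) ∩ Ω|)^k · e^{−n·|B(x, r_n) ∩ Ω|} dx = e^{−c}. -/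
open MeasureTheory Metric Real Filter Topology

/-- The Euclidean plane. -/
abbrev Plane := EuclideanSpace ℝ (Fin 2)

namespace Plane

/-- Rotation of a plane vector by a right angle. -/
noncomputable def perp (u : Plane) : Plane := !₂[-u 1, u 0]

lemma inner_eq (x y : Plane) : inner ℝ x y = x 0 * y 0 + x 1 * y 1 := by
  simp [PiLp.inner_apply, Fin.sum_univ_two, mul_comm]

lemma norm_sq_eq (x : Plane) : ‖x‖ ^ 2 = x 0 ^ 2 + x 1 ^ 2 := by
  rw [← real_inner_self_eq_norm_sq, inner_eq]; ring

lemma sq_add_sq_of_norm_eq_one {u : Plane} (hu : ‖u‖ = 1) : u 0 ^ 2 + u 1 ^ 2 = 1 := by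
  rw [← norm_sq_eq, hu, one_pow]

lemma inner_perp (u x : Plane) : inner ℝ (perp u) x = -u 1 * x 0 + u 0 * x 1 := by
  rw [inner_eq]; simp [perp]

/-- Coordinates in the orthonormal frame `(perp u, u)`. -/
noncomputable def coords (u : Plane) (x : Plane) : ℝ × ℝ := (inner ℝ (perp u) x, inner ℝ u x)

lemma coords_decomp {u : Plane} (hu : ‖u‖ = 1) (x : Plane) :
    x = (coords u x).1 • perp u + (coords u x).2 • u := by
  have h := sq_add_sq_of_norm_eq_one hu
  ext i
  fin_cases i
  · simp only [coords, inner_eq]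
    simp [perp]
    linear_combination (-(x 0)) * h
  · simp only [coords, inner_eq]
    simp [perp]
    linear_combination (-(x 1)) * h

lemma coords_combo {u : Plane} (hu : ‖u‖ = 1) (a b : ℝ) :
    coords u (a • perp u + b • u) = (a, b) := by
  have h := sq_add_sq_of_norm_eq_one hu
  ext
  · simp only [coords, inner_perp]
    simp [perp]
    linear_combination a * h
  · simp only [coords, inner_eq]
    simp [perp]
    linear_combination b * h

lemma norm_combo_sq {u : Plane} (hu : ‖u‖ = 1) (a b : ℝ) :
    ‖a • perp u + b • u‖ ^ 2 = a ^ 2 + b ^ 2 := by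
  have h := sq_add_sq_of_norm_eq_one hu
  rw [norm_sq_eq]
  simp [perp]
  linear_combination (a ^ 2 + b ^ 2) * h

lemma measurePreserving_coords {u : Plane} (hu : ‖u‖ = 1) :
    MeasurePreserving (coords u) := by
  have h := sq_add_sq_of_norm_eq_one hu
  have hon : Orthonormal ℝ ![perp u, u] := by
    rw [orthonormal_iff_ite]
    intro i j
    fin_cases i <;> fin_cases j <;> simp [inner_eq, perp, -inner_self_eq_norm_sq_to_K]
    all_goals nlinarith [h, hu]
  let b : OrthonormalBasis (Fin 2) ℝ Plane :=
    OrthonormalBasis.mk hon (by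
      intro x _
      rw [coords_decomp hu x]
      refine Submodule.add_mem _ (Submodule.smul_mem _ _ (Submodule.subset_span ⟨0, rfl⟩))
        (Submodule.smul_mem _ _ (Submodule.subset_span ⟨1, rfl⟩)))
  have h1 := (volume_preserving_finTwoArrow ℝ).comp
    ((EuclideanSpace.volume_preserving_symm_measurableEquiv_toLp (Fin 2)).comp
      b.measurePreserving_repr)
  have h2 : coords u = MeasurableEquiv.finTwoArrow ∘
      (MeasurableEquiv.toLp 2 (Fin 2 → ℝ)).symm ∘ b.repr := by
    funext x
    simp [coords, b, OrthonormalBasis.repr_apply_apply, MeasurableEquiv.finTwoArrow]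
  rw [h2]
  exact h1

lemma continuous_coords (u : Plane) : Continuous (coords u) := by
  unfold coords; fun_prop

lemma volume_coords_preimage {u : Plane} (hu : ‖u‖ = 1) {T : Set (ℝ × ℝ)}
    (hT : MeasurableSet T) : volume (coords u ⁻¹' T) = volume T :=
  (measurePreserving_coords hu).measure_preimage hT.nullMeasurableSet

/-- The abscissas, in the frame `(perp u, u)`, of the points of `F` on the line at height `h`. -/
def trace (u : Plane) (h : ℝ) (F : Set Plane) : Set ℝ := {a | a • perp u + h • u ∈ F}

lemma measurableSet_trace (u : Plane) (h : ℝ) {F : Set Plane} (hF : MeasurableSet F) :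
    MeasurableSet (trace u h F) :=
  (show Continuous (fun a : ℝ => a • perp u + h • u) by fun_prop).measurable hF

lemma hausdorffMeasure_eq_volume_trace {u : Plane} (hu : ‖u‖ = 1) {h : ℝ} {F : Set Plane}
    (hF : ∀ x ∈ F, inner ℝ u x = h) : μH[1] F = volume (trace u h F) := by
  have hiso : Isometry (fun a : ℝ => a • perp u + h • u) := by
    refine Isometry.of_dist_eq fun a b => ?_
    rw [dist_eq_norm, Real.dist_eq]
    have h1 : a • perp u + h • u - (b • perp u + h • u) = (a - b) • perp u + (0 : ℝ) • u := by
      module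
    rw [h1, ← sq_eq_sq₀ (norm_nonneg _) (abs_nonneg _), norm_combo_sq hu, sq_abs]
    ring
  have himg : (fun a : ℝ => a • perp u + h • u) '' trace u h F = F := by
    ext x
    constructor
    · rintro ⟨a, ha, rfl⟩
      exact ha
    · intro hx
      have hd := coords_decomp hu x
      have h2 : (coords u x).2 = h := hF x hx
      rw [h2] at hd
      exact ⟨(coords u x).1, by rw [trace, Set.mem_ofPred_eq, ← hd]; exact hx, hd.symm⟩
  rw [← hausdorffMeasure_real, ← hiso.hausdorffMeasure_image (Or.inl zero_le_one), himg]

/-- The points which reach `F` when moving along the segment from `0` to `z`. -/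
def sweep (F : Set Plane) (z : Plane) : Set Plane :=
  {x | ∃ s ∈ Set.Icc (0 : ℝ) 1, x + s • z ∈ F}

lemma volume_sweep_le {u : Plane} (hu : ‖u‖ = 1) {h : ℝ} {F : Set Plane}
    (hFm : MeasurableSet F) (hF : ∀ x ∈ F, inner ℝ u x = h) (z : Plane) (hz : 0 ≤ inner ℝ u z) :
    volume (sweep F z) ≤ μH[1] F * ENNReal.ofReal (inner ℝ u z) := by
  rw [hausdorffMeasure_eq_volume_trace hu hF]
  set A := trace u h F
  have hA : MeasurableSet A := measurableSet_trace u h hFm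
  set α := (coords u z).1 with hα
  set β := (coords u z).2 with hβ
  change volume (sweep F z) ≤ volume A * ENNReal.ofReal β
  have hβ0 : 0 ≤ β := hz
  set T : Set (ℝ × ℝ) := {p | p.2 ∈ Set.Icc (h - β) h ∧ (β = 0 ∨ p.1 + (h - p.2) / β * α ∈ A)}
    with hT
  have hTm : MeasurableSet T := by
    refine ((measurableSet_Icc).preimage measurable_snd).inter ?_
    by_cases hb : β = 0
    · simp only [hb, true_or]
      exact MeasurableSet.univ
    · simp only [hb, false_or]
      exact (show Measurable fun p : ℝ × ℝ => p.1 + (h - p.2) / β * α by fun_prop) hA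
  have hsub : sweep F z ⊆ coords u ⁻¹' T := by
    rintro x ⟨s, hs, hx⟩
    have h1 : (coords u x).2 + s * β = h := by
      rw [← hF _ hx, inner_add_right, inner_smul_right]; rfl
    have h2 : (coords u x).1 + s * α ∈ A := by
      have h3 : x + s • z = ((coords u x).1 + s * α) • perp u + h • u := by
        rw [← h1]
        conv_lhs => rw [coords_decomp hu x, coords_decomp hu z]
        rw [← hα, ← hβ]
        module
      change ((coords u x).1 + s * α) • perp u + h • u ∈ F
      rw [← h3]; exact hx
    refine ⟨⟨by nlinarith [hs.1, hs.2], by nlinarith [hs.1, hs.2]⟩, ?_⟩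
    by_cases hb : β = 0
    · exact Or.inl hb
    · right
      have : (h - (coords u x).2) / β = s := by
        rw [← h1]; field_simp; ring
      rw [this]; exact h2
  refine (measure_mono hsub).trans ?_
  rw [volume_coords_preimage hu hTm, Measure.volume_eq_prod, Measure.prod_apply_symm hTm]
  by_cases hb : β = 0
  · have : ∀ᵐ y : ℝ, volume ((fun x : ℝ => (x, y)) ⁻¹' T) = 0 := by
      have h0 : ∀ᵐ y : ℝ, y ≠ h := by
        simp [ae_iff, measure_singleton]
      filter_upwards [h0] with y hy
      convert measure_empty (μ := (volume : Measure ℝ)) using 2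
      ext x
      simp only [hT, hb, Set.mem_preimage, Set.mem_ofPred_eq, sub_zero, Set.Icc_self,
        Set.mem_singleton_iff, hy, false_and, Set.mem_empty_iff_false]
    rw [lintegral_congr_ae this]; simp
  · have : ∀ y : ℝ, volume ((fun x : ℝ => (x, y)) ⁻¹' T) =
        (Set.Icc (h - β) h).indicator (fun _ => volume A) y := by
      intro y
      by_cases hy : y ∈ Set.Icc (h - β) h
      · rw [Set.indicator_of_mem hy]
        have : (fun x : ℝ => (x, y)) ⁻¹' T = (fun x => x + (h - y) / β * α) ⁻¹' A := by
          ext x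
          simp only [hT, hb, Set.mem_preimage, Set.mem_ofPred_eq, hy, true_and, false_or]
        rw [this, measure_preimage_add_right]
      · rw [Set.indicator_of_notMem hy]
        convert measure_empty (μ := (volume : Measure ℝ)) using 2
        ext x
        simp only [hT, Set.mem_preimage, Set.mem_ofPred_eq, hy, false_and, Set.mem_empty_iff_false]
    rw [lintegral_congr this, lintegral_indicator measurableSet_Icc, lintegral_const,
      Measure.restrict_apply_univ, Real.volume_Icc]
    simp

/-- The closed rectangle erected on a subset `F` of a line orthogonal to `u`. -/
def rect (F : Set Plane) (u : Plane) (t : ℝ) : Set Plane :=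
  {x | ∃ y ∈ F, ∃ s ∈ Set.Icc (0 : ℝ) t, x = y + s • u}

lemma rect_eq {u : Plane} (hu : ‖u‖ = 1) {h : ℝ} {F : Set Plane}
    (hF : ∀ x ∈ F, inner ℝ u x = h) (t : ℝ) :
    rect F u t = coords u ⁻¹' (trace u h F ×ˢ Set.Icc h (h + t)) := by
  ext x
  constructor
  · rintro ⟨y, hy, s, hs, rfl⟩
    have h2 : (coords u y).2 = h := hF y hy
    have hd := coords_decomp hu y
    rw [h2] at hd
    have : y + s • u = (coords u y).1 • perp u + (h + s) • u := by
      conv_lhs => rw [hd]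
      module
    rw [Set.mem_preimage, this, coords_combo hu]
    refine ⟨?_, by simpa using hs⟩
    change (coords u y).1 • perp u + h • u ∈ F
    rwa [← hd]
  · rintro ⟨h1, h2⟩
    refine ⟨_, h1, (coords u x).2 - h, ⟨by linarith [h2.1], by linarith [h2.2]⟩, ?_⟩
    conv_lhs => rw [coords_decomp hu x]
    module

lemma measurableSet_rect {u : Plane} (hu : ‖u‖ = 1) {h : ℝ} {F : Set Plane}
    (hFm : MeasurableSet F) (hF : ∀ x ∈ F, inner ℝ u x = h) (t : ℝ) :
    MeasurableSet (rect F u t) := by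
  rw [rect_eq hu hF]
  exact (continuous_coords u).measurable ((measurableSet_trace u h hFm).prod measurableSet_Icc)

lemma volume_rect {u : Plane} (hu : ‖u‖ = 1) {h : ℝ} {F : Set Plane}
    (hFm : MeasurableSet F) (hF : ∀ x ∈ F, inner ℝ u x = h) (t : ℝ) :
    volume (rect F u t) = μH[1] F * ENNReal.ofReal t := by
  rw [rect_eq hu hF, volume_coords_preimage hu
    ((measurableSet_trace u h hFm).prod measurableSet_Icc), Measure.volume_eq_prod,
    Measure.prod_prod, hausdorffMeasure_eq_volume_trace hu hF, Real.volume_Icc]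
  simp

section Polygon

variable {m : ℕ}

/-- The polygon cut out by the half-planes `⟪u i, x⟫ ≤ h i`. -/
def poly (u : Fin m → Plane) (h : Fin m → ℝ) : Set Plane := {x | ∀ i, inner ℝ (u i) x ≤ h i}

/-- The points of the polygon whose first active constraint is the `i`-th one. -/
def face (u : Fin m → Plane) (h : Fin m → ℝ) (i : Fin m) : Set Plane :=
  {x | x ∈ poly u h ∧ inner ℝ (u i) x = h i ∧ ∀ j < i, inner ℝ (u j) x < h j}

variable {u : Fin m → Plane} {h : Fin m → ℝ}

lemma isClosed_poly : IsClosed (poly u h) := by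
  have : poly u h = ⋂ i, {x | inner ℝ (u i) x ≤ h i} := by
    ext x; simp [poly]
  rw [this]
  exact isClosed_iInter fun i => isClosed_le (by fun_prop) continuous_const

lemma convex_poly : Convex ℝ (poly u h) := by
  intro x hx y hy a b ha hb hab i
  rw [inner_add_right, inner_smul_right, inner_smul_right]
  calc a * inner ℝ (u i) x + b * inner ℝ (u i) y ≤ a * h i + b * h i := by
        gcongr
        · exact hx i
        · exact hy i
    _ = h i := by rw [← add_mul, hab, one_mul]

lemma measurableSet_face (i : Fin m) : MeasurableSet (face u h i) := by
  refine isClosed_poly.measurableSet.inter (MeasurableSet.inter ?_ ?_)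
  · exact (isClosed_eq (by fun_prop) continuous_const).measurableSet
  · have : {x : Plane | ∀ j < i, inner ℝ (u j) x < h j} =
        ⋂ j, ⋂ (_ : j < i), {x | inner ℝ (u j) x < h j} := by
      ext x; simp
    change MeasurableSet {x : Plane | ∀ j < i, inner ℝ (u j) x < h j}
    rw [this]
    exact MeasurableSet.iInter fun j => MeasurableSet.iInter fun _ =>
      (isOpen_lt (by fun_prop) continuous_const).measurableSet

lemma inner_eq_of_mem_face {i : Fin m} : ∀ x ∈ face u h i, inner ℝ (u i) x = h i :=
  fun _ hx => hx.2.1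

lemma pairwise_disjoint_face : Pairwise (Function.onFun Disjoint (face u h)) := by
  intro i j hij
  rw [Function.onFun, Set.disjoint_left]
  rintro x ⟨_, hi, hi'⟩ ⟨_, hj, hj'⟩
  rcases lt_or_gt_of_ne hij with hlt | hlt
  · exact (hj' i hlt).ne hi
  · exact (hi' j hlt).ne hj

lemma exists_mem_face {x : Plane} (hx : x ∈ poly u h) {i : Fin m} (hi : inner ℝ (u i) x = h i) :
    ∃ j, x ∈ face u h j := by
  classical
  obtain ⟨j, hj, hmin⟩ := WellFounded.has_min (wellFounded_lt (α := Fin m))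
    {j | inner ℝ (u j) x = h j} ⟨i, hi⟩
  exact ⟨j, hx, hj, fun l hl => lt_of_le_of_ne (hx l) fun h' => hmin l h' hl⟩

lemma frontier_poly_subset : frontier (poly u h) ⊆ ⋃ i, face u h i := by
  intro x hx
  rw [isClosed_poly.frontier_eq] at hx
  obtain ⟨hxP, hxi⟩ := hx
  rw [Set.mem_iUnion]
  by_contra hcon
  have hlt : ∀ i, inner ℝ (u i) x < h i := fun i => lt_of_le_of_ne (hxP i) fun h' =>
    hcon (exists_mem_face hxP h')
  apply hxi
  rw [mem_interior_iff_mem_nhds]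
  have : ∀ i, ∀ᶠ y in 𝓝 x, inner ℝ (u i) y < h i := fun i =>
    (show Continuous fun y : Plane => inner ℝ (u i) y by fun_prop).continuousAt.eventually_lt
      continuousAt_const (hlt i)
  filter_upwards [eventually_all.2 this] with y hy i using (hy i).le

lemma face_subset_frontier (hu : ∀ i, ‖u i‖ = 1) (i : Fin m) :
    face u h i ⊆ frontier (poly u h) := by
  rintro x ⟨hxP, hxi, _⟩
  rw [isClosed_poly.frontier_eq]
  refine ⟨hxP, fun hint => ?_⟩
  have hc : Tendsto (fun s : ℝ => x + s • u i) (𝓝[>] 0) (𝓝 x) := by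
    have : Continuous fun s : ℝ => x + s • u i := by fun_prop
    simpa using (this.tendsto 0).mono_left nhdsWithin_le_nhds
  obtain ⟨s, hs, hs0⟩ := ((hc.eventually (mem_interior_iff_mem_nhds.1 hint)).and
    self_mem_nhdsWithin).exists
  have := hs i
  rw [inner_add_right, inner_smul_right, real_inner_self_eq_norm_sq, hu, hxi] at this
  have h0 : (0 : ℝ) < s := hs0
  linarith

lemma sum_hausdorffMeasure_face (hu : ∀ i, ‖u i‖ = 1) :
    ∑ i, μH[1] (face u h i) = μH[1] (frontier (poly u h)) := by
  have : frontier (poly u h) = ⋃ i, face u h i :=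
    frontier_poly_subset.antisymm (Set.iUnion_subset (face_subset_frontier hu))
  rw [this, measure_iUnion pairwise_disjoint_face measurableSet_face, tsum_fintype]

/-- The inner tube of width `t` of a polygon has area at most `t` times the perimeter. -/
lemma volume_inner_tube_poly_le (hu : ∀ i, ‖u i‖ = 1) (hne : (poly u h)ᶜ.Nonempty) {t : ℝ}
    (ht : 0 < t) :
    volume {x | x ∈ poly u h ∧ infDist x (poly u h)ᶜ ≤ t} ≤
      μH[1] (frontier (poly u h)) * ENNReal.ofReal t := by
  set P := poly u h with hP
  have hsub : {x | x ∈ P ∧ infDist x Pᶜ ≤ t} ⊆ ⋃ i, sweep (face u h i) (t • u i) := by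
    rintro x ⟨hxP, hxt⟩
    set d := infDist x Pᶜ with hd
    have hd0 : 0 ≤ d := infDist_nonneg
    have hball : ball x d ⊆ P := by
      have := ball_infDist_compl_subset (s := P) (x := x)
      exact this
    obtain ⟨y, hyc, hy⟩ := isClosed_closure.exists_infDist_eq_dist (hne.closure) x
    rw [infDist_closure, ← hd] at hy
    have hyP : y ∈ P := by
      rcases hd0.eq_or_lt with h0 | h0
      · rw [← h0] at hy
        rwa [← dist_eq_zero.1 hy.symm]
      · have : y ∈ closure (ball x d) := by
          rw [closure_ball x h0.ne', mem_closedBall, dist_comm, hy]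
        exact closure_minimal hball isClosed_poly this
    have hyf : y ∈ frontier P := by
      rw [frontier_eq_closure_inter_closure]
      exact ⟨subset_closure hyP, hyc⟩
    obtain ⟨i, hi⟩ := Set.mem_iUnion.1 (frontier_poly_subset hyf)
    have hinner : d ≤ inner ℝ (u i) (y - x) := by
      refine le_of_forall_lt fun s hs => ?_
      rcases lt_or_ge s 0 with hneg | hpos
      · have : inner ℝ (u i) x ≤ h i := hxP i
        rw [inner_sub_right, hi.2.1]
        linarith
      · obtain ⟨s', hs', hs'd⟩ := exists_between hs
        have : x + s' • u i ∈ P := hball (by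
          rw [mem_ball, dist_eq_norm, add_sub_cancel_left, norm_smul, hu, mul_one,
            Real.norm_of_nonneg (hpos.trans hs'.le)]
          exact hs'd)
        have h1 := this i
        rw [inner_add_right, inner_smul_right, real_inner_self_eq_norm_sq, hu] at h1
        rw [inner_sub_right, hi.2.1]
        linarith
    have hyx : y = x + d • u i := by
      have h2 : ‖y - x - d • u i‖ ^ 2 ≤ 0 := by
        rw [norm_sub_sq_real, norm_smul, hu, inner_smul_right, real_inner_comm,
          ← dist_eq_norm, dist_comm, ← hy, Real.norm_of_nonneg hd0]
        nlinarith
      have h3 : y - x - d • u i = 0 := by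
        rw [← norm_eq_zero]
        exact pow_eq_zero_iff (two_ne_zero) |>.1 (le_antisymm h2 (sq_nonneg _))
      rw [sub_sub, sub_eq_zero] at h3
      exact h3
    refine Set.mem_iUnion.2 ⟨i, d / t, ⟨by positivity, (div_le_one ht).2 hxt⟩, ?_⟩
    rw [smul_smul, div_mul_cancel₀ _ ht.ne', ← hyx]
    exact hi
  refine (measure_mono hsub).trans ((measure_iUnion_le _).trans ?_)
  rw [tsum_fintype, ← sum_hausdorffMeasure_face hu, Finset.sum_mul]
  refine Finset.sum_le_sum fun i _ => ?_
  have h1 : inner ℝ (u i) (t • u i) = t := by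
    rw [inner_smul_right, real_inner_self_eq_norm_sq, hu]; ring
  have := volume_sweep_le (hu i) (measurableSet_face (u := u) (h := h) i)
    inner_eq_of_mem_face (t • u i) (by rw [h1]; exact ht.le)
  rwa [h1] at this

lemma exists_mem_frontier_of_segment {S : Set Plane} {x z : Plane} (hx : x ∈ S)
    (hz : x + z ∉ S) : ∃ s ∈ Set.Icc (0 : ℝ) 1, x + s • z ∈ frontier S := by
  have hc : Continuous fun s : ℝ => x + s • z := by fun_prop
  by_contra hcon
  push Not at hcon
  have hpre := (isPreconnected_Icc (a := (0 : ℝ)) (b := 1)).image _ hc.continuousOn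
  have h1 : (fun s : ℝ => x + s • z) '' Set.Icc 0 1 ⊆ interior S ∪ (closure S)ᶜ := by
    rintro _ ⟨s, hs, rfl⟩
    by_contra h'
    simp only [Set.mem_union, Set.mem_compl_iff, not_or, not_not] at h'
    exact hcon s hs ⟨h'.2, h'.1⟩
  obtain ⟨w, -, hw1, hw2⟩ := hpre _ _ isOpen_interior isClosed_closure.isOpen_compl h1
    ⟨x, ⟨0, by simp, by simp⟩, by
      rcases h1 ⟨0, by simp, rfl⟩ with h | h
      · simpa using h
      · exact absurd (subset_closure hx) (by simpa using h)⟩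
    ⟨x + z, ⟨1, by simp, by simp⟩, by
      rcases h1 ⟨1, by simp, rfl⟩ with h | h
      · exact absurd (interior_subset h) (by simpa using hz)
      · simpa using h⟩
  exact hw2 (subset_closure (interior_subset hw1))

/-- The part of a polygon which leaves it under the translation by `z`. -/
lemma volume_translate_exit_poly_le (hu : ∀ i, ‖u i‖ = 1) (z : Plane) :
    volume {x | x ∈ poly u h ∧ x + z ∉ poly u h} ≤
      ∑ i, μH[1] (face u h i) * ENNReal.ofReal (inner ℝ (u i) z) := by
  classical
  set w : Fin m → Plane := fun i => if 0 ≤ inner ℝ (u i) z then z else 0 with hw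
  have hsub : {x | x ∈ poly u h ∧ x + z ∉ poly u h} ⊆ ⋃ i, sweep (face u h i) (w i) := by
    rintro x ⟨hx, hxz⟩
    obtain ⟨s, hs, hsf⟩ := exists_mem_frontier_of_segment hx hxz
    obtain ⟨i, hi⟩ := Set.mem_iUnion.1 (frontier_poly_subset hsf)
    refine Set.mem_iUnion.2 ⟨i, s, hs, ?_⟩
    by_cases hpos : 0 ≤ inner ℝ (u i) z
    · simpa [hw, hpos] using hi
    · have h1 := hi.2.1
      rw [inner_add_right, inner_smul_right] at h1
      have h2 := hx i
      have h0 : s = 0 := by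
        rcases hs.1.eq_or_lt with h | h
        · exact h.symm
        · nlinarith
      simpa [hw, h0] using hi
  refine (measure_mono hsub).trans ((measure_iUnion_le _).trans ?_)
  rw [tsum_fintype]
  refine Finset.sum_le_sum fun i _ => ?_
  by_cases hpos : 0 ≤ inner ℝ (u i) z
  · have := volume_sweep_le (hu i) (measurableSet_face (u := u) (h := h) i)
      inner_eq_of_mem_face z hpos
    simpa [hw, hpos] using this
  · have := volume_sweep_le (hu i) (measurableSet_face (u := u) (h := h) i)
      inner_eq_of_mem_face 0 (by simp)
    rw [inner_zero_right, ENNReal.ofReal_zero, mul_zero] at this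
    simp only [hw, hpos, if_false]
    exact this.trans (by simp)

lemma volume_face (hu : ∀ i, ‖u i‖ = 1) (i : Fin m) : volume (face u h i) = 0 := by
  have := volume_sweep_le (hu i) (measurableSet_face (u := u) (h := h) i)
    inner_eq_of_mem_face 0 (by simp)
  rw [inner_zero_right, ENNReal.ofReal_zero, mul_zero] at this
  refine measure_mono_null (fun x hx => ?_) (nonpos_iff_eq_zero.1 this)
  exact ⟨0, by simp, by simpa using hx⟩

lemma eq_of_nearest {K : Set Plane} {x y y' : Plane} (hy : y ∈ K) (hy' : y' ∈ K)
    (h1 : ∀ w ∈ K, inner ℝ (x - y) (w - y) ≤ 0) (h2 : ∀ w ∈ K, inner ℝ (x - y') (w - y') ≤ 0) :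
    y = y' := by
  have a := h1 y' hy'
  have b := h2 y hy
  have : ‖y - y'‖ ^ 2 ≤ 0 := by
    rw [← real_inner_self_eq_norm_sq]
    have : inner ℝ (y - y') (y - y') = inner ℝ (x - y) (y' - y) + inner ℝ (x - y') (y - y') := by
      simp only [inner_sub_left, inner_sub_right]; ring
    linarith
  rw [← sub_eq_zero, ← norm_eq_zero]
  exact pow_eq_zero_iff two_ne_zero |>.1 (le_antisymm this (sq_nonneg _))

/-- The outer parallel set of a polygon gains at least `t` times the perimeter. -/
lemma le_volume_cthickening_poly (hu : ∀ i, ‖u i‖ = 1) (t : ℝ) :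
    volume (poly u h) + μH[1] (frontier (poly u h)) * ENNReal.ofReal t ≤
      volume (cthickening t (poly u h)) := by
  set R : Fin m → Set Plane := fun i => rect (face u h i) (u i) t \ face u h i with hR
  have hRm : ∀ i, MeasurableSet (R i) := fun i =>
    (measurableSet_rect (hu i) (measurableSet_face i) inner_eq_of_mem_face t).diff
      (measurableSet_face i)
  have hRv : ∀ i, volume (R i) = μH[1] (face u h i) * ENNReal.ofReal t := fun i => by
    rw [hR]
    simp only
    rw [measure_sdiff_null (volume_face hu i),
      volume_rect (hu i) (measurableSet_face i) inner_eq_of_mem_face]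
  have hnear : ∀ i, ∀ y ∈ face u h i, ∀ s : ℝ, 0 ≤ s → ∀ w ∈ poly u h,
      inner ℝ (y + s • u i - y) (w - y) ≤ 0 := by
    intro i y hy s hs w hw
    have h1 := hw i
    rw [add_sub_cancel_left, real_inner_smul_left, inner_sub_right, hy.2.1]
    nlinarith
  have hRd : Pairwise (Function.onFun Disjoint R) := by
    intro i j hij
    rw [Function.onFun, Set.disjoint_left]
    rintro x ⟨⟨y, hy, s, hs, rfl⟩, -⟩ ⟨⟨y', hy', s', hs', hx'⟩, -⟩
    have : y = y' := eq_of_nearest hy.1 hy'.1 (hnear i y hy s hs.1)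
      (by rw [hx']; exact hnear j y' hy' s' hs'.1)
    subst this
    exact Set.disjoint_left.1 (pairwise_disjoint_face hij) hy hy'
  have hPR : Disjoint (poly u h) (⋃ i, R i) := by
    rw [Set.disjoint_left]
    intro x hx hxR
    obtain ⟨i, ⟨y, hy, s, hs, rfl⟩, hn⟩ := Set.mem_iUnion.1 hxR
    have h1 := hx i
    rw [inner_add_right, inner_smul_right, real_inner_self_eq_norm_sq, hu, hy.2.1] at h1
    have h0 : s = 0 := le_antisymm (by linarith) hs.1
    exact hn (by simpa [h0] using hy)
  calc volume (poly u h) + μH[1] (frontier (poly u h)) * ENNReal.ofReal t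
      = volume (poly u h ∪ ⋃ i, R i) := by
        rw [measure_union hPR (MeasurableSet.iUnion hRm), measure_iUnion hRd hRm, tsum_fintype,
          ← sum_hausdorffMeasure_face hu, Finset.sum_mul]
        simp [hRv]
    _ ≤ volume (cthickening t (poly u h)) := by
        refine measure_mono (Set.union_subset (self_subset_cthickening _) ?_)
        refine Set.iUnion_subset fun i => ?_
        rintro x ⟨⟨y, hy, s, hs, rfl⟩, -⟩
        refine mem_cthickening_of_dist_le _ y _ _ hy.1 ?_
        rw [dist_eq_norm, add_sub_cancel_left, norm_smul, hu, mul_one, Real.norm_of_nonneg hs.1]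
        exact hs.2

end Polygon

variable {K : Set Plane}

lemma exists_unit_of_strongDual (f : StrongDual ℝ Plane) (hf : f ≠ 0) :
    ∃ u : Plane, ‖u‖ = 1 ∧ ∃ c : ℝ, 0 < c ∧ ∀ x, f x = c * inner ℝ u x := by
  set v := (InnerProductSpace.toDual ℝ Plane).symm f with hv
  have hv0 : v ≠ 0 := by simpa [hv] using hf
  have hn : 0 < ‖v‖ := norm_pos_iff.2 hv0
  refine ⟨‖v‖⁻¹ • v, by rw [norm_smul, norm_inv, norm_norm, inv_mul_cancel₀ hn.ne'], ‖v‖, hn,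
    fun x => ?_⟩
  rw [real_inner_smul_left, ← mul_assoc, mul_inv_cancel₀ hn.ne', one_mul, hv,
    InnerProductSpace.toDual_symm_apply]

lemma exists_supporting (hK : Convex ℝ K) (hi : (interior K).Nonempty) {y : Plane}
    (hy : y ∉ interior K) :
    ∃ u : Plane, ‖u‖ = 1 ∧ ∀ w ∈ K, inner ℝ u w ≤ inner ℝ u y := by
  obtain ⟨f, hf⟩ := geometric_hahn_banach_open_point hK.interior isOpen_interior hy
  obtain ⟨q, hq⟩ := hi
  have hf0 : f ≠ 0 := by
    rintro rfl
    simpa using hf q hq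
  obtain ⟨u, hu, c, hc, hfu⟩ := exists_unit_of_strongDual f hf0
  refine ⟨u, hu, fun w hw => ?_⟩
  have hcl : w ∈ closure (interior K) := by
    rw [hK.closure_interior_eq_closure_of_nonempty_interior ⟨q, hq⟩]
    exact subset_closure hw
  have : closure (interior K) ⊆ {w | inner ℝ u w ≤ inner ℝ u y} := by
    refine closure_minimal (fun a ha => ?_) (isClosed_le (by fun_prop) continuous_const)
    have := hf a ha
    rw [hfu, hfu] at this
    exact (lt_of_mul_lt_mul_left this hc.le).le
  exact this hcl

lemma exists_separating (hK : Convex ℝ K) (hcl : IsClosed K) (hne : K.Nonempty) {y : Plane}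
    (hy : y ∉ K) :
    ∃ u : Plane, ‖u‖ = 1 ∧ ∃ c : ℝ, (∀ w ∈ K, inner ℝ u w ≤ c) ∧ c < inner ℝ u y := by
  obtain ⟨f, b, hf, hb⟩ := geometric_hahn_banach_closed_point hK hcl hy
  obtain ⟨q, hq⟩ := hne
  have hf0 : f ≠ 0 := by
    rintro rfl
    have := (hf q hq).trans hb
    simp at this
  obtain ⟨u, hu, c, hc, hfu⟩ := exists_unit_of_strongDual f hf0
  refine ⟨u, hu, b / c, fun w hw => ?_, ?_⟩
  · rw [le_div_iff₀ hc, mul_comm, ← hfu]; exact (hf w hw).le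
  · rw [div_lt_iff₀ hc, mul_comm, ← hfu]; exact hb

/-- Among convex sets, the perimeter is monotone. -/
lemma hausdorffMeasure_frontier_mono {K' : Set Plane} (hK : Convex ℝ K) (hcl : IsClosed K)
    (hi : (interior K).Nonempty) (hK' : IsCompact K') (hsub : K ⊆ K') :
    μH[1] (frontier K) ≤ μH[1] (frontier K') := by
  have hne : K.Nonempty := hi.mono interior_subset
  have hex : ∀ x : Plane, ∃ y ∈ K, ∀ w ∈ K, inner ℝ (x - y) (w - y) ≤ 0 := by
    intro x
    obtain ⟨y, hy, hy'⟩ := exists_norm_eq_iInf_of_complete_convex hne hcl.isComplete hK x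
    exact ⟨y, hy, (norm_eq_iInf_iff_real_inner_le_zero hK hy).1 hy'⟩
  choose p hpK hp using hex
  have hlip : LipschitzWith 1 p := by
    refine LipschitzWith.of_dist_le_mul fun x y => ?_
    rw [NNReal.coe_one, one_mul, dist_eq_norm, dist_eq_norm]
    have h1 := hp x (p y) (hpK y)
    have h2 := hp y (p x) (hpK x)
    have h3 : ‖p x - p y‖ * ‖p x - p y‖ ≤ ‖x - y‖ * ‖p x - p y‖ := by
      refine le_trans ?_ (real_inner_le_norm (x - y) (p x - p y))
      rw [← real_inner_self_eq_norm_mul_norm]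
      simp only [inner_sub_left, inner_sub_right] at h1 h2 ⊢
      linarith
    rcases (norm_nonneg (p x - p y)).eq_or_lt with h0 | h0
    · rw [← h0]; exact norm_nonneg _
    · exact le_of_mul_le_mul_right h3 h0
  have himg : frontier K ⊆ p '' frontier K' := by
    intro y hy
    rw [hcl.frontier_eq] at hy
    obtain ⟨u, hu, hsup⟩ := exists_supporting hK hi hy.2
    have hcont : Continuous fun s : ℝ => y + s • u := by fun_prop
    set S : Set ℝ := Set.Ici 0 ∩ (fun s : ℝ => y + s • u) ⁻¹' K' with hS
    have hScl : IsClosed S := isClosed_Ici.inter (hK'.isClosed.preimage hcont)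
    obtain ⟨R, hR⟩ := hK'.isBounded.exists_norm_le
    have hSb : BddAbove S := by
      refine ⟨R + ‖y‖, fun s hs => ?_⟩
      have h1 := hR _ hs.2
      have h2 : ‖s • u‖ ≤ ‖y + s • u‖ + ‖y‖ := by
        simpa using norm_sub_le (y + s • u) y
      rw [norm_smul, hu, mul_one] at h2
      exact (le_abs_self s).trans (h2.trans (by gcongr))
    have hSne : S.Nonempty := ⟨0, by simp, by simpa using hsub hy.1⟩
    have hmem := hScl.csSup_mem hSne hSb
    set s := sSup S
    have hs0 : 0 ≤ s := hmem.1
    refine ⟨y + s • u, ?_, ?_⟩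
    · rw [hK'.isClosed.frontier_eq]
      refine ⟨hmem.2, fun hint => ?_⟩
      have hev : ∀ᶠ s' in 𝓝[>] s, y + s' • u ∈ K' :=
        ((hcont.tendsto s).mono_left nhdsWithin_le_nhds).eventually
          (mem_interior_iff_mem_nhds.1 hint)
      obtain ⟨s', h1, h2⟩ := (hev.and self_mem_nhdsWithin).exists
      have h2' : s < s' := h2
      exact (le_csSup hSb ⟨hs0.trans h2'.le, h1⟩).not_gt h2'
    · refine eq_of_nearest (hpK _) hy.1 (hp _) fun w hw => ?_
      rw [add_sub_cancel_left, real_inner_smul_left, inner_sub_right]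
      nlinarith [hsup w hw]
  calc μH[1] (frontier K) ≤ μH[1] (p '' frontier K') := measure_mono himg
    _ ≤ μH[1] (frontier K') := by
      simpa using hlip.hausdorffMeasure_image_le zero_le_one (frontier _)

/-- The homothety of centre `p` and nonzero ratio `c`, as a homeomorphism. -/
noncomputable def homothetyHomeomorph (p : Plane) (c : ℝ) (hc : c ≠ 0) : Plane ≃ₜ Plane where
  toFun := AffineMap.homothety p c
  invFun := AffineMap.homothety p c⁻¹
  left_inv x := by simp [AffineMap.homothety_apply, smul_smul, hc]
  right_inv x := by simp [AffineMap.homothety_apply, smul_smul, hc]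
  continuous_toFun := AffineMap.homothety_continuous p c
  continuous_invFun := AffineMap.homothety_continuous p c⁻¹

lemma hausdorffMeasure_frontier_homothety (p : Plane) {c : ℝ} (hc : 0 < c) (K : Set Plane) :
    μH[1] (frontier (AffineMap.homothety p c '' K)) = ENNReal.ofReal c * μH[1] (frontier K) := by
  have h1 : frontier (AffineMap.homothety p c '' K) = AffineMap.homothety p c '' frontier K :=
    ((homothetyHomeomorph p c hc.ne').image_frontier K).symm
  rw [h1, hausdorffMeasure_homothety_image zero_le_one p hc.ne', NNReal.rpow_one,
    ENNReal.smul_def, smul_eq_mul]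
  congr 1
  rw [← enorm_eq_nnnorm, Real.enorm_eq_ofReal hc.le]

lemma homothety_eq (p : Plane) (c : ℝ) (x : Plane) :
    AffineMap.homothety p c x = c • (x - p) + p := by
  simp [AffineMap.homothety_apply]

lemma mem_homothety_image {p : Plane} {c : ℝ} (hc : c ≠ 0) {x : Plane} :
    x ∈ AffineMap.homothety p c '' K ↔ AffineMap.homothety p c⁻¹ x ∈ K := by
  constructor
  · rintro ⟨y, hy, rfl⟩
    rwa [show AffineMap.homothety p c⁻¹ (AffineMap.homothety p c y) = y from
      (homothetyHomeomorph p c hc).left_inv y]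
  · intro h
    exact ⟨_, h, (homothetyHomeomorph p c hc).right_inv x⟩

lemma ball_homothety_subset (hK : Convex ℝ K) {p : Plane} {ρ : ℝ} (hb : ball p ρ ⊆ K)
    {τ : ℝ} (h0 : 0 < τ) (h1 : τ ≤ 1) {x : Plane} (hx : x ∈ K) :
    ball (AffineMap.homothety p (1 - τ) x) (τ * ρ) ⊆ K := by
  intro y hy
  rw [mem_ball, dist_eq_norm, homothety_eq] at hy
  set v := y - ((1 - τ) • (x - p) + p) with hv
  have hq : p + τ⁻¹ • v ∈ K := hb (by
    rw [mem_ball, dist_eq_norm, add_sub_cancel_left, norm_smul, norm_inv,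
      Real.norm_of_nonneg h0.le, inv_mul_lt_iff₀ h0]
    exact hy)
  have := hK hx hq (sub_nonneg.2 h1) h0.le (by ring)
  convert this using 1
  rw [smul_add, smul_smul, mul_inv_cancel₀ h0.ne', hv]
  module

/-- A convex body is approximated from outside by polygons. -/
lemma exists_poly_approx (hK : Convex ℝ K) (hc : IsCompact K) {p : Plane} {ρ : ℝ} (hρ : 0 < ρ)
    (hb : ball p ρ ⊆ K) {ε : ℝ} (hε : 0 < ε) :
    ∃ (m : ℕ) (u : Fin m → Plane) (h : Fin m → ℝ), (∀ i, ‖u i‖ = 1) ∧ K ⊆ poly u h ∧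
      poly u h ⊆ AffineMap.homothety p (1 + ε) '' K := by
  have h1ε : (0 : ℝ) < 1 + ε := by linarith
  have hpK : p ∈ K := hb (mem_ball_self hρ)
  set K' := AffineMap.homothety p (1 + ε) '' K with hK'
  have hK'c : IsCompact K' := hc.image (AffineMap.homothety_continuous p _)
  have hint : ∀ x ∈ K, x ∈ interior K' := by
    intro x hx
    rw [mem_interior]
    refine ⟨ball x (ε * ρ), fun y hy => ?_, isOpen_ball, mem_ball_self (by positivity)⟩
    rw [hK', mem_homothety_image h1ε.ne']
    have hτ1 : ε / (1 + ε) ≤ 1 := (div_le_one h1ε).2 (by linarith)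
    refine ball_homothety_subset hK hb (div_pos hε h1ε) hτ1 hx ?_
    have h2 : 1 - ε / (1 + ε) = (1 + ε)⁻¹ := by field_simp; ring
    rw [h2, mem_ball, dist_eq_norm, homothety_eq, homothety_eq]
    have h3 : (1 + ε)⁻¹ • (y - p) + p - ((1 + ε)⁻¹ • (x - p) + p) = (1 + ε)⁻¹ • (y - x) := by
      module
    rw [h3, norm_smul, norm_inv, Real.norm_of_nonneg h1ε.le, ← dist_eq_norm]
    have := mem_ball.1 hy
    calc (1 + ε)⁻¹ * dist y x < (1 + ε)⁻¹ * (ε * ρ) := by gcongr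
      _ = ε / (1 + ε) * ρ := by ring
  let I := {q : Plane × ℝ // ‖q.1‖ = 1 ∧ ∀ w ∈ K, inner ℝ q.1 w ≤ q.2}
  obtain ⟨t, ht⟩ := (hK'c.of_isClosed_subset isClosed_frontier
      hK'c.isClosed.frontier_subset).elim_finite_subcover
    (fun q : I => {y : Plane | q.1.2 < inner ℝ q.1.1 y})
    (fun q => isOpen_lt continuous_const (by fun_prop))
    (fun y hy => by
      have hyK : y ∉ K := fun h => hy.2 (hint y h)
      obtain ⟨u, hu, c, hcK, hcy⟩ := exists_separating hK hc.isClosed ⟨p, hpK⟩ hyK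
      exact Set.mem_iUnion.2 ⟨⟨(u, c), hu, hcK⟩, hcy⟩)
  refine ⟨t.card, fun i => (t.equivFin.symm i).1.1.1, fun i => (t.equivFin.symm i).1.1.2,
    fun i => (t.equivFin.symm i).1.2.1, fun w hw i => (t.equivFin.symm i).1.2.2 w hw, ?_⟩
  set P := poly (fun i => (t.equivFin.symm i).1.1.1) (fun i => (t.equivFin.symm i).1.1.2) with hP
  have hKP : K ⊆ P := fun w hw i => (t.equivFin.symm i).1.2.2 w hw
  intro x hx
  by_contra hxK'
  obtain ⟨s, hs, hsf⟩ := exists_mem_frontier_of_segment (x := p) (z := x - p)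
    (interior_subset (hint p hpK)) (by rwa [add_sub_cancel])
  have hsP : p + s • (x - p) ∈ P := by
    have := convex_poly (hKP hpK) hx (sub_nonneg.2 hs.2) hs.1 (by ring)
    convert this using 1
    module
  obtain ⟨q, hq, hlt⟩ := Set.mem_iUnion₂.1 (ht hsf)
  have h4 := hsP (t.equivFin ⟨q, hq⟩)
  simp only [Equiv.symm_apply_apply] at h4
  exact h4.not_gt hlt

lemma perimeter_poly_ne_top {m : ℕ} {u : Fin m → Plane} {h : Fin m → ℝ} (hu : ∀ i, ‖u i‖ = 1)
    (hb : Bornology.IsBounded (poly u h)) : μH[1] (frontier (poly u h)) ≠ ⊤ := by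
  have h1 := le_volume_cthickening_poly (h := h) hu 1
  have h2 : volume (cthickening 1 (poly u h)) < ⊤ := hb.cthickening.measure_lt_top
  rw [ENNReal.ofReal_one, mul_one] at h1
  exact ((le_add_self.trans h1).trans_lt h2).ne

lemma exists_poly_approx_perimeter (hK : Convex ℝ K) (hc : IsCompact K) {p : Plane} {ρ : ℝ}
    (hρ : 0 < ρ) (hb : ball p ρ ⊆ K) {ε : ℝ} (hε : 0 < ε) :
    ∃ (m : ℕ) (u : Fin m → Plane) (h : Fin m → ℝ), (∀ i, ‖u i‖ = 1) ∧ K ⊆ poly u h ∧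
      poly u h ⊆ AffineMap.homothety p (1 + ε) '' K ∧ IsCompact (poly u h) ∧
      μH[1] (frontier K) ≤ μH[1] (frontier (poly u h)) ∧
      μH[1] (frontier (poly u h)) ≤ ENNReal.ofReal (1 + ε) * μH[1] (frontier K) := by
  obtain ⟨m, u, h, hu, hKP, hPK⟩ := exists_poly_approx hK hc hρ hb hε
  have hK'c : IsCompact (AffineMap.homothety p (1 + ε) '' K) :=
    hc.image (AffineMap.homothety_continuous p _)
  have hPc : IsCompact (poly u h) := hK'c.of_isClosed_subset isClosed_poly hPK
  have hint : (interior K).Nonempty := ⟨p, mem_interior.2 ⟨_, hb, isOpen_ball, mem_ball_self hρ⟩⟩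
  refine ⟨m, u, h, hu, hKP, hPK, hPc,
    hausdorffMeasure_frontier_mono hK hc.isClosed hint hPc hKP, ?_⟩
  rw [← hausdorffMeasure_frontier_homothety p (by linarith)]
  exact hausdorffMeasure_frontier_mono convex_poly isClosed_poly
    (hint.mono (interior_mono hKP)) hK'c hPK

lemma perimeter_ne_top (hK : Convex ℝ K) (hc : IsCompact K) {p : Plane} {ρ : ℝ}
    (hρ : 0 < ρ) (hb : ball p ρ ⊆ K) : μH[1] (frontier K) ≠ ⊤ := by
  obtain ⟨m, u, h, hu, -, -, hPc, hle, -⟩ := exists_poly_approx_perimeter hK hc hρ hb one_pos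
  exact ne_top_of_le_ne_top (perimeter_poly_ne_top hu hPc.isBounded) hle

/-- The inner tube of width `t` of a convex body has area at most `t` times the perimeter. -/
lemma volume_inner_tube_le (hK : Convex ℝ K) (hc : IsCompact K) {p : Plane} {ρ : ℝ}
    (hρ : 0 < ρ) (hb : ball p ρ ⊆ K) {t : ℝ} (ht : 0 ≤ t) :
    volume {x | x ∈ K ∧ infDist x Kᶜ ≤ t} ≤ μH[1] (frontier K) * ENNReal.ofReal t := by
  obtain ⟨D, hD⟩ := hc.isBounded.subset_closedBall p
  have hpK : p ∈ K := hb (mem_ball_self hρ)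
  have hD0 : 0 ≤ D := by simpa using hD hpK
  have hfin := perimeter_ne_top hK hc hρ hb
  set l := μH[1] (frontier K) with hl
  have key : ∀ ε : ℝ, 0 < ε → volume {x | x ∈ K ∧ infDist x Kᶜ ≤ t} ≤
      ENNReal.ofReal ((1 + ε) * l.toReal * (t + ε + ε * (t + ε + D))) := by
    intro ε hε
    obtain ⟨m, u, h, hu, hKP, hPK, hPc, -, hle⟩ := exists_poly_approx_perimeter hK hc hρ hb hε
    have hsub : {x | x ∈ K ∧ infDist x Kᶜ ≤ t} ⊆
        {x | x ∈ poly u h ∧ infDist x (poly u h)ᶜ ≤ t + ε + ε * (t + ε + D)} := by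
      rintro x ⟨hx, hxt⟩
      refine ⟨hKP hx, ?_⟩
      have hne : Kᶜ.Nonempty := Set.nonempty_compl.2 hc.ne_univ
      obtain ⟨y, hyK, hy⟩ := (infDist_lt_iff hne).1 (hxt.trans_lt (lt_add_of_pos_right t hε))
      have hy' : AffineMap.homothety p (1 + ε) y ∈ (poly u h)ᶜ := by
        intro hmem
        obtain ⟨y₂, hy₂, he⟩ := hPK hmem
        rw [(homothetyHomeomorph p (1 + ε) (by positivity)).injective he] at hy₂
        exact hyK hy₂
      refine (infDist_le_dist_of_mem hy').trans ?_
      have h1 : dist y (AffineMap.homothety p (1 + ε) y) = ε * dist y p := by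
        rw [dist_eq_norm, homothety_eq, dist_eq_norm,
          show y - ((1 + ε) • (y - p) + p) = -(ε • (y - p)) by module, norm_neg, norm_smul,
          Real.norm_of_nonneg hε.le]
      have h2 : dist y p ≤ t + ε + D := by
        have h3 := dist_triangle_left y p x
        have h4 : dist x p ≤ D := hD hx
        linarith
      calc dist x _ ≤ dist x y + dist y (AffineMap.homothety p (1 + ε) y) := dist_triangle _ _ _
        _ ≤ _ := by rw [h1]; gcongr
    refine (measure_mono hsub).trans ((volume_inner_tube_poly_le hu
      (Set.nonempty_compl.2 hPc.ne_univ) (by positivity)).trans ?_)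
    rw [ENNReal.ofReal_mul (by positivity), ENNReal.ofReal_mul (by positivity),
      ENNReal.ofReal_toReal hfin]
    gcongr
  have hlim : Tendsto (fun ε : ℝ =>
      ENNReal.ofReal ((1 + ε) * l.toReal * (t + ε + ε * (t + ε + D)))) (𝓝[>] 0)
      (𝓝 (l * ENNReal.ofReal t)) := by
    have hcont : Continuous fun ε : ℝ =>
      ENNReal.ofReal ((1 + ε) * l.toReal * (t + ε + ε * (t + ε + D))) :=
      ENNReal.continuous_ofReal.comp (by fun_prop)
    have := (hcont.tendsto 0).mono_left (nhdsWithin_le_nhds (s := Set.Ioi 0))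
    simpa [ENNReal.ofReal_mul, ENNReal.ofReal_toReal hfin] using this
  exact ge_of_tendsto hlim (eventually_mem_nhdsWithin.mono fun ε hε => key ε hε)

/-- The outer parallel set of a convex body gains at least `t` times the perimeter. -/
lemma le_volume_thickening (hK : Convex ℝ K) (hc : IsCompact K) {p : Plane} {ρ : ℝ}
    (hρ : 0 < ρ) (hb : ball p ρ ⊆ K) {t : ℝ} (ht : 0 < t) :
    volume K + μH[1] (frontier K) * ENNReal.ofReal t ≤ volume (thickening t K) := by
  obtain ⟨D, hD⟩ := hc.isBounded.subset_closedBall p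
  have hpK : p ∈ K := hb (mem_ball_self hρ)
  have hD0 : 0 ≤ D := by simpa using hD hpK
  have hfin := perimeter_ne_top hK hc hρ hb
  have key : ∀ s : ℝ, 0 ≤ s → s < t →
      volume K + μH[1] (frontier K) * ENNReal.ofReal s ≤ volume (thickening t K) := by
    intro s hs hst
    set ε := (t - s) / (2 * (D + 1)) with hε
    have hε0 : 0 < ε := div_pos (by linarith) (by linarith)
    have hεD : s + ε * D < t := by
      have : ε * (2 * (D + 1)) = t - s := by rw [hε]; field_simp
      nlinarith
    obtain ⟨m, u, h, hu, hKP, hPK, hPc, hle, -⟩ := exists_poly_approx_perimeter hK hc hρ hb hε0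
    have hsub : poly u h ⊆ cthickening (ε * D) K := by
      intro x hx
      obtain ⟨y, hy, rfl⟩ := hPK hx
      refine mem_cthickening_of_dist_le _ y _ _ hy ?_
      rw [dist_eq_norm, homothety_eq, show (1 + ε) • (y - p) + p - y = ε • (y - p) by module,
        norm_smul, Real.norm_of_nonneg hε0.le, ← dist_eq_norm]
      gcongr
      exact hD hy
    calc volume K + μH[1] (frontier K) * ENNReal.ofReal s
        ≤ volume (poly u h) + μH[1] (frontier (poly u h)) * ENNReal.ofReal s := by gcongr
      _ ≤ volume (cthickening s (poly u h)) := le_volume_cthickening_poly hu s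
      _ ≤ volume (thickening t K) := by
        refine measure_mono ((cthickening_subset_of_subset s hsub).trans
          ((cthickening_cthickening_subset hs (by positivity) K).trans
          (cthickening_subset_thickening' ht hεD K)))
  have hlim : Tendsto (fun s : ℝ => volume K + μH[1] (frontier K) * ENNReal.ofReal s) (𝓝[<] t)
      (𝓝 (volume K + μH[1] (frontier K) * ENNReal.ofReal t)) := by
    refine tendsto_const_nhds.add (ENNReal.Tendsto.const_mul ?_ (Or.inr hfin))
    exact (ENNReal.continuous_ofReal.tendsto t).mono_left nhdsWithin_le_nhds
  refine le_of_tendsto hlim ?_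
  filter_upwards [Ioo_mem_nhdsLT ht] with s hs using key s hs.1.le hs.2

/-- The inner tube of width `t` of a convex body of inradius at least `ρ` has area at least
`(1 - t / ρ) t` times the perimeter. -/
lemma le_volume_inner_tube (hK : Convex ℝ K) (hc : IsCompact K) {p : Plane} {ρ : ℝ}
    (hρ : 0 < ρ) (hb : ball p ρ ⊆ K) {t : ℝ} (ht : 0 < t) (htρ : t < ρ) :
    μH[1] (frontier K) * ENNReal.ofReal ((1 - t / ρ) * t) ≤
      volume {x | x ∈ K ∧ infDist x Kᶜ < t} := by
  have hne : Kᶜ.Nonempty := Set.nonempty_compl.2 hc.ne_univ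
  set Q : Set Plane := {x | t ≤ infDist x Kᶜ} with hQ
  have hQb : ∀ x, x ∈ Q ↔ ball x t ⊆ K := by
    intro x
    constructor
    · intro hx
      exact (ball_subset_ball hx).trans (ball_infDist_compl_subset (s := K) (x := x))
    · intro hx
      by_contra hlt
      obtain ⟨y, hy, hyx⟩ := (infDist_lt_iff hne).1 (not_le.1 hlt)
      exact hy (hx (by rwa [mem_ball, dist_comm]))
  have hQK : Q ⊆ K := fun x hx => (hQb x).1 hx (mem_ball_self ht)
  have hQcl : IsClosed Q := isClosed_le continuous_const (continuous_infDist_pt _)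
  have hQc : IsCompact Q := hc.of_isClosed_subset hQcl hQK
  have hQconv : Convex ℝ Q := by
    intro x hx y hy a b ha hb' hab
    rw [hQb] at hx hy ⊢
    intro w hw
    set v := w - (a • x + b • y) with hv
    have hvt : ‖v‖ < t := by rw [hv, ← dist_eq_norm]; exact hw
    have h1 : x + v ∈ K := hx (by simpa using hvt)
    have h2 : y + v ∈ K := hy (by simpa using hvt)
    have h3 := hK h1 h2 ha hb' hab
    convert h3 using 1
    have h4 : v = (a + b) • v := by rw [hab, one_smul]
    calc w = a • x + b • y + v := by rw [hv]; abel
      _ = a • x + b • y + (a + b) • v := by rw [← h4]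
      _ = _ := by module
  have hQball : ball p (ρ - t) ⊆ Q := by
    intro x hx
    rw [hQb]
    exact (ball_subset_ball' (by have := mem_ball.1 hx; linarith)).trans hb
  have hthick : thickening t Q ⊆ K := by
    intro x hx
    obtain ⟨y, hy, hxy⟩ := mem_thickening_iff.1 hx
    exact (hQb y).1 hy hxy
  have h1 := le_volume_thickening hQconv hQc (sub_pos.2 htρ) hQball ht
  have hτ : t / ρ < 1 := (div_lt_one hρ).2 htρ
  have hsub : AffineMap.homothety p (1 - t / ρ) '' K ⊆ Q := by
    rintro _ ⟨x, hx, rfl⟩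
    rw [hQb]
    have := ball_homothety_subset hK hb (div_pos ht hρ) hτ.le hx
    rwa [div_mul_cancel₀ _ hρ.ne'] at this
  have h1τ : 0 < 1 - t / ρ := by linarith
  have h2 : ENNReal.ofReal (1 - t / ρ) * μH[1] (frontier K) ≤ μH[1] (frontier Q) := by
    rw [← hausdorffMeasure_frontier_homothety p h1τ]
    refine hausdorffMeasure_frontier_mono (hK.affine_image _)
      (hc.image (AffineMap.homothety_continuous p _)).isClosed ⟨p, ?_⟩ hQc hsub
    refine mem_interior.2 ⟨ball p ((1 - t / ρ) * ρ), fun y hy => ?_, isOpen_ball,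
      mem_ball_self (by positivity)⟩
    rw [mem_homothety_image h1τ.ne']
    refine hb ?_
    rw [mem_ball, dist_eq_norm, homothety_eq, add_sub_cancel_right, norm_smul, norm_inv,
      Real.norm_of_nonneg h1τ.le, inv_mul_lt_iff₀ h1τ, ← dist_eq_norm]
    exact hy
  have h3 : {x | x ∈ K ∧ infDist x Kᶜ < t} = K \ Q := by
    ext x
    simp [hQ]
  rw [h3, measure_sdiff hQK hQcl.nullMeasurableSet hQc.measure_lt_top.ne]
  refine ENNReal.le_sub_of_add_le_left hQc.measure_lt_top.ne ?_
  calc volume Q + μH[1] (frontier K) * ENNReal.ofReal ((1 - t / ρ) * t)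
      = volume Q + (ENNReal.ofReal (1 - t / ρ) * μH[1] (frontier K)) * ENNReal.ofReal t := by
        rw [ENNReal.ofReal_mul h1τ.le]; ring
    _ ≤ volume Q + μH[1] (frontier Q) * ENNReal.ofReal t := by gcongr
    _ ≤ volume K := h1.trans (measure_mono hthick)

/-- The disc of radius `r` about the origin, in coordinates. -/
def disc (r : ℝ) : Set (ℝ × ℝ) := {q | q.1 ^ 2 + q.2 ^ 2 ≤ r ^ 2}

/-- The area of the part of a disc of radius `r` beyond a line at distance `d` of its centre. -/
noncomputable def capArea (r d : ℝ) : ENNReal := volume (disc r ∩ {q | d < q.2})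

lemma isClosed_disc (r : ℝ) : IsClosed (disc r) :=
  isClosed_le (by fun_prop) continuous_const

lemma measurableSet_cap (r d : ℝ) : MeasurableSet (disc r ∩ {q : ℝ × ℝ | d < q.2}) :=
  (isClosed_disc r).measurableSet.inter (isOpen_lt continuous_const continuous_snd).measurableSet

lemma norm_sq_eq_coords {u : Plane} (hu : ‖u‖ = 1) (x : Plane) :
    ‖x‖ ^ 2 = (coords u x).1 ^ 2 + (coords u x).2 ^ 2 := by
  rw [← norm_combo_sq hu, ← coords_decomp hu]

lemma coords_preimage_disc {u : Plane} (hu : ‖u‖ = 1) {r : ℝ} (hr : 0 ≤ r) :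
    coords u ⁻¹' disc r = closedBall 0 r := by
  ext x
  rw [mem_closedBall_zero_iff, Set.mem_preimage]
  change (coords u x).1 ^ 2 + (coords u x).2 ^ 2 ≤ r ^ 2 ↔ _
  rw [← norm_sq_eq_coords hu, sq_le_sq₀ (norm_nonneg _) hr]

lemma norm_single_one : ‖(EuclideanSpace.single 0 1 : Plane)‖ = 1 := by simp

lemma volume_disc {r : ℝ} (hr : 0 ≤ r) : volume (disc r) = ENNReal.ofReal (π * r ^ 2) := by
  rw [← volume_coords_preimage norm_single_one (isClosed_disc r).measurableSet,
    coords_preimage_disc norm_single_one hr, EuclideanSpace.volume_closedBall_fin_two,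
    ← ENNReal.ofReal_pow hr, mul_comm π, ENNReal.ofReal_mul (by positivity)]

lemma setLIntegral_closedBall_inner {u : Plane} (hu : ‖u‖ = 1) {r : ℝ} (hr : 0 ≤ r) :
    ∫⁻ z in closedBall 0 r, ENNReal.ofReal (inner ℝ u z) =
      ∫⁻ q in disc r, ENNReal.ofReal q.2 := by
  rw [← coords_preimage_disc hu hr]
  exact (measurePreserving_coords hu).setLIntegral_comp_preimage
    (isClosed_disc r).measurableSet (f := fun q : ℝ × ℝ => ENNReal.ofReal q.2)
    (by fun_prop)

lemma capArea_le_volume_diff (hK : Convex ℝ K) (hi : (interior K).Nonempty) (hc : IsCompact K)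
    (x : Plane) {r : ℝ} (hr : 0 ≤ r) :
    capArea r (infDist x Kᶜ) ≤ volume (closedBall x r \ K) := by
  have hne : Kᶜ.Nonempty := Set.nonempty_compl.2 hc.ne_univ
  obtain ⟨y, hyc, hy⟩ := isClosed_closure.exists_infDist_eq_dist (hne.closure) x
  rw [infDist_closure] at hy
  rw [closure_compl] at hyc
  obtain ⟨u, hu, hsup⟩ := exists_supporting hK hi hyc
  rw [capArea, ← volume_coords_preimage hu (measurableSet_cap r _),
    ← measure_preimage_add volume x (closedBall x r \ K)]
  refine measure_mono ?_
  rintro z ⟨hz1, hz2⟩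
  have hz1' : z ∈ closedBall (0 : Plane) r := by rw [← coords_preimage_disc hu hr]; exact hz1
  have hz2' : infDist x Kᶜ < inner ℝ u z := hz2
  refine ⟨by simpa using hz1', fun hzK => ?_⟩
  have h1 := hsup _ hzK
  rw [inner_add_right] at h1
  have h2 : inner ℝ u (y - x) ≤ dist x y := by
    have := real_inner_le_norm u (y - x)
    rwa [hu, one_mul, ← dist_eq_norm, dist_comm] at this
  rw [inner_sub_right] at h2
  linarith

lemma setLIntegral_volume_diff (hc : IsCompact K) (r : ℝ) :
    ∫⁻ x in K, volume (closedBall x r \ K) =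
      ∫⁻ z in closedBall 0 r, volume {x | x ∈ K ∧ x + z ∉ K} := by
  have hS : MeasurableSet {q : Plane × Plane | q.1 + q.2 ∉ K} :=
    (hc.measurableSet.compl).preimage (by fun_prop : Measurable fun q : Plane × Plane => q.1 + q.2)
  have h1 := Measure.prod_apply (μ := volume.restrict K)
    (ν := volume.restrict (closedBall (0 : Plane) r)) hS
  have h2 := Measure.prod_apply_symm (μ := volume.restrict K)
    (ν := volume.restrict (closedBall (0 : Plane) r)) hS
  rw [h1] at h2
  convert h2 using 1
  · refine lintegral_congr fun x => ?_
    rw [Measure.restrict_apply' measurableSet_closedBall,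
      ← measure_preimage_add volume x (closedBall x r \ K)]
    congr 1
    ext z
    simp [and_comm]
  · refine lintegral_congr fun z => ?_
    rw [Measure.restrict_apply' hc.measurableSet]
    congr 1
    ext x
    simp [and_comm]

lemma setLIntegral_capArea (hc : IsCompact K) (r : ℝ) :
    ∫⁻ x in K, capArea r (infDist x Kᶜ) =
      ∫⁻ q in disc r, volume {x | x ∈ K ∧ infDist x Kᶜ < q.2} := by
  have hS : MeasurableSet {q : Plane × (ℝ × ℝ) | infDist q.1 Kᶜ < q.2.2} :=
    (isOpen_lt ((continuous_infDist_pt _).comp continuous_fst) (by fun_prop)).measurableSet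
  have h1 := Measure.prod_apply (μ := volume.restrict K)
    (ν := volume.restrict (disc r)) hS
  have h2 := Measure.prod_apply_symm (μ := volume.restrict K)
    (ν := volume.restrict (disc r)) hS
  rw [h1] at h2
  convert h2 using 1
  · refine lintegral_congr fun x => ?_
    rw [Measure.restrict_apply' (isClosed_disc r).measurableSet, capArea]
    congr 1
    ext z
    simp [and_comm]
  · refine lintegral_congr fun z => ?_
    rw [Measure.restrict_apply' hc.measurableSet]
    congr 1
    ext x
    simp [and_comm]

lemma setLIntegral_volume_diff_le (hK : Convex ℝ K) (hc : IsCompact K) {p : Plane} {ρ : ℝ}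
    (hρ : 0 < ρ) (hb : ball p ρ ⊆ K) {r : ℝ} (hr : 0 ≤ r) :
    ∫⁻ x in K, volume (closedBall x r \ K) ≤
      μH[1] (frontier K) * ∫⁻ q in disc r, ENNReal.ofReal q.2 := by
  rw [setLIntegral_volume_diff hc]
  have hl := perimeter_ne_top hK hc hρ hb
  set l := μH[1] (frontier K)
  set M := ∫⁻ q in disc r, ENNReal.ofReal q.2 with hM
  have hMfin : M ≠ ⊤ := by
    have : M ≤ ∫⁻ q in disc r, ENNReal.ofReal r := by
      refine setLIntegral_mono measurable_const fun q hq => ENNReal.ofReal_le_ofReal ?_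
      have : q.1 ^ 2 + q.2 ^ 2 ≤ r ^ 2 := hq
      exact abs_le_of_sq_le_sq' (by nlinarith [sq_nonneg q.1]) hr |>.2
    rw [setLIntegral_const, volume_disc hr] at this
    exact ne_top_of_le_ne_top (by finiteness) this
  have hvK : volume K ≠ ⊤ := hc.measure_lt_top.ne
  have key : ∀ ε : ℝ, 0 < ε → ∫⁻ z in closedBall 0 r, volume {x | x ∈ K ∧ x + z ∉ K} ≤
      ENNReal.ofReal ((1 + ε) * (l * M).toReal +
        ((1 + ε) ^ 2 - 1) * (volume K).toReal * (volume (closedBall (0 : Plane) r)).toReal) := by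
    intro ε hε
    obtain ⟨m, u, h, hu, hKP, hPK, hPc, -, hle⟩ := exists_poly_approx_perimeter hK hc hρ hb hε
    have hdiff : volume (poly u h \ K) ≤ ENNReal.ofReal (((1 + ε) ^ 2 - 1) * (volume K).toReal) := by
      rw [measure_sdiff hKP hc.measurableSet.nullMeasurableSet hvK, sub_mul, one_mul,
        ENNReal.ofReal_sub _ ENNReal.toReal_nonneg, ENNReal.ofReal_mul (by positivity),
        ENNReal.ofReal_toReal hvK]
      gcongr
      refine (measure_mono hPK).trans ?_
      rw [Measure.addHaar_image_homothety, finrank_euclideanSpace_fin,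
        abs_of_nonneg (by positivity)]
    have hz : ∀ z : Plane, volume {x | x ∈ K ∧ x + z ∉ K} ≤
        (∑ i, μH[1] (face u h i) * ENNReal.ofReal (inner ℝ (u i) z)) +
          ENNReal.ofReal (((1 + ε) ^ 2 - 1) * (volume K).toReal) := by
      intro z
      have hsub : {x | x ∈ K ∧ x + z ∉ K} ⊆ {x | x ∈ poly u h ∧ x + z ∉ poly u h} ∪
          (fun x => x + z) ⁻¹' (poly u h \ K) := by
        rintro x ⟨hx, hxz⟩
        by_cases hP : x + z ∈ poly u h
        · exact Or.inr ⟨hP, hxz⟩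
        · exact Or.inl ⟨hKP hx, hP⟩
      refine (measure_mono hsub).trans ((measure_union_le _ _).trans ?_)
      rw [measure_preimage_add_right]
      exact add_le_add (volume_translate_exit_poly_le hu z) hdiff
    refine (lintegral_mono hz).trans ?_
    rw [lintegral_add_right _ measurable_const, setLIntegral_const,
      lintegral_finsetSum _ (fun i _ => by fun_prop)]
    have hsum : ∑ i, ∫⁻ z in closedBall 0 r, μH[1] (face u h i) *
        ENNReal.ofReal (inner ℝ (u i) z) = μH[1] (frontier (poly u h)) * M := by
      rw [← sum_hausdorffMeasure_face hu, Finset.sum_mul]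
      refine Finset.sum_congr rfl fun i _ => ?_
      rw [lintegral_const_mul _ (by fun_prop), setLIntegral_closedBall_inner (hu i) hr]
    have hε2 : 0 ≤ (1 + ε) ^ 2 - 1 := by nlinarith
    have hnn : 0 ≤ ((1 + ε) ^ 2 - 1) * (volume K).toReal := mul_nonneg hε2 ENNReal.toReal_nonneg
    rw [hsum, ENNReal.ofReal_add (by positivity) (by positivity),
      ENNReal.ofReal_mul (by positivity : (0 : ℝ) ≤ 1 + ε),
      ENNReal.ofReal_toReal (ENNReal.mul_ne_top hl hMfin), ENNReal.ofReal_mul hnn,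
      ENNReal.ofReal_toReal (measure_closedBall_lt_top).ne, ← mul_assoc]
    gcongr
  have hlim : Tendsto (fun ε : ℝ => ENNReal.ofReal ((1 + ε) * (l * M).toReal +
        ((1 + ε) ^ 2 - 1) * (volume K).toReal * (volume (closedBall (0 : Plane) r)).toReal))
      (𝓝[>] 0) (𝓝 (l * M)) := by
    have hcont : Continuous fun ε : ℝ => ENNReal.ofReal ((1 + ε) * (l * M).toReal +
        ((1 + ε) ^ 2 - 1) * (volume K).toReal * (volume (closedBall (0 : Plane) r)).toReal) :=
      ENNReal.continuous_ofReal.comp (by fun_prop)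
    have := (hcont.tendsto 0).mono_left (nhdsWithin_le_nhds (s := Set.Ioi 0))
    simpa [ENNReal.ofReal_toReal (ENNReal.mul_ne_top hl hMfin), -ENNReal.toReal_mul] using this
  exact ge_of_tendsto hlim (eventually_mem_nhdsWithin.mono fun ε hε => key ε hε)

lemma capArea_ne_top {r : ℝ} (hr : 0 ≤ r) (d : ℝ) : capArea r d ≠ ⊤ := by
  refine ne_top_of_le_ne_top ?_ (measure_mono Set.inter_subset_left)
  rw [volume_disc hr]
  finiteness

lemma capArea_antitone (r : ℝ) : Antitone (capArea r) := fun _ _ h =>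
  measure_mono (Set.inter_subset_inter_right _ fun _ hq => lt_of_le_of_lt h hq)

lemma measurable_capArea (r : ℝ) : Measurable (capArea r) := (capArea_antitone r).measurable

lemma measurable_volume_closedBall_diff (hc : IsCompact K) (r : ℝ) :
    Measurable fun x : Plane => volume (closedBall x r \ K) := by
  have hS : MeasurableSet {q : Plane × Plane | q.2 ∈ closedBall q.1 r \ K} :=
    (isClosed_le (by fun_prop : Continuous fun q : Plane × Plane => dist q.2 q.1)
      continuous_const).measurableSet.inter (hc.measurableSet.compl.preimage measurable_snd)
  exact measurable_measure_prodMk_left hS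

/-- The points of a convex body near which the boundary is far from being flat at scale `r` form a
small set. -/
lemma mul_volume_nonflat_le (hK : Convex ℝ K) (hc : IsCompact K) {p : Plane} {ρ : ℝ}
    (hρ : 0 < ρ) (hb : ball p ρ ⊆ K) {r : ℝ} (hr : 0 ≤ r) (hrρ : r < ρ) (δ : ENNReal) :
    δ * volume {x | x ∈ K ∧ capArea r (infDist x Kᶜ) + δ ≤ volume (closedBall x r \ K)} ≤
      μH[1] (frontier K) * ENNReal.ofReal (r ^ 2 / ρ * (π * r ^ 2)) := by
  set l := μH[1] (frontier K)
  set B := {x | x ∈ K ∧ capArea r (infDist x Kᶜ) + δ ≤ volume (closedBall x r \ K)} with hB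
  have hmeas : Measurable fun x : Plane => capArea r (infDist x Kᶜ) :=
    (measurable_capArea r).comp (continuous_infDist_pt _).measurable
  have hBm : MeasurableSet B := hc.measurableSet.inter
    (measurableSet_le (hmeas.add_const δ) (measurable_volume_closedBall_diff hc r))
  have h1 : (∫⁻ x in K, capArea r (infDist x Kᶜ)) + δ * volume B ≤
      ∫⁻ x in K, volume (closedBall x r \ K) := by
    have h2 : δ * volume B = ∫⁻ x in K, B.indicator (fun _ => δ) x := by
      rw [lintegral_indicator hBm, setLIntegral_const, Measure.restrict_apply hBm,
        Set.inter_eq_self_of_subset_left fun x hx => hx.1]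
    rw [h2, ← lintegral_add_left hmeas]
    refine lintegral_mono fun x => ?_
    by_cases hx : x ∈ B
    · rw [Set.indicator_of_mem hx]; exact hx.2
    · rw [Set.indicator_of_notMem hx, add_zero]
      exact capArea_le_volume_diff hK ⟨p, mem_interior.2 ⟨_, hb, isOpen_ball, mem_ball_self hρ⟩⟩
        hc x hr
  have h2 : l * (∫⁻ q in disc r, ENNReal.ofReal q.2) ≤
      (∫⁻ x in K, capArea r (infDist x Kᶜ)) + l * ENNReal.ofReal (r ^ 2 / ρ * (π * r ^ 2)) := by
    rw [setLIntegral_capArea hc, ENNReal.ofReal_mul (by positivity), ← volume_disc hr,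
      ← setLIntegral_const, ← lintegral_const_mul _ (by fun_prop),
      ← lintegral_const_mul _ (by fun_prop), ← lintegral_add_right _ (by fun_prop)]
    refine setLIntegral_mono' (isClosed_disc r).measurableSet fun q hq => ?_
    have hq' : q.1 ^ 2 + q.2 ^ 2 ≤ r ^ 2 := hq
    rcases le_or_gt q.2 0 with h0 | h0
    · rw [ENNReal.ofReal_of_nonpos h0, mul_zero]; exact zero_le
    have hqr : q.2 ≤ r := (abs_le_of_sq_le_sq' (by nlinarith [sq_nonneg q.1]) hr).2
    calc l * ENNReal.ofReal q.2 ≤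
        l * (ENNReal.ofReal ((1 - q.2 / ρ) * q.2) + ENNReal.ofReal (r ^ 2 / ρ)) := by
          gcongr
          refine (ENNReal.ofReal_le_ofReal ?_).trans ENNReal.ofReal_add_le
          have : q.2 * q.2 / ρ ≤ r ^ 2 / ρ := by gcongr; nlinarith
          calc q.2 = (1 - q.2 / ρ) * q.2 + q.2 * q.2 / ρ := by ring
            _ ≤ _ := by gcongr
      _ ≤ _ := by
          rw [mul_add]
          gcongr
          exact le_volume_inner_tube hK hc hρ hb h0 (hqr.trans_lt hrρ)
  have h3 := h1.trans ((setLIntegral_volume_diff_le hK hc hρ hb hr).trans h2)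
  refine (ENNReal.add_le_add_iff_left ?_).1 h3
  refine ne_top_of_le_ne_top ?_ (setLIntegral_mono (g := fun _ => volume (disc r))
    measurable_const fun x _ => measure_mono Set.inter_subset_left)
  rw [setLIntegral_const, volume_disc hr]
  exact ENNReal.mul_ne_top (by finiteness) hc.measure_lt_top.ne

lemma volume_le_volume_closedBall_inter (hK : Convex ℝ K) {x : Plane} (hx : x ∈ K) {D r : ℝ}
    (hD : 0 < D) (hKD : K ⊆ closedBall x D) (hr : 0 ≤ r) (hrD : r ≤ D) :
    ENNReal.ofReal ((r / D) ^ 2) * volume K ≤ volume (closedBall x r ∩ K) := by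
  have h := Measure.addHaar_image_homothety (volume : Measure Plane) x (r / D) K
  rw [finrank_euclideanSpace_fin, abs_of_nonneg (by positivity)] at h
  rw [← h]
  refine measure_mono ?_
  rintro _ ⟨y, hy, rfl⟩
  have e : AffineMap.homothety x (r / D) y = x + (r / D) • (y - x) := by
    simp [AffineMap.homothety_apply, add_comm]
  rw [e]
  constructor
  · have h1 := hKD hy
    rw [mem_closedBall, dist_eq_norm] at h1 ⊢
    rw [add_sub_cancel_left, norm_smul, norm_of_nonneg (by positivity)]
    calc r / D * ‖y - x‖ ≤ r / D * D := by gcongr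
      _ = r := by field_simp
  · exact hK.add_smul_sub_mem hx hy ⟨by positivity, (div_le_one hD).2 hrD⟩

lemma capArea_scale {r : ℝ} (hr : 0 < r) (t : ℝ) :
    capArea r t = ENNReal.ofReal (r ^ 2) * capArea 1 (t / r) := by
  have h := Measure.addHaar_smul (volume : Measure (ℝ × ℝ)) r (disc 1 ∩ {q | t / r < q.2})
  rw [Module.finrank_prod, Module.finrank_self, abs_of_nonneg (by positivity)] at h
  rw [capArea, capArea, ← h]
  congr 1
  ext q
  rw [Set.mem_smul_set_iff_inv_smul_mem₀ hr.ne']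
  simp only [disc, Set.mem_inter_iff, Set.mem_ofPred_eq, Prod.smul_fst, Prod.smul_snd, smul_eq_mul]
  refine and_congr ?_ ?_
  · rw [mul_pow, mul_pow, ← mul_add, inv_pow, inv_mul_le_iff₀ (by positivity), one_pow, mul_one]
  · rw [div_eq_inv_mul, mul_lt_mul_iff_right₀ (by positivity)]

lemma capArea_one_eq_zero {s : ℝ} (hs : 1 ≤ s) : capArea 1 s = 0 := by
  rw [capArea]
  convert measure_empty (μ := (volume : Measure (ℝ × ℝ)))
  ext q
  simp only [disc, Set.mem_inter_iff, Set.mem_ofPred_eq, Set.mem_empty_iff_false, iff_false,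
    not_and, not_lt]
  intro h
  nlinarith [sq_nonneg q.1]

lemma volume_disc_inter_strip_le {s : ℝ} :
    volume (disc 1 ∩ {q | 0 < q.2 ∧ q.2 ≤ s}) ≤ ENNReal.ofReal (2 * s) := by
  calc volume (disc 1 ∩ {q | 0 < q.2 ∧ q.2 ≤ s})
      ≤ volume (Set.Icc (-1 : ℝ) 1 ×ˢ Set.Ioc 0 s) := by
        refine measure_mono ?_
        rintro q ⟨h1, h2⟩
        simp only [disc, Set.mem_ofPred_eq] at h1
        exact ⟨⟨by nlinarith [sq_nonneg q.2], by nlinarith [sq_nonneg q.2]⟩, h2⟩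
    _ = ENNReal.ofReal (2 * s) := by
        rw [Measure.volume_eq_prod, Measure.prod_prod, Real.volume_Icc, Real.volume_Ioc,
          ← ENNReal.ofReal_mul (by norm_num)]
        congr 1
        ring

lemma le_volume_disc_inter_strip {s : ℝ} (hs : 0 ≤ s) :
    ENNReal.ofReal (2 * s * √(1 - s ^ 2)) ≤ volume (disc 1 ∩ {q | 0 < q.2 ∧ q.2 ≤ s}) := by
  rcases le_or_gt 1 s with h | hs1
  · rw [Real.sqrt_eq_zero'.2 (by nlinarith)]
    simp
  calc ENNReal.ofReal (2 * s * √(1 - s ^ 2))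
      = volume (Set.Icc (-√(1 - s ^ 2)) (√(1 - s ^ 2)) ×ˢ Set.Ioc 0 s) := by
        rw [Measure.volume_eq_prod, Measure.prod_prod, Real.volume_Icc, Real.volume_Ioc,
          ← ENNReal.ofReal_mul (by have := Real.sqrt_nonneg (1 - s ^ 2); linarith)]
        congr 1
        ring
    _ ≤ volume (disc 1 ∩ {q | 0 < q.2 ∧ q.2 ≤ s}) := by
        refine measure_mono ?_
        rintro q ⟨⟨h1, h2⟩, h3, h4⟩
        refine ⟨?_, h3, h4⟩
        have h5 := Real.sq_sqrt (show 0 ≤ 1 - s ^ 2 by nlinarith)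
        have h6 := sq_le_sq' h1 h2
        simp only [disc, Set.mem_ofPred_eq]
        nlinarith

lemma capArea_zero : capArea 1 0 = ENNReal.ofReal (π / 2) := by
  have hneg : MeasurePreserving (fun q : ℝ × ℝ => -q) volume volume :=
    Measure.measurePreserving_neg _
  have h1 : volume (disc 1 ∩ {q : ℝ × ℝ | q.2 < 0}) = capArea 1 0 := by
    rw [capArea, ← hneg.measure_preimage (measurableSet_cap 1 0).nullMeasurableSet]
    congr 1
    ext q
    simp [disc]
  have h0 : volume (disc 1 ∩ {q : ℝ × ℝ | q.2 = 0}) = 0 := by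
    refine measure_mono_null (t := Set.univ ×ˢ {0}) (fun q hq => ⟨trivial, hq.2⟩) ?_
    rw [Measure.volume_eq_prod, Measure.prod_prod]
    simp
  have h2 : volume (disc 1) = capArea 1 0 + capArea 1 0 := by
    rw [← measure_inter_add_sdiff (disc 1)
      (isOpen_lt continuous_const continuous_snd : IsOpen {q : ℝ × ℝ | 0 < q.2}).measurableSet]
    refine congrArg (capArea 1 0 + ·) ?_
    rw [← h1]
    refine le_antisymm ?_ (measure_mono ?_)
    · rw [← add_zero (volume (disc 1 ∩ {q : ℝ × ℝ | q.2 < 0})), ← h0]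
      refine (measure_mono ?_).trans (measure_union_le _ _)
      rintro q ⟨hq, hq2⟩
      rcases (not_lt.1 (show ¬ 0 < q.2 from hq2)).lt_or_eq with h | h
      exacts [Or.inl ⟨hq, h⟩, Or.inr ⟨hq, h⟩]
    · rintro q ⟨hq, hq2⟩
      exact ⟨hq, show ¬ 0 < q.2 from not_lt.2 (le_of_lt hq2)⟩
  rw [volume_disc zero_le_one] at h2
  have h3 : capArea 1 0 ≠ ⊤ := capArea_ne_top zero_le_one 0
  rw [← ENNReal.ofReal_toReal h3] at h2 ⊢
  rw [← ENNReal.ofReal_add (by positivity) (by positivity),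
    ENNReal.ofReal_eq_ofReal_iff (by positivity) (by positivity)] at h2
  congr 1
  linarith

/-- The area of the part of the unit disc on the near side of a line at distance `s`
of its centre. -/
noncomputable def truncArea (s : ℝ) : ℝ := π - (capArea 1 s).toReal

lemma truncArea_monotone : Monotone truncArea := fun _ _ h =>
  sub_le_sub_left (ENNReal.toReal_mono (capArea_ne_top zero_le_one _) (capArea_antitone 1 h)) _

lemma measurable_truncArea : Measurable truncArea := truncArea_monotone.measurable

lemma truncArea_le_pi (s : ℝ) : truncArea s ≤ π := sub_le_self _ ENNReal.toReal_nonneg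

lemma truncArea_of_one_le {s : ℝ} (hs : 1 ≤ s) : truncArea s = π := by
  simp [truncArea, capArea_one_eq_zero hs]

lemma truncArea_zero : truncArea 0 = π / 2 := by
  rw [truncArea, capArea_zero, ENNReal.toReal_ofReal (by positivity)]
  ring

lemma truncArea_eq_strip {s : ℝ} (hs : 0 ≤ s) :
    truncArea s = π / 2 + (volume (disc 1 ∩ {q | 0 < q.2 ∧ q.2 ≤ s})).toReal := by
  have h : capArea 1 0 = capArea 1 s + volume (disc 1 ∩ {q | 0 < q.2 ∧ q.2 ≤ s}) := by
    rw [capArea, ← measure_inter_add_sdiff _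
      (isOpen_lt continuous_const continuous_snd : IsOpen {q : ℝ × ℝ | s < q.2}).measurableSet]
    congr 2
    · ext q
      simp only [disc, Set.mem_inter_iff, Set.mem_ofPred_eq]
      constructor
      · rintro ⟨⟨h1, -⟩, h2⟩
        exact ⟨h1, h2⟩
      · rintro ⟨h1, h2⟩
        exact ⟨⟨h1, hs.trans_lt h2⟩, h2⟩
    · ext q
      simp only [disc, Set.mem_inter_iff, Set.mem_ofPred_eq, Set.mem_sdiff, not_lt, and_assoc]
  have h' := congrArg ENNReal.toReal h
  rw [ENNReal.toReal_add (capArea_ne_top zero_le_one _)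
    (volume_disc_inter_strip_le.trans_lt ENNReal.ofReal_lt_top).ne, capArea_zero,
    ENNReal.toReal_ofReal (by positivity)] at h'
  rw [truncArea]
  linarith

lemma truncArea_le {s : ℝ} (hs : 0 ≤ s) : truncArea s ≤ π / 2 + 2 * s := by
  rw [truncArea_eq_strip hs]
  gcongr
  exact ENNReal.toReal_le_of_le_ofReal (by positivity) volume_disc_inter_strip_le

lemma le_truncArea {s : ℝ} (hs : 0 ≤ s) : π / 2 + 2 * s * √(1 - s ^ 2) ≤ truncArea s := by
  rw [truncArea_eq_strip hs]
  gcongr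
  exact (ENNReal.ofReal_le_iff_le_toReal
    (volume_disc_inter_strip_le.trans_lt ENNReal.ofReal_lt_top).ne).1
    (le_volume_disc_inter_strip hs)

lemma pi_div_two_le_truncArea {s : ℝ} (hs : 0 ≤ s) : π / 2 ≤ truncArea s :=
  truncArea_zero ▸ truncArea_monotone hs

lemma le_truncArea_linear {s : ℝ} (hs : 0 ≤ s) (hs1 : s ≤ 1) : π / 2 + s / 2 ≤ truncArea s := by
  refine le_trans ?_ ((le_truncArea (s := s / 2) (by linarith)).trans
    (truncArea_monotone (by linarith)))
  have h : 1 / 2 ≤ √(1 - (s / 2) ^ 2) := Real.le_sqrt_of_sq_le (by nlinarith)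
  nlinarith

lemma truncArea_eq {r : ℝ} (hr : 0 < r) (t : ℝ) :
    r ^ 2 * truncArea (t / r) = π * r ^ 2 - (capArea r t).toReal := by
  rw [capArea_scale hr, ENNReal.toReal_mul, ENNReal.toReal_ofReal (by positivity), truncArea]
  ring

/-- The unnormalised Poisson weight `t ^ k * exp (-t)`. -/
noncomputable def powExp (k : ℕ) (t : ℝ) : ℝ := t ^ k * Real.exp (-t)

lemma powExp_nonneg (k : ℕ) {t : ℝ} (ht : 0 ≤ t) : 0 ≤ powExp k t := by
  rw [powExp]; positivity

lemma powExp_pos (k : ℕ) {t : ℝ} (ht : 0 < t) : 0 < powExp k t := by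
  rw [powExp]; positivity

lemma continuous_powExp (k : ℕ) : Continuous (powExp k) := by
  unfold powExp
  fun_prop

lemma powExp_le_powExp {k : ℕ} {s t : ℝ} (hs : 0 < s) (hk : k ≤ s) (hst : s ≤ t) :
    powExp k t ≤ powExp k s := by
  have h1 : t / s ≤ Real.exp ((t - s) / s) := by
    have := Real.add_one_le_exp ((t - s) / s)
    rwa [sub_div, div_self hs.ne', sub_add_cancel, ← div_self hs.ne', ← sub_div] at this
  have h2 : (t / s) ^ k ≤ Real.exp (t - s) := by
    calc (t / s) ^ k ≤ Real.exp ((t - s) / s) ^ k := by gcongr; exact div_nonneg (by linarith) hs.le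
      _ = Real.exp (k / s * (t - s)) := by rw [← Real.exp_nat_mul]; congr 1; ring
      _ ≤ Real.exp (1 * (t - s)) := by
        have := (div_le_one hs).2 hk
        have := sub_nonneg.2 hst
        gcongr
      _ = Real.exp (t - s) := by rw [one_mul]
  calc powExp k t = s ^ k * (t / s) ^ k * Real.exp (-t) := by
        rw [powExp, ← mul_pow, mul_div_cancel₀ _ hs.ne']
    _ ≤ s ^ k * Real.exp (t - s) * Real.exp (-t) := by gcongr
    _ = powExp k s := by rw [powExp, mul_assoc, ← Real.exp_add]; congr 2; ring

/-- The rescaled integrand in the Laplace asymptotics of `∫ powExp k (ν * truncArea s)`. -/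
noncomputable def laplaceIntegrand (k : ℕ) (ν u : ℝ) : ℝ :=
  Set.indicator (Set.Iic ν) (fun u => (truncArea (u / ν) / (π / 2)) ^ k *
    Real.exp (-(ν * (truncArea (u / ν) - π / 2)))) u

lemma laplaceIntegrand_eq (k : ℕ) {ν : ℝ} (hν : 0 < ν) :
    ν * (∫ s in (0 : ℝ)..1, powExp k (ν * truncArea s)) / powExp k (ν * (π / 2)) =
      ∫ u in Set.Ioi (0 : ℝ), laplaceIntegrand k ν u := by
  have h1 := intervalIntegral.integral_comp_div (a := 0) (b := ν)
    (fun s => powExp k (ν * truncArea s)) hν.ne'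
  rw [zero_div, div_self hν.ne', smul_eq_mul] at h1
  have h2 : ∫ u in Set.Ioi (0 : ℝ), laplaceIntegrand k ν u =
      ∫ u in (0 : ℝ)..ν, powExp k (ν * truncArea (u / ν)) / powExp k (ν * (π / 2)) := by
    rw [intervalIntegral.integral_of_le hν.le, ← Set.Ioi_inter_Iic,
      ← setIntegral_indicator measurableSet_Iic]
    congr 1 with u
    rw [laplaceIntegrand]
    congr 1 with u
    have hp := pi_pos
    rw [powExp, powExp, mul_div_mul_comm, ← Real.exp_sub, mul_pow, mul_pow,
      mul_div_mul_left _ _ (by positivity), div_pow]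
    congr 2
    ring
  rw [h2, intervalIntegral.integral_div, h1]

lemma tendsto_laplaceIntegrand (k : ℕ) {u : ℝ} (hu : 0 < u) :
    Tendsto (fun ν => laplaceIntegrand k ν u) atTop (𝓝 (Real.exp (-2 * u))) := by
  have hs : Tendsto (fun ν : ℝ => u / ν) atTop (𝓝 0) := tendsto_const_nhds.div_atTop tendsto_id
  have hlow : Tendsto (fun ν : ℝ => 2 * u * √(1 - (u / ν) ^ 2)) atTop (𝓝 (2 * u)) := by
    have : Tendsto (fun ν : ℝ => 2 * u * √(1 - (u / ν) ^ 2)) atTop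
        (𝓝 (2 * u * √(1 - 0 ^ 2))) :=
      ((tendsto_const_nhds.sub (hs.pow 2)).sqrt).const_mul _
    simpa using this
  have hdiff : Tendsto (fun ν : ℝ => ν * (truncArea (u / ν) - π / 2)) atTop (𝓝 (2 * u)) := by
    refine tendsto_of_tendsto_of_tendsto_of_le_of_le' hlow tendsto_const_nhds ?_ ?_
    · filter_upwards [eventually_gt_atTop 0] with ν hν
      have h := le_truncArea (s := u / ν) (by positivity)
      calc 2 * u * √(1 - (u / ν) ^ 2) = ν * (2 * (u / ν) * √(1 - (u / ν) ^ 2)) := by field_simp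
        _ ≤ _ := by gcongr; linarith
    · filter_upwards [eventually_gt_atTop 0] with ν hν
      have h := truncArea_le (s := u / ν) (by positivity)
      calc _ ≤ ν * (2 * (u / ν)) := by gcongr; linarith
        _ = 2 * u := by field_simp
  have hratio : Tendsto (fun ν : ℝ => truncArea (u / ν) / (π / 2)) atTop (𝓝 1) := by
    have h : Tendsto (fun ν : ℝ => ν * (truncArea (u / ν) - π / 2) / ν / (π / 2) + 1) atTop
        (𝓝 (0 / (π / 2) + 1)) :=
      ((hdiff.div_atTop tendsto_id).div_const _).add_const 1
    rw [zero_div, zero_add] at h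
    refine h.congr' ?_
    filter_upwards [eventually_gt_atTop 0] with ν hν
    field_simp
    ring
  have h := (hratio.pow k).mul (hdiff.neg.rexp)
  rw [one_pow, one_mul, ← neg_mul] at h
  refine h.congr' ?_
  filter_upwards [eventually_ge_atTop u] with ν hν
  rw [laplaceIntegrand, Set.indicator_of_mem (Set.mem_Iic.2 hν)]

lemma norm_laplaceIntegrand_le (k : ℕ) {ν u : ℝ} (hν : 0 < ν) (hu : 0 < u) :
    ‖laplaceIntegrand k ν u‖ ≤ 2 ^ k * Real.exp (-(1 / 2) * u) := by
  rw [laplaceIntegrand]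
  by_cases h : u ≤ ν
  · rw [Set.indicator_of_mem (Set.mem_Iic.2 h)]
    have h0 := pi_div_two_le_truncArea (s := u / ν) (by positivity)
    have hp := pi_pos
    rw [norm_of_nonneg (by
      have : 0 ≤ truncArea (u / ν) := by linarith
      positivity)]
    gcongr
    · exact div_nonneg (by linarith) (by linarith)
    · rw [div_le_iff₀ (by positivity)]
      linarith [truncArea_le_pi (u / ν)]
    · have h1 := le_truncArea_linear (s := u / ν) (by positivity) ((div_le_one hν).2 h)
      have h2 : ν * (u / ν / 2) ≤ ν * (truncArea (u / ν) - π / 2) := by gcongr; linarith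
      have h3 : ν * (u / ν / 2) = u / 2 := by field_simp
      linarith
  · rw [Set.indicator_of_notMem (by simpa using h), norm_zero]
    positivity

lemma tendsto_laplace (k : ℕ) :
    Tendsto (fun ν : ℝ => ν * (∫ s in (0 : ℝ)..1, powExp k (ν * truncArea s)) /
      powExp k (ν * (π / 2))) atTop (𝓝 (1 / 2)) := by
  have h : Tendsto (fun ν : ℝ => ∫ u in Set.Ioi (0 : ℝ), laplaceIntegrand k ν u) atTop
      (𝓝 (∫ u in Set.Ioi (0 : ℝ), Real.exp (-2 * u))) := by
    refine tendsto_integral_filter_of_dominated_convergence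
      (fun u => 2 ^ k * Real.exp (-(1 / 2) * u)) (Eventually.of_forall fun ν => ?_) ?_ ?_ ?_
    · refine (Measurable.indicator ?_ measurableSet_Iic).aestronglyMeasurable
      have := measurable_truncArea
      fun_prop
    · filter_upwards [eventually_gt_atTop 0] with ν hν
      filter_upwards [ae_restrict_mem measurableSet_Ioi] with u hu
      exact norm_laplaceIntegrand_le k hν hu
    · exact (exp_neg_integrableOn_Ioi 0 (by norm_num)).const_mul _
    · filter_upwards [ae_restrict_mem measurableSet_Ioi] with u hu
      exact tendsto_laplaceIntegrand k hu
  have e : ∫ u in Set.Ioi (0 : ℝ), Real.exp (-2 * u) = 1 / 2 := by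
    rw [integral_exp_mul_Ioi (by norm_num)]
    norm_num
  rw [e] at h
  refine h.congr' ?_
  filter_upwards [eventually_gt_atTop 0] with ν hν
  rw [laplaceIntegrand_eq k hν]

lemma exists_superlevel_eq {f : ℝ → ℝ} (hf : AntitoneOn f (Set.Ici 0)) {r : ℝ} (hr : 0 ≤ r)
    (hfr : ∀ t, r ≤ t → f t = 0) {y : ℝ} (hy : 0 ≤ y) :
    ∃ τ, 0 ≤ τ ∧ τ ≤ r ∧ (∀ t, 0 ≤ t → t < τ → y < f t) ∧ ∀ t, 0 ≤ t → y < f t → t ≤ τ := by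
  set S := {t | 0 ≤ t ∧ y < f t} with hS
  have hbd : ∀ t ∈ S, t ≤ r := fun t ht => by
    by_contra! h
    exact hy.not_gt (hfr t h.le ▸ ht.2)
  rcases S.eq_empty_or_nonempty with hE | hne
  · refine ⟨0, le_rfl, hr, fun t h0 h1 => absurd h1 h0.not_gt, fun t h0 h1 => ?_⟩
    have : t ∈ S := ⟨h0, h1⟩
    simp [hE] at this
  · have hB : BddAbove S := ⟨r, hbd⟩
    refine ⟨sSup S, Real.sSup_nonneg fun t ht => ht.1, csSup_le hne hbd, fun t h0 h1 => ?_,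
      fun t h0 h1 => le_csSup hB ⟨h0, h1⟩⟩
    obtain ⟨s, hs, hts⟩ := exists_lt_of_lt_csSup hne h1
    exact hs.2.trans_le (hf h0 hs.1 hts.le)

lemma lintegral_infDist_bounds (hK : Convex ℝ K) (hc : IsCompact K) {p : Plane} {ρ : ℝ}
    (hb : ball p ρ ⊆ K) {f : ℝ → ℝ} (hfm : Measurable f) (hf0 : ∀ t, 0 ≤ f t)
    (hf : AntitoneOn f (Set.Ici 0)) {r : ℝ} (hr : 0 < r) (hrρ : r < ρ)
    (hfr : ∀ t, r ≤ t → f t = 0) :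
    ENNReal.ofReal (1 - r / ρ) * μH[1] (frontier K) * ∫⁻ t in Set.Ioi 0, ENNReal.ofReal (f t) ≤
        ∫⁻ x in K, ENNReal.ofReal (f (infDist x Kᶜ)) ∧
      ∫⁻ x in K, ENNReal.ofReal (f (infDist x Kᶜ)) ≤
        μH[1] (frontier K) * ∫⁻ t in Set.Ioi 0, ENNReal.ofReal (f t) := by
  have hρ : 0 < ρ := hr.trans hrρ
  have hd : Measurable fun x : Plane => f (infDist x Kᶜ) :=
    hfm.comp (continuous_infDist_pt _).measurable
  rw [lintegral_eq_lintegral_meas_lt (volume.restrict K) (Eventually.of_forall fun x => hf0 _)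
      hd.aemeasurable,
    lintegral_eq_lintegral_meas_lt (volume.restrict (Set.Ioi 0)) (Eventually.of_forall hf0)
      hfm.aemeasurable]
  have key : ∀ y ∈ Set.Ioi (0 : ℝ),
      ENNReal.ofReal (1 - r / ρ) * μH[1] (frontier K) *
        volume.restrict (Set.Ioi 0) {t | y < f t} ≤
        volume.restrict K {x | y < f (infDist x Kᶜ)} ∧
      volume.restrict K {x | y < f (infDist x Kᶜ)} ≤
        μH[1] (frontier K) * volume.restrict (Set.Ioi 0) {t | y < f t} := by
    intro y hy
    obtain ⟨τ, hτ0, hτr, h1, h2⟩ := exists_superlevel_eq hf hr.le hfr (le_of_lt hy)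
    rw [Measure.restrict_apply (measurableSet_lt measurable_const hfm),
      Measure.restrict_apply (measurableSet_lt measurable_const hd)]
    have e : volume ({t | y < f t} ∩ Set.Ioi 0) = ENNReal.ofReal τ := by
      refine le_antisymm ?_ ?_
      · rw [← sub_zero τ, ← Real.volume_Icc]
        exact measure_mono fun t ht => ⟨le_of_lt ht.2, h2 t (le_of_lt ht.2) ht.1⟩
      · rw [← sub_zero τ, ← Real.volume_Ioo]
        exact measure_mono fun t ht => ⟨h1 t ht.1.le ht.2, ht.1⟩
    rw [e]
    constructor
    · rcases hτ0.eq_or_lt with rfl | hτ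
      · simp
      calc ENNReal.ofReal (1 - r / ρ) * μH[1] (frontier K) * ENNReal.ofReal τ
          ≤ ENNReal.ofReal (1 - τ / ρ) * μH[1] (frontier K) * ENNReal.ofReal τ := by gcongr
        _ = μH[1] (frontier K) * ENNReal.ofReal ((1 - τ / ρ) * τ) := by
          rw [ENNReal.ofReal_mul (sub_nonneg.2 ((div_le_one hρ).2 (hτr.trans hrρ.le)))]
          ring
        _ ≤ volume {x | x ∈ K ∧ infDist x Kᶜ < τ} :=
          le_volume_inner_tube hK hc hρ hb hτ (hτr.trans_lt hrρ)
        _ ≤ volume ({x | y < f (infDist x Kᶜ)} ∩ K) :=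
          measure_mono fun x hx => ⟨h1 _ infDist_nonneg hx.2, hx.1⟩
    · exact (measure_mono (t := {x | x ∈ K ∧ infDist x Kᶜ ≤ τ})
          fun x hx => ⟨hx.2, h2 _ infDist_nonneg hx.1⟩).trans
        (volume_inner_tube_le hK hc hρ hb hτ0)
  have hm : Measurable fun y : ℝ => volume.restrict (Set.Ioi 0) {t | y < f t} :=
    Antitone.measurable fun a b hab => measure_mono fun t ht => lt_of_le_of_lt hab ht
  rw [← lintegral_const_mul _ hm, ← lintegral_const_mul _ hm]
  exact ⟨setLIntegral_mono' measurableSet_Ioi fun y hy => (key y hy).1,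
    setLIntegral_mono' measurableSet_Ioi fun y hy => (key y hy).2⟩

lemma integral_infDist_bounds (hK : Convex ℝ K) (hc : IsCompact K) {p : Plane} {ρ : ℝ}
    (hb : ball p ρ ⊆ K) {f : ℝ → ℝ} (hfm : Measurable f) (hf0 : ∀ t, 0 ≤ f t)
    (hf : AntitoneOn f (Set.Ici 0)) {r : ℝ} (hr : 0 < r) (hrρ : r < ρ)
    (hfr : ∀ t, r ≤ t → f t = 0) :
    (1 - r / ρ) * (μH[1] (frontier K)).toReal * ∫ t in (0 : ℝ)..r, f t ≤
        ∫ x in K, f (infDist x Kᶜ) ∧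
      ∫ x in K, f (infDist x Kᶜ) ≤ (μH[1] (frontier K)).toReal * ∫ t in (0 : ℝ)..r, f t := by
  have hρ : 0 < ρ := hr.trans hrρ
  have hd : Measurable fun x : Plane => f (infDist x Kᶜ) :=
    hfm.comp (continuous_infDist_pt _).measurable
  obtain ⟨h1, h2⟩ := lintegral_infDist_bounds hK hc hb hfm hf0 hf hr hrρ hfr
  have hP := perimeter_ne_top hK hc hρ hb
  have e0 : ∫⁻ t in Set.Ioi 0, ENNReal.ofReal (f t) =
      ∫⁻ t in Set.Ioc 0 r, ENNReal.ofReal (f t) := by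
    rw [← Set.Ioi_inter_Iic, Set.inter_comm, ← setLIntegral_indicator measurableSet_Iic]
    refine lintegral_congr fun t => ?_
    by_cases h : t ≤ r
    · rw [Set.indicator_of_mem (Set.mem_Iic.2 h)]
    · rw [Set.indicator_of_notMem (by simpa using h), hfr t (le_of_not_ge h), ENNReal.ofReal_zero]
  have hfin : ∫⁻ t in Set.Ioi 0, ENNReal.ofReal (f t) ≠ ⊤ := by
    rw [e0]
    refine ((setLIntegral_mono' (g := fun _ => ENNReal.ofReal (f 0)) measurableSet_Ioc
      fun t ht => ?_).trans_lt ?_).ne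
    · exact ENNReal.ofReal_le_ofReal (hf Set.self_mem_Ici (Set.mem_Ici.2 ht.1.le) ht.1.le)
    · rw [setLIntegral_const, Real.volume_Ioc]
      exact ENNReal.mul_lt_top ENNReal.ofReal_lt_top ENNReal.ofReal_lt_top
  have e1 : ∫ t in (0 : ℝ)..r, f t = (∫⁻ t in Set.Ioi 0, ENNReal.ofReal (f t)).toReal := by
    rw [intervalIntegral.integral_of_le hr.le, e0,
      integral_eq_lintegral_of_nonneg_ae (Eventually.of_forall hf0) hfm.aestronglyMeasurable]
  have e2 : ∫ x in K, f (infDist x Kᶜ) =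
      (∫⁻ x in K, ENNReal.ofReal (f (infDist x Kᶜ))).toReal :=
    integral_eq_lintegral_of_nonneg_ae (Eventually.of_forall fun x => hf0 _)
      hd.aestronglyMeasurable
  have hfin2 := ENNReal.mul_ne_top hP hfin
  rw [e1, e2, ← ENNReal.toReal_mul, ← ENNReal.toReal_ofReal
    (sub_nonneg.2 ((div_le_one hρ).2 hrρ.le)), ← ENNReal.toReal_mul, ← ENNReal.toReal_mul]
  exact ⟨ENNReal.toReal_mono (ne_top_of_le_ne_top hfin2 h2) h1, ENNReal.toReal_mono hfin2 h2⟩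

lemma powExp_le_factorial (k : ℕ) {t : ℝ} (ht : 0 ≤ t) : powExp k t ≤ k.factorial := by
  have h := Real.pow_div_factorial_le_exp t ht k
  rw [div_le_iff₀ (by positivity)] at h
  calc powExp k t ≤ Real.exp t * k.factorial * Real.exp (-t) := by rw [powExp]; gcongr
    _ = k.factorial := by
      rw [mul_right_comm, ← Real.exp_add, add_neg_cancel, Real.exp_zero, one_mul]

/-- The area of the part of the disc about `x` of radius `r` inside `K`. -/
noncomputable def areaIn (K : Set Plane) (r : ℝ) (x : Plane) : ℝ :=
  (volume (closedBall x r ∩ K)).toReal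

lemma areaIn_nonneg (K : Set Plane) (r : ℝ) (x : Plane) : 0 ≤ areaIn K r x := ENNReal.toReal_nonneg

lemma volume_closedBall_plane (x : Plane) {r : ℝ} (hr : 0 ≤ r) :
    volume (closedBall x r) = ENNReal.ofReal (π * r ^ 2) := by
  rw [EuclideanSpace.volume_closedBall_fin_two, ← ENNReal.ofReal_pow hr, mul_comm π,
    ENNReal.ofReal_mul (by positivity)]

lemma areaIn_eq (hc : IsCompact K) {r : ℝ} (hr : 0 ≤ r) (x : Plane) :
    areaIn K r x = π * r ^ 2 - (volume (closedBall x r \ K)).toReal := by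
  have hfin : volume (closedBall x r) ≠ ⊤ := measure_closedBall_lt_top.ne
  have h := measure_inter_add_sdiff (μ := volume) (closedBall x r) hc.measurableSet
  have h' := congrArg ENNReal.toReal h
  rw [ENNReal.toReal_add (measure_ne_top_of_subset Set.inter_subset_left hfin)
    (measure_ne_top_of_subset Set.sdiff_subset hfin), volume_closedBall_plane x hr,
    ENNReal.toReal_ofReal (by positivity)] at h'
  rw [areaIn]
  linarith

lemma measurable_areaIn (hc : IsCompact K) {r : ℝ} (hr : 0 ≤ r) : Measurable (areaIn K r) := by
  have h : areaIn K r = fun x => π * r ^ 2 - (volume (closedBall x r \ K)).toReal :=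
    funext (areaIn_eq hc hr)
  rw [h]
  exact measurable_const.sub (measurable_volume_closedBall_diff hc r).ennreal_toReal

lemma areaIn_le (hK : Convex ℝ K) (hi : (interior K).Nonempty) (hc : IsCompact K) {r : ℝ}
    (hr : 0 < r) (x : Plane) : areaIn K r x ≤ r ^ 2 * truncArea (infDist x Kᶜ / r) := by
  rw [truncArea_eq hr, areaIn_eq hc hr.le]
  refine sub_le_sub_left (ENNReal.toReal_mono ?_ (capArea_le_volume_diff hK hi hc x hr.le)) _
  exact measure_ne_top_of_subset Set.sdiff_subset measure_closedBall_lt_top.ne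

lemma le_areaIn_of_flat {r : ℝ} (hc : IsCompact K) (hr : 0 < r) {δ : ℝ} (hδ : 0 ≤ δ) {x : Plane}
    (h : volume (closedBall x r \ K) ≤ capArea r (infDist x Kᶜ) + ENNReal.ofReal δ) :
    r ^ 2 * truncArea (infDist x Kᶜ / r) - δ ≤ areaIn K r x := by
  have hcap := capArea_ne_top hr.le (infDist x Kᶜ)
  have h' := ENNReal.toReal_mono (ENNReal.add_ne_top.2 ⟨hcap, ENNReal.ofReal_ne_top⟩) h
  rw [ENNReal.toReal_add hcap ENNReal.ofReal_ne_top, ENNReal.toReal_ofReal hδ] at h'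
  rw [truncArea_eq hr, areaIn_eq hc hr.le]
  linarith

lemma areaIn_le_disc (hc : IsCompact K) {r : ℝ} (hr : 0 ≤ r) (x : Plane) :
    areaIn K r x ≤ π * r ^ 2 := by
  rw [areaIn_eq hc hr]
  exact sub_le_self _ ENNReal.toReal_nonneg

lemma le_areaIn (hK : Convex ℝ K) {x : Plane} (hx : x ∈ K) (hv : volume K = 1) {D r : ℝ}
    (hD : 0 < D) (hKD : K ⊆ closedBall x D) (hr : 0 ≤ r) (hrD : r ≤ D) :
    (r / D) ^ 2 ≤ areaIn K r x := by
  have h := volume_le_volume_closedBall_inter hK hx hD hKD hr hrD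
  rw [hv, mul_one] at h
  exact (ENNReal.ofReal_le_iff_le_toReal
    (measure_ne_top_of_subset Set.inter_subset_left measure_closedBall_lt_top.ne)).1 h

lemma integrable_powExp_comp {μ : Measure Plane} [IsFiniteMeasure μ] (k : ℕ) {f : Plane → ℝ}
    (hf : Measurable f) (hf0 : ∀ x, 0 ≤ f x) : Integrable (fun x => powExp k (f x)) μ := by
  refine Integrable.of_bound ((continuous_powExp k).measurable.comp hf).aestronglyMeasurable
    k.factorial (Eventually.of_forall fun x => ?_)
  rw [norm_of_nonneg (powExp_nonneg k (hf0 x))]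
  exact powExp_le_factorial k (hf0 x)

/-- The integral of `powExp` when every ball is replaced by its part below a tangent line. -/
noncomputable def modelIntegral (K : Set Plane) (k : ℕ) (ν r : ℝ) : ℝ :=
  ∫ x in K, powExp k (ν * truncArea (infDist x Kᶜ / r))

lemma measurable_truncArea_infDist (K : Set Plane) (r : ℝ) :
    Measurable fun x : Plane => truncArea (infDist x Kᶜ / r) :=
  measurable_truncArea.comp ((continuous_infDist_pt _).measurable.div_const r)

lemma truncArea_infDist_nonneg (K : Set Plane) {r : ℝ} (hr : 0 < r) (x : Plane) :
    0 ≤ truncArea (infDist x Kᶜ / r) :=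
  (by positivity : (0 : ℝ) ≤ π / 2).trans
    (pi_div_two_le_truncArea (div_nonneg infDist_nonneg hr.le))

lemma modelIntegral_bounds (hK : Convex ℝ K) (hc : IsCompact K) (hv : volume K = 1) {p : Plane}
    {ρ : ℝ} (hb : ball p ρ ⊆ K) {k : ℕ} {ν r : ℝ} (hr : 0 < r) (hrρ : r < ρ) (hν : 0 < ν)
    (hkν : k ≤ ν * (π / 2)) :
    powExp k (ν * π) + (1 - r / ρ) * (μH[1] (frontier K)).toReal *
        (r * ((∫ s in (0 : ℝ)..1, powExp k (ν * truncArea s)) - powExp k (ν * π))) ≤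
        modelIntegral K k ν r ∧
      modelIntegral K k ν r ≤ powExp k (ν * π) + (μH[1] (frontier K)).toReal *
        (r * ((∫ s in (0 : ℝ)..1, powExp k (ν * truncArea s)) - powExp k (ν * π))) := by
  have hp := pi_pos
  set f : ℝ → ℝ := fun t => powExp k (ν * truncArea (max t 0 / r)) - powExp k (ν * π) with hf
  have hkey : ∀ s t : ℝ, 0 ≤ s → s ≤ t →
      powExp k (ν * truncArea t) ≤ powExp k (ν * truncArea s) := fun s t hs hst => by
    have h1 := pi_div_two_le_truncArea hs
    have h2 : ν * (π / 2) ≤ ν * truncArea s := by gcongr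
    refine powExp_le_powExp (by nlinarith [mul_pos hν hp]) (hkν.trans h2) ?_
    gcongr
    exact truncArea_monotone hst
  have hfm : Measurable f := by
    have := (continuous_powExp k).measurable
    have := measurable_truncArea
    fun_prop
  have hanti : Antitone f := fun s t hst =>
    sub_le_sub_right (hkey _ _ (by positivity) (by gcongr)) _
  have hfr : ∀ t, r ≤ t → f t = 0 := fun t ht => by
    simp only [hf]
    rw [truncArea_of_one_le, sub_self]
    rw [max_eq_left (hr.le.trans ht)]
    exact (one_le_div hr).2 ht
  have hf0 : ∀ t, 0 ≤ f t := fun t => by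
    rw [← hfr (max t r) (le_max_right _ _)]
    exact hanti (le_max_left _ _)
  have hII : IntervalIntegrable (fun s => powExp k (ν * truncArea (s / r))) volume 0 r := by
    have h : IntervalIntegrable f volume 0 r := hanti.intervalIntegrable
    have h' := h.add (intervalIntegrable_const (c := powExp k (ν * π)))
    refine h'.congr_uIoo fun t ht => ?_
    rw [Set.uIoo_of_le hr.le] at ht
    simp [hf, max_eq_left ht.1.le]
  have e1 : ∫ t in (0 : ℝ)..r, f t =
      r * ((∫ s in (0 : ℝ)..1, powExp k (ν * truncArea s)) - powExp k (ν * π)) := by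
    have h1 : ∫ t in (0 : ℝ)..r, f t =
        ∫ t in (0 : ℝ)..r, (powExp k (ν * truncArea (t / r)) - powExp k (ν * π)) := by
      refine intervalIntegral.integral_congr fun t ht => ?_
      rw [Set.uIcc_of_le hr.le] at ht
      simp [hf, max_eq_left ht.1]
    rw [h1, intervalIntegral.integral_sub hII intervalIntegrable_const,
      intervalIntegral.integral_comp_div (fun s => powExp k (ν * truncArea s)) hr.ne']
    rw [zero_div, div_self hr.ne', intervalIntegral.integral_const]
    simp only [smul_eq_mul, sub_zero]
    ring
  have : IsProbabilityMeasure (volume.restrict K) := ⟨by rw [Measure.restrict_apply_univ, hv]⟩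
  have e2 : ∫ x in K, f (infDist x Kᶜ) = modelIntegral K k ν r - powExp k (ν * π) := by
    have h1 : ∀ x, f (infDist x Kᶜ) =
        powExp k (ν * truncArea (infDist x Kᶜ / r)) - powExp k (ν * π) := fun x => by
      simp [hf, max_eq_left infDist_nonneg]
    simp_rw [h1]
    rw [integral_sub (integrable_powExp_comp k ((measurable_truncArea_infDist K r).const_mul ν)
      fun x => mul_nonneg hν.le (truncArea_infDist_nonneg K hr x)) (integrable_const _),
      integral_const, modelIntegral]
    simp
  obtain ⟨h1, h2⟩ := integral_infDist_bounds hK hc hb hfm hf0 (hanti.antitoneOn _) hr hrρ hfr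
  rw [e1, e2] at h1 h2
  constructor <;> linarith

lemma modelIntegral_le (hK : Convex ℝ K) (hi : (interior K).Nonempty) (hc : IsCompact K)
    (hv : volume K = 1) {D : ℝ} (hD : 0 < D) (hKD : ∀ x ∈ K, K ⊆ closedBall x D) {k : ℕ} {n r : ℝ}
    (hn : 0 < n) (hr : 0 < r) (hrD : r ≤ D) (hk : k ≤ n * r ^ 2 / D ^ 2) :
    modelIntegral K k (n * r ^ 2) r ≤ ∫ x in K, powExp k (n * areaIn K r x) := by
  have : IsProbabilityMeasure (volume.restrict K) := ⟨by rw [Measure.restrict_apply_univ, hv]⟩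
  refine setIntegral_mono_on ?_ ?_ hc.measurableSet fun x hx => ?_
  · exact integrable_powExp_comp k ((measurable_truncArea_infDist K r).const_mul _)
      fun x => mul_nonneg (by positivity) (truncArea_infDist_nonneg K hr x)
  · exact integrable_powExp_comp k ((measurable_areaIn hc hr.le).const_mul _)
      fun x => mul_nonneg hn.le (areaIn_nonneg K r x)
  · have h1 := le_areaIn hK hx hv hD (hKD x hx) hr.le hrD
    have h2 : n * r ^ 2 / D ^ 2 ≤ n * areaIn K r x := by
      calc n * r ^ 2 / D ^ 2 = n * (r / D) ^ 2 := by ring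
        _ ≤ _ := by gcongr
    refine powExp_le_powExp (lt_of_lt_of_le (by positivity) h2) (hk.trans h2) ?_
    rw [mul_assoc]
    gcongr
    exact areaIn_le hK hi hc hr x

lemma volume_nonflat_le (hK : Convex ℝ K) (hc : IsCompact K) {p : Plane} {ρ : ℝ}
    (hb : ball p ρ ⊆ K) {r δ : ℝ} (hr : 0 < r) (hrρ : r < ρ) (hδ : 0 < δ) :
    (volume {x | x ∈ K ∧ capArea r (infDist x Kᶜ) + ENNReal.ofReal δ ≤
      volume (closedBall x r \ K)}).toReal ≤
      (μH[1] (frontier K)).toReal * (r ^ 2 / ρ * (π * r ^ 2)) / δ := by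
  have hρ : 0 < ρ := hr.trans hrρ
  have h := mul_volume_nonflat_le hK hc hρ hb hr.le hrρ (ENNReal.ofReal δ)
  have h' := ENNReal.toReal_mono
    (ENNReal.mul_ne_top (perimeter_ne_top hK hc hρ hb) ENNReal.ofReal_ne_top) h
  rw [ENNReal.toReal_mul, ENNReal.toReal_mul, ENNReal.toReal_ofReal hδ.le,
    ENNReal.toReal_ofReal (by positivity)] at h'
  rw [le_div_iff₀ hδ]
  linarith

lemma integral_areaIn_le (hK : Convex ℝ K) (hi : (interior K).Nonempty) (hc : IsCompact K)
    (hv : volume K = 1) {p : Plane} {ρ : ℝ} (hb : ball p ρ ⊆ K) {D : ℝ} (hD : 0 < D)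
    (hKD : ∀ x ∈ K, K ⊆ closedBall x D) {k : ℕ} {n r δ : ℝ} (hn : 0 < n) (hr : 0 < r)
    (hrρ : r < ρ) (hrD : r ≤ D) (hδ : 0 < δ) :
    ∫ x in K, powExp k (n * areaIn K r x) ≤
      Real.exp (n * δ) * modelIntegral K k (n * r ^ 2) r +
        (π * (n * r ^ 2)) ^ k * Real.exp (-(n * r ^ 2 / D ^ 2)) *
          ((μH[1] (frontier K)).toReal * (r ^ 2 / ρ * (π * r ^ 2)) / δ) := by
  have : IsProbabilityMeasure (volume.restrict K) := ⟨by rw [Measure.restrict_apply_univ, hv]⟩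
  set S := {x | capArea r (infDist x Kᶜ) + ENNReal.ofReal δ ≤ volume (closedBall x r \ K)} with hS
  have hSm : MeasurableSet S := measurableSet_le
    (((measurable_capArea r).comp (continuous_infDist_pt _).measurable).add measurable_const)
    (measurable_volume_closedBall_diff hc r)
  set C := (π * (n * r ^ 2)) ^ k * Real.exp (-(n * r ^ 2 / D ^ 2)) with hC
  have hC0 : 0 ≤ C := by have := pi_pos; positivity
  have hint : Integrable (fun x => powExp k (n * r ^ 2 * truncArea (infDist x Kᶜ / r)))
      (volume.restrict K) :=
    integrable_powExp_comp k ((measurable_truncArea_infDist K r).const_mul _)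
      fun x => mul_nonneg (by positivity) (truncArea_infDist_nonneg K hr x)
  calc ∫ x in K, powExp k (n * areaIn K r x)
      ≤ ∫ x in K, (Real.exp (n * δ) * powExp k (n * r ^ 2 * truncArea (infDist x Kᶜ / r)) +
          S.indicator (fun _ => C) x) := by
        refine setIntegral_mono_on ?_ ?_ hc.measurableSet fun x hx => ?_
        · exact integrable_powExp_comp k ((measurable_areaIn hc hr.le).const_mul _)
            fun x => mul_nonneg hn.le (areaIn_nonneg K r x)
        · exact (hint.const_mul _).add ((integrable_const C).indicator hSm)
        · have hA0 : 0 ≤ n * areaIn K r x := mul_nonneg hn.le (areaIn_nonneg K r x)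
          have hT0 := truncArea_infDist_nonneg K hr x
          by_cases hxS : x ∈ S
          · rw [Set.indicator_of_mem hxS]
            refine le_add_of_nonneg_of_le
              (mul_nonneg (Real.exp_pos _).le (powExp_nonneg k (by positivity))) ?_
            have h1 := le_areaIn hK hx hv hD (hKD x hx) hr.le hrD
            have h2 : n * r ^ 2 / D ^ 2 ≤ n * areaIn K r x := by
              calc n * r ^ 2 / D ^ 2 = n * (r / D) ^ 2 := by ring
                _ ≤ _ := by gcongr
            have h3 : n * areaIn K r x ≤ π * (n * r ^ 2) := by
              calc n * areaIn K r x ≤ n * (π * r ^ 2) := by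
                    gcongr; exact areaIn_le_disc hc hr.le x
                _ = _ := by ring
            rw [powExp, hC]
            gcongr
          · rw [Set.indicator_of_notMem hxS, add_zero]
            have h1 := le_areaIn_of_flat hc hr hδ.le (not_le.1 hxS).le
            have h2 := areaIn_le hK hi hc hr x
            set T := truncArea (infDist x Kᶜ / r)
            calc powExp k (n * areaIn K r x)
                ≤ (n * r ^ 2 * T) ^ k * Real.exp (n * δ + -(n * r ^ 2 * T)) := by
                  rw [powExp]
                  have h3 : n * areaIn K r x ≤ n * r ^ 2 * T := by
                    rw [mul_assoc]; gcongr
                  gcongr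
                  have := mul_le_mul_of_nonneg_left h1 hn.le
                  linarith
              _ = Real.exp (n * δ) * powExp k (n * r ^ 2 * T) := by
                  rw [powExp, Real.exp_add]
                  ring
    _ = Real.exp (n * δ) * modelIntegral K k (n * r ^ 2) r +
          C * (volume {x | x ∈ K ∧ capArea r (infDist x Kᶜ) + ENNReal.ofReal δ ≤
            volume (closedBall x r \ K)}).toReal := by
        rw [integral_add (hint.const_mul _) ((integrable_const C).indicator hSm),
          integral_const_mul, integral_indicator_const C hSm, modelIntegral, measureReal_def,
          Measure.restrict_apply hSm, smul_eq_mul, mul_comm C]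
        congr 4
        ext x
        exact and_comm
    _ ≤ _ := by
        gcongr
        exact volume_nonflat_le hK hc hb hr hrρ hδ

lemma tendsto_mul_laplace {k : ℕ} {r : ℕ → ℝ} {H : ℝ}
    (hν : Tendsto (fun n : ℕ => n * r n ^ 2) atTop atTop)
    (hH : Tendsto (fun n : ℕ => n * r n * powExp k (n * r n ^ 2 * (π / 2)) / (n * r n ^ 2))
      atTop (𝓝 H)) :
    Tendsto (fun n : ℕ => n * r n * ∫ s in (0 : ℝ)..1, powExp k (n * r n ^ 2 * truncArea s))
      atTop (𝓝 (H / 2)) := by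
  have h := hH.mul ((tendsto_laplace k).comp hν)
  rw [mul_one_div] at h
  refine h.congr' ?_
  filter_upwards [hν.eventually_gt_atTop 0] with n hn
  have hP := (powExp_pos k (mul_pos hn (half_pos pi_pos))).ne'
  simp only [Function.comp]
  generalize powExp k (n * r n ^ 2 * (π / 2)) = P at hP
  generalize (n : ℝ) * r n ^ 2 = ν at hn
  have := hn.ne'
  field_simp

lemma tendsto_modelIntegral (hK : Convex ℝ K) (hc : IsCompact K) (hv : volume K = 1) {p : Plane}
    {ρ : ℝ} (hρ : 0 < ρ) (hb : ball p ρ ⊆ K) {k : ℕ} {r : ℕ → ℝ} {G H : ℝ}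
    (hr : ∀ᶠ n in atTop, 0 < r n) (hr0 : Tendsto r atTop (𝓝 0))
    (hν : Tendsto (fun n : ℕ => n * r n ^ 2) atTop atTop)
    (hG : Tendsto (fun n : ℕ => n * powExp k (n * r n ^ 2 * π)) atTop (𝓝 G))
    (hH : Tendsto (fun n : ℕ => n * r n * powExp k (n * r n ^ 2 * (π / 2)) / (n * r n ^ 2))
      atTop (𝓝 H)) :
    Tendsto (fun n : ℕ => n * modelIntegral K k (n * r n ^ 2) (r n)) atTop
      (𝓝 (G + (μH[1] (frontier K)).toReal * (H / 2))) := by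
  set l := (μH[1] (frontier K)).toReal
  have hJ := tendsto_mul_laplace hν hH
  have hd : Tendsto (fun n : ℕ => n * r n * (∫ s in (0 : ℝ)..1,
      powExp k (n * r n ^ 2 * truncArea s)) - r n * (n * powExp k (n * r n ^ 2 * π)))
      atTop (𝓝 (H / 2)) := by
    simpa using hJ.sub (hr0.mul hG)
  have hlow : Tendsto (fun n : ℕ => n * powExp k (n * r n ^ 2 * π) + (1 - r n / ρ) * l *
      (n * r n * (∫ s in (0 : ℝ)..1,
      powExp k (n * r n ^ 2 * truncArea s)) - r n * (n * powExp k (n * r n ^ 2 * π))))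
      atTop (𝓝 (G + l * (H / 2))) := by
    have h := hG.add ((((hr0.div_const ρ).const_sub 1).mul_const l).mul hd)
    simpa using h
  have hupp := hG.add (hd.const_mul l)
  have hev : ∀ᶠ n : ℕ in atTop, 0 < r n ∧ r n < ρ ∧ 0 < n * r n ^ 2 ∧
      k ≤ n * r n ^ 2 * (π / 2) := by
    filter_upwards [hr, hr0.eventually_lt_const hρ, hν.eventually_gt_atTop 0,
      (hν.atTop_mul_const (half_pos pi_pos)).eventually_ge_atTop (k : ℝ)] with n h1 h2 h3 h4
    exact ⟨h1, h2, h3, h4⟩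
  refine tendsto_of_tendsto_of_tendsto_of_le_of_le' hlow hupp ?_ ?_
  · filter_upwards [hev] with n ⟨h1, h2, h3, h4⟩
    have h := mul_le_mul_of_nonneg_left (modelIntegral_bounds hK hc hv hb h1 h2 h3 h4).1
      (Nat.cast_nonneg (α := ℝ) n)
    refine le_of_eq_of_le ?_ h
    ring
  · filter_upwards [hev] with n ⟨h1, h2, h3, h4⟩
    have h := mul_le_mul_of_nonneg_left (modelIntegral_bounds hK hc hv hb h1 h2 h3 h4).2
      (Nat.cast_nonneg (α := ℝ) n)
    refine h.trans_eq ?_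
    ring

lemma tendsto_integral_areaIn (hK : Convex ℝ K) (hi : (interior K).Nonempty) (hc : IsCompact K)
    (hv : volume K = 1) {k : ℕ} {r : ℕ → ℝ} {G H : ℝ}
    (hr : ∀ᶠ n in atTop, 0 < r n) (hr0 : Tendsto r atTop (𝓝 0))
    (hν : Tendsto (fun n : ℕ => n * r n ^ 2) atTop atTop)
    (hG : Tendsto (fun n : ℕ => n * powExp k (n * r n ^ 2 * π)) atTop (𝓝 G))
    (hH : Tendsto (fun n : ℕ => n * r n * powExp k (n * r n ^ 2 * (π / 2)) / (n * r n ^ 2))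
      atTop (𝓝 H)) :
    Tendsto (fun n : ℕ => n * ∫ x in K, powExp k (n * areaIn K (r n) x)) atTop
      (𝓝 (G + (μH[1] (frontier K)).toReal * (H / 2))) := by
  obtain ⟨p, hp⟩ := hi
  obtain ⟨ρ, hρ, hb⟩ := Metric.isOpen_iff.1 isOpen_interior p hp
  replace hb := hb.trans interior_subset
  have hi : (interior K).Nonempty := ⟨p, hp⟩
  obtain ⟨D, hD, hKD⟩ : ∃ D : ℝ, 0 < D ∧ ∀ x ∈ K, K ⊆ closedBall x D := by
    refine ⟨diam K + 1, by have := diam_nonneg (s := K); linarith, fun x hx y hy => ?_⟩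
    have := dist_le_diam_of_mem hc.isBounded hy hx
    rw [mem_closedBall]
    linarith
  set l := (μH[1] (frontier K)).toReal
  have hM := tendsto_modelIntegral hK hc hv hρ hb hr hr0 hν hG hH
  have herr : Tendsto (fun n : ℕ => l * π ^ (k + 1) / ρ * D ^ (2 * (k + 3)) *
      ((n * r n ^ 2 / D ^ 2) ^ (k + 3) * Real.exp (-(n * r n ^ 2 / D ^ 2)))) atTop (𝓝 0) := by
    have h := ((Real.tendsto_pow_mul_exp_neg_atTop_nhds_zero (k + 3)).comp
      (hν.atTop_div_const (show 0 < D ^ 2 by positivity))).const_mul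
      (l * π ^ (k + 1) / ρ * D ^ (2 * (k + 3)))
    simpa only [mul_zero, Function.comp_def] using h
  have hexp : Tendsto (fun n : ℕ => Real.exp (n * (r n ^ 2 / (n * r n ^ 2) ^ 2))) atTop (𝓝 1) := by
    rw [← Real.exp_zero]
    refine (Real.continuous_exp.tendsto 0).comp (hν.inv_tendsto_atTop.congr' ?_)
    filter_upwards [hν.eventually_gt_atTop 0] with n hn
    simp only [Pi.inv_apply]
    rw [← mul_div_assoc, sq (n * r n ^ 2), div_mul_cancel_left₀ hn.ne']
  have hupp := (hexp.mul hM).add herr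
  rw [one_mul, add_zero] at hupp
  refine tendsto_of_tendsto_of_tendsto_of_le_of_le' hM hupp ?_ ?_
  · filter_upwards [hr, hr0.eventually_lt_const hD, eventually_gt_atTop 0,
      (hν.atTop_div_const (show 0 < D ^ 2 by positivity)).eventually_ge_atTop (k : ℝ)]
      with n h1 h2 h3 h4
    gcongr
    exact modelIntegral_le hK hi hc hv hD hKD (by positivity) h1 h2.le h4
  · filter_upwards [hr, hr0.eventually_lt_const hD, hr0.eventually_lt_const hρ,
      eventually_gt_atTop 0] with n h1 h2 h3 h4
    have hn : (0 : ℝ) < n := by positivity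
    have h := mul_le_mul_of_nonneg_left (integral_areaIn_le (k := k) hK hi hc hv hb hD hKD hn h1
      h3 h2.le (show 0 < r n ^ 2 / (n * r n ^ 2) ^ 2 by positivity)) hn.le
    refine h.trans_eq ?_
    rw [mul_add]
    congr 1
    · ring
    · have e : D ^ (2 * (k + 3)) * (n * r n ^ 2 / D ^ 2) ^ (k + 3) = (n * r n ^ 2) ^ (k + 3) := by
        rw [pow_mul, ← mul_pow, mul_div_cancel₀ _ (by positivity)]
      rw [← mul_assoc (l * π ^ (k + 1) / ρ * D ^ (2 * (k + 3))), mul_assoc (l * π ^ (k + 1) / ρ), e]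
      field_simp
      rw [show (μH[1] (frontier K)).toReal = l from rfl]
      ring

/-- The critical value of `π * n * r ^ 2`. -/
noncomputable def critExponent (k : ℕ) (ξ : ℝ) (n : ℕ) : ℝ :=
  Real.log n + (2 * (k : ℝ) - 1) * Real.log (Real.log n) + ξ

lemma tendsto_log_natCast : Tendsto (fun n : ℕ => Real.log n) atTop atTop :=
  Real.tendsto_log_atTop.comp tendsto_natCast_atTop_atTop

lemma tendsto_critExponent_div_log (k : ℕ) (ξ : ℝ) :
    Tendsto (fun n : ℕ => critExponent k ξ n / Real.log n) atTop (𝓝 1) := by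
  have h1 : Tendsto (fun n : ℕ => Real.log (Real.log n) / Real.log n) atTop (𝓝 0) :=
    Real.isLittleO_log_id_atTop.tendsto_div_nhds_zero.comp tendsto_log_natCast
  have h2 : Tendsto (fun n : ℕ => ξ / Real.log n) atTop (𝓝 0) :=
    tendsto_const_nhds.div_atTop tendsto_log_natCast
  have h := ((h1.const_mul (2 * (k : ℝ) - 1)).const_add 1).add h2
  rw [mul_zero, add_zero, add_zero] at h
  refine h.congr' ?_
  filter_upwards [tendsto_log_natCast.eventually_gt_atTop 0] with n hn
  rw [critExponent]
  field_simp

lemma tendsto_critExponent (k : ℕ) (ξ : ℝ) : Tendsto (critExponent k ξ) atTop atTop := by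
  refine ((tendsto_critExponent_div_log k ξ).pos_mul_atTop one_pos tendsto_log_natCast).congr' ?_
  filter_upwards [tendsto_log_natCast.eventually_gt_atTop 0] with n hn
  rw [div_mul_cancel₀ _ hn.ne']

lemma tendsto_critExponent_div_natCast (k : ℕ) (ξ : ℝ) :
    Tendsto (fun n : ℕ => critExponent k ξ n / (π * n)) atTop (𝓝 0) := by
  have h1 : Tendsto (fun n : ℕ => Real.log n / n) atTop (𝓝 0) :=
    Real.isLittleO_log_id_atTop.tendsto_div_nhds_zero.comp tendsto_natCast_atTop_atTop
  have h := ((tendsto_critExponent_div_log k ξ).mul h1).div_const π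
  rw [mul_zero, zero_div] at h
  refine h.congr' ?_
  filter_upwards [tendsto_log_natCast.eventually_gt_atTop 0, eventually_gt_atTop 0] with n hn hn0
  have := pi_pos
  field_simp

lemma exp_neg_half_critExponent {k n : ℕ} (ξ : ℝ) (hn : 0 < n) (hL : 0 < Real.log n) :
    Real.exp (-(critExponent k ξ n / 2)) =
      √(Real.log n) * Real.exp (-ξ / 2) / (√n * Real.log n ^ k) := by
  have hn' : (0 : ℝ) < n := by positivity
  rw [eq_div_iff (by positivity)]
  have h1 : √(n : ℝ) = Real.exp (Real.log n / 2) := by rw [Real.exp_half, Real.exp_log hn']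
  have h2 : √(Real.log n) = Real.exp (Real.log (Real.log n) / 2) := by
    rw [Real.exp_half, Real.exp_log hL]
  have h3 : Real.log n ^ k = Real.exp (k * Real.log (Real.log n)) := by
    rw [Real.exp_nat_mul, Real.exp_log hL]
  rw [h3, h2, h1, ← Real.exp_add, ← Real.exp_add, ← Real.exp_add, critExponent]
  congr 1
  ring

lemma tendsto_interior_term {k : ℕ} (hk : 1 ≤ k) (ξ : ℝ) :
    Tendsto (fun n : ℕ => n * powExp k (critExponent k ξ n)) atTop
      (𝓝 (if k = 1 then Real.exp (-ξ) else 0)) := by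
  have hinv : Tendsto (fun n : ℕ => ((Real.log n) ^ (k - 1))⁻¹) atTop
      (𝓝 (if k = 1 then 1 else 0)) := by
    split_ifs with h
    · simp [h]
    · exact ((tendsto_pow_atTop (by omega)).comp tendsto_log_natCast).inv_tendsto_atTop
  have h := (((tendsto_critExponent_div_log k ξ).pow k).mul hinv).mul_const (Real.exp (-ξ))
  have e : 1 ^ k * (if k = 1 then (1 : ℝ) else 0) * Real.exp (-ξ) =
      if k = 1 then Real.exp (-ξ) else 0 := by split_ifs <;> simp
  rw [e] at h
  refine h.congr' ?_
  filter_upwards [tendsto_log_natCast.eventually_gt_atTop 0, eventually_gt_atTop 0] with n hL hn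
  have hn' : (0 : ℝ) < n := by positivity
  have h1 : Real.exp (-critExponent k ξ n) = Real.exp (-(critExponent k ξ n / 2)) ^ 2 := by
    rw [← Real.exp_nat_mul]
    congr 1
    push_cast
    ring
  have h2 : Real.exp (-ξ / 2) ^ 2 = Real.exp (-ξ) := by
    rw [← Real.exp_nat_mul]
    congr 1
    push_cast
    ring
  rw [powExp, h1, exp_neg_half_critExponent ξ hn hL, div_pow, div_pow, mul_pow, mul_pow, h2,
    Real.sq_sqrt hL.le, Real.sq_sqrt hn'.le]
  obtain ⟨j, rfl⟩ : ∃ j, k = j + 1 := ⟨k - 1, by omega⟩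
  rw [Nat.add_sub_cancel]
  field_simp
  ring

lemma tendsto_boundary_term (k : ℕ) (ξ : ℝ) :
    Tendsto (fun n : ℕ => n * √(critExponent k ξ n / (π * n)) *
      powExp k (critExponent k ξ n / 2) / (critExponent k ξ n / π)) atTop
      (𝓝 (√π * Real.exp (-ξ / 2) / 2 ^ k)) := by
  have h0 := tendsto_critExponent_div_log k ξ
  have h := (((h0.pow k).mul (h0.inv₀ one_ne_zero).sqrt).mul_const
    (√π * Real.exp (-ξ / 2) / 2 ^ k))
  rw [one_pow, inv_one, Real.sqrt_one, one_mul, one_mul] at h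
  refine h.congr' ?_
  filter_upwards [tendsto_log_natCast.eventually_gt_atTop 0, eventually_gt_atTop 0,
    (tendsto_critExponent k ξ).eventually_gt_atTop 0] with n hL hn hw
  have hn' : (0 : ℝ) < n := by positivity
  have hp := pi_pos
  rw [powExp, exp_neg_half_critExponent ξ hn hL]
  generalize critExponent k ξ n = w at hw
  generalize Real.log (n : ℝ) = L at hL
  generalize (n : ℝ) = m at hn'
  rw [inv_div, Real.sqrt_div hL.le, Real.sqrt_div hw.le, Real.sqrt_mul hp.le]
  obtain ⟨a, ha, rfl⟩ : ∃ a, 0 < a ∧ m = a ^ 2 := ⟨√m, by positivity, (Real.sq_sqrt hn'.le).symm⟩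
  obtain ⟨b, hb, rfl⟩ : ∃ b, 0 < b ∧ w = b ^ 2 := ⟨√w, by positivity, (Real.sq_sqrt hw.le).symm⟩
  obtain ⟨q, hq, hq2⟩ : ∃ q, 0 < q ∧ π = q ^ 2 := ⟨√π, by positivity, (Real.sq_sqrt hp.le).symm⟩
  rw [hq2, Real.sqrt_sq ha.le, Real.sqrt_sq hb.le, Real.sqrt_sq hq.le, div_pow, div_pow]
  field_simp

lemma perimeter_pos (hK : Convex ℝ K) (hi : (interior K).Nonempty) (hc : IsCompact K)
    (hv : volume K ≠ 0) : 0 < (μH[1] (frontier K)).toReal := by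
  obtain ⟨p, hp⟩ := hi
  obtain ⟨ρ, hρ, hb⟩ := Metric.isOpen_iff.1 isOpen_interior p hp
  replace hb := hb.trans interior_subset
  refine ENNReal.toReal_pos (fun h0 => hv ?_) (perimeter_ne_top hK hc hρ hb)
  obtain ⟨q, hq⟩ : Kᶜ.Nonempty := Set.nonempty_compl.2 hc.ne_univ
  obtain ⟨R, hR⟩ := hc.isBounded.subset_closedBall q
  have h := volume_inner_tube_le hK hc hρ hb (le_max_right R 0)
  rw [h0, zero_mul] at h
  refine measure_mono_null (t := {x | x ∈ K ∧ infDist x Kᶜ ≤ max R 0})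
    (fun x hx => ⟨hx, ?_⟩) (nonpos_iff_eq_zero.1 h)
  exact (infDist_le_dist_of_mem hq).trans ((mem_closedBall.1 (hR hx)).trans (le_max_left _ _))

lemma limit_value_one {l c ξ : ℝ}
    (hξ : ξ = -2 * Real.log (√(Real.exp (-c) + π * l ^ 2 / 64) - l * √π / 8)) :
    Real.exp (-ξ) + l * (√π * Real.exp (-ξ / 2) / 2 / 2) = Real.exp (-c) := by
  have hp := pi_pos
  have hs : √π ^ 2 = π := Real.sq_sqrt hp.le
  set u := √(Real.exp (-c) + π * l ^ 2 / 64) - l * √π / 8 with hu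
  have hu0 : 0 < u := by
    rw [hu, sub_pos]
    refine Real.lt_sqrt_of_sq_lt ?_
    have := Real.exp_pos (-c)
    nlinarith
  have h1 : Real.exp (-ξ / 2) = u := by
    rw [hξ, show -(-2 * Real.log u) / 2 = Real.log u by ring, Real.exp_log hu0]
  have h2 : Real.exp (-ξ) = u ^ 2 := by
    rw [← h1, ← Real.exp_nat_mul]
    congr 1
    push_cast
    ring
  have h3 : (u + l * √π / 8) ^ 2 = Real.exp (-c) + π * l ^ 2 / 64 := by
    rw [hu, sub_add_cancel, Real.sq_sqrt (by positivity)]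
  rw [h1, h2]
  nlinarith

lemma limit_value_of_one_lt {l c ξ : ℝ} {k : ℕ} (hl : 0 < l)
    (hξ : ξ = 2 * Real.log (l * √π / (2 ^ (k + 1) * (k.factorial : ℝ))) + 2 * c) :
    l * (√π * Real.exp (-ξ / 2) / 2 ^ k / 2) / k.factorial = Real.exp (-c) := by
  have hp := pi_pos
  have h1 : Real.exp (-ξ / 2) =
      (l * √π / (2 ^ (k + 1) * (k.factorial : ℝ)))⁻¹ * Real.exp (-c) := by
    rw [hξ, show ∀ a : ℝ, -(2 * a + 2 * c) / 2 = -a + -c by intro a; ring, Real.exp_add,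
      Real.exp_neg, Real.exp_log (by positivity)]
  rw [h1]
  field_simp
  ring

end Plane

theorem critical_radius_integral_limit_2d
    (Ω : Set (EuclideanSpace ℝ (Fin 2)))
    (hconv : Convex ℝ Ω) (hcomp : IsCompact Ω) (hint : (interior Ω).Nonempty)
    (hvol : volume Ω = 1)
    (ℓ : ℝ) (hℓ : ℓ = (μH[1] (frontier Ω)).toReal)
    (k : ℕ) (hk : 1 ≤ k) (c : ℝ) (hc : 0 < c) (ξ : ℝ)
    (hξ1 : k = 1 → ξ = -2 * Real.log
        (Real.sqrt (Real.exp (-c) + π * ℓ ^ 2 / 64) - ℓ * Real.sqrt π / 8))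
    (hξ2 : 1 < k → ξ = 2 * Real.log
        (ℓ * Real.sqrt π / (2 ^ (k + 1) * (k.factorial : ℝ))) + 2 * c)
    (r : ℕ → ℝ)
    (hr : ∀ n : ℕ, r n = Real.sqrt
        ((Real.log n + (2 * (k : ℝ) - 1) * Real.log (Real.log n) + ξ) / (π * n))) :
    Tendsto (fun n : ℕ =>
        (n : ℝ) / (k.factorial : ℝ) *
          ∫ x in Ω, ((n : ℝ) * (volume (closedBall x (r n) ∩ Ω)).toReal) ^ k *
            Real.exp (-((n : ℝ) * (volume (closedBall x (r n) ∩ Ω)).toReal)))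
      atTop (𝓝 (Real.exp (-c))) := by
  have hp := pi_pos
  have hl : 0 < ℓ := hℓ ▸ Plane.perimeter_pos hconv hint hcomp (by rw [hvol]; exact one_ne_zero)
  have hr' : ∀ n, r n = √(Plane.critExponent k ξ n / (π * n)) := hr
  have hpos : ∀ᶠ n : ℕ in atTop, 0 < n ∧ 0 < Plane.critExponent k ξ n :=
    (eventually_gt_atTop 0).and ((Plane.tendsto_critExponent k ξ).eventually_gt_atTop 0)
  have hsq : ∀ᶠ n : ℕ in atTop, n * r n ^ 2 = Plane.critExponent k ξ n / π := by
    filter_upwards [hpos] with n ⟨hn, hw⟩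
    rw [hr', Real.sq_sqrt (by positivity)]
    field_simp
  have hr_pos : ∀ᶠ n in atTop, 0 < r n := by
    filter_upwards [hpos] with n ⟨hn, hw⟩
    rw [hr']
    positivity
  have hr0 : Tendsto r atTop (𝓝 0) := by
    have h := (Plane.tendsto_critExponent_div_natCast k ξ).sqrt
    rw [Real.sqrt_zero] at h
    exact h.congr fun n => (hr' n).symm
  have hν : Tendsto (fun n : ℕ => n * r n ^ 2) atTop atTop :=
    ((Plane.tendsto_critExponent k ξ).atTop_div_const hp).congr' (hsq.mono fun n hn => hn.symm)
  have hG : Tendsto (fun n : ℕ => n * Plane.powExp k (n * r n ^ 2 * π)) atTop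
      (𝓝 (if k = 1 then Real.exp (-ξ) else 0)) := by
    refine (Plane.tendsto_interior_term hk ξ).congr' ?_
    filter_upwards [hsq] with n hn
    rw [hn, div_mul_cancel₀ _ hp.ne']
  have hH : Tendsto (fun n : ℕ => n * r n * Plane.powExp k (n * r n ^ 2 * (π / 2)) /
      (n * r n ^ 2)) atTop (𝓝 (√π * Real.exp (-ξ / 2) / 2 ^ k)) := by
    refine (Plane.tendsto_boundary_term k ξ).congr' ?_
    filter_upwards [hsq] with n hn
    rw [hn, hr', ← mul_div_assoc, div_mul_cancel₀ _ hp.ne']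
  have hmain := (Plane.tendsto_integral_areaIn hconv hint hcomp hvol hr_pos hr0 hν hG hH).div_const
    (k.factorial : ℝ)
  have hval : ((if k = 1 then Real.exp (-ξ) else 0) +
      (μH[1] (frontier Ω)).toReal * (√π * Real.exp (-ξ / 2) / 2 ^ k / 2)) / k.factorial =
      Real.exp (-c) := by
    rw [← hℓ]
    rcases hk.eq_or_lt with h | h
    · subst h
      rw [if_pos rfl, Nat.factorial_one, Nat.cast_one, div_one, pow_one]
      exact Plane.limit_value_one (hξ1 rfl)
    · rw [if_neg h.ne', zero_add]
      exact Plane.limit_value_of_one_lt hl (hξ2 h)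
  rw [hval] at hmain
  refine hmain.congr fun n => ?_
  rw [mul_div_right_comm]
  rfl
end

section
/- Let Ω ⊂ ℝ² be a compact convex region of unit area with nonempty interior, c > 0 a constant, and r_n = √((log n + c)/(π·n)). Then lim_{n→∞} n·∫_Ω e^{−n·|B(x, r_n) ∩ Ω|} dx = e^{−c}. -/
open MeasureTheory Metric Real Filter Topology

/-- In a planar convex set that reaches distance `ρ` to both sides of the origin on the horizontal
axis, the points whose horizontal translates by `± w` both leave the set form a set of area
`O(w ^ 2)`. -/
lemma volume_horizontal_short_chords_le {K : Set (ℝ × ℝ)} (hK : Convex ℝ K)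
    (hKm : MeasurableSet K) {ρ D w : ℝ} (hρ : 0 < ρ) (hD : 0 ≤ D) (hw : 0 < w)
    (h1 : ((ρ, 0) : ℝ × ℝ) ∈ K) (h2 : ((-ρ, 0) : ℝ × ℝ) ∈ K)
    (hKD : ∀ q ∈ K, |q.2| ≤ D) :
    volume {q : ℝ × ℝ | q ∈ K ∧ (q.1 + w, q.2) ∉ K ∧ (q.1 - w, q.2) ∉ K} ≤
      ENNReal.ofReal (4 * D / ρ * w ^ 2) := by
  have between : ∀ {a b m y : ℝ}, (a, y) ∈ K → (b, y) ∈ K → a ≤ m → m ≤ b → (m, y) ∈ K := by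
    intro a b m y ha hb h h'
    rcases eq_or_lt_of_le (h.trans h') with hab | hab
    · obtain rfl : a = m := by linarith
      exact ha
    · have := hK ha hb (a := (b - m) / (b - a)) (b := (m - a) / (b - a))
        (div_nonneg (by linarith) (by linarith)) (div_nonneg (by linarith) (by linarith))
        (by have : b - a ≠ 0 := by linarith
            field_simp; ring)
      convert this using 1
      have : b - a ≠ 0 := by linarith
      ext <;> simp <;> field_simp <;> ring
  set S := {q : ℝ × ℝ | q ∈ K ∧ (q.1 + w, q.2) ∉ K ∧ (q.1 - w, q.2) ∉ K} with hS
  have hSm : MeasurableSet S := by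
    refine hKm.inter (MeasurableSet.inter ?_ ?_)
    · exact (hKm.preimage (f := fun q : ℝ × ℝ => (q.1 + w, q.2)) (by fun_prop)).compl
    · exact (hKm.preimage (f := fun q : ℝ × ℝ => (q.1 - w, q.2)) (by fun_prop)).compl
  -- a point of `S` lies in the last fraction `w / ρ` of the heights attained in its direction
  have height : ∀ ε : ℝ, (ε = 1 ∨ ε = -1) → ∀ a y a' y' : ℝ, (a, ε * y) ∈ S → (a', ε * y') ∈ S →
      0 ≤ y → y' - y ≤ w / ρ * D := by
    intro ε hε a y a' y' hy hy' h0
    by_contra! hlt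
    have hy'D : y' ≤ D := by
      have := hKD _ hy'.1
      rcases hε with rfl | rfl <;> simp only [one_mul, neg_one_mul, abs_neg] at this <;>
        exact (le_abs_self _).trans this
    have hpos : 0 ≤ w / ρ * D := by positivity
    have hy'0 : 0 < y' := by linarith
    have hle : y < (1 - w / ρ) * y' := by
      have : w / ρ * y' ≤ w / ρ * D := by gcongr
      linarith
    set l := y / y' with hl
    have hl0 : 0 ≤ l := by positivity
    have hl1 : l < 1 - w / ρ := by rw [hl, div_lt_iff₀ hy'0]; exact hle
    have hwρ : 0 < w / ρ := by positivity
    have hly : l * y' = y := by rw [hl]; field_simp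
    have hgap : w ≤ (1 - l) * ρ := by
      have : w / ρ * ρ ≤ (1 - l) * ρ := by gcongr; linarith
      rwa [div_mul_cancel₀ _ hρ.ne'] at this
    have q1 : (l * a' + (1 - l) * ρ, ε * y) ∈ K := by
      have := hK hy'.1 h1 hl0 (b := 1 - l) (by linarith) (by ring)
      convert this using 1
      ext
      · simp
      · simp [← hly]; ring
    have q2 : (l * a' - (1 - l) * ρ, ε * y) ∈ K := by
      have := hK hy'.1 h2 hl0 (b := 1 - l) (by linarith) (by ring)
      convert this using 1
      ext
      · simp; ring
      · simp [← hly]; ring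
    rcases le_total a (l * a') with h | h
    · exact hy.2.1 (between hy.1 q1 (by simp; linarith) (by simp; linarith))
    · exact hy.2.2 (between q2 hy.1 (by simp; linarith) (by simp; linarith))
  set Y : ℝ → Set ℝ := fun ε => {y | 0 ≤ ε * y ∧ ∃ a, (a, y) ∈ S}
  have hY : ∀ ε : ℝ, (ε = 1 ∨ ε = -1) → volume (Y ε) ≤ ENNReal.ofReal (w / ρ * D) := by
    intro ε hε
    have hεε : ε * ε = 1 := by rcases hε with rfl | rfl <;> norm_num
    refine (Real.volume_le_diam _).trans (ediam_le ?_)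
    rintro y ⟨hy, a, ha⟩ y' ⟨hy', a', ha'⟩
    rw [edist_dist]
    apply ENNReal.ofReal_le_ofReal
    have e1 := height ε hε a (ε * y) a' (ε * y') (by rwa [← mul_assoc, hεε, one_mul])
      (by rwa [← mul_assoc, hεε, one_mul]) hy
    have e2 := height ε hε a' (ε * y') a (ε * y) (by rwa [← mul_assoc, hεε, one_mul])
      (by rwa [← mul_assoc, hεε, one_mul]) hy'
    rw [Real.dist_eq, abs_le]
    rcases hε with rfl | rfl <;> constructor <;> linarith
  have hslice : ∀ y, volume ((fun x => (x, y)) ⁻¹' S) ≤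
      (toMeasurable volume (Y 1 ∪ Y (-1))).indicator (fun _ => ENNReal.ofReal (2 * w)) y := by
    intro y
    rcases ((fun x => (x, y)) ⁻¹' S).eq_empty_or_nonempty with h | ⟨a, ha⟩
    · rw [h]; simp
    · rw [Set.indicator_of_mem]
      · refine (Real.volume_le_diam _).trans (ediam_le ?_)
        intro b hb b' hb'
        rw [edist_dist]
        apply ENNReal.ofReal_le_ofReal
        rw [Real.dist_eq, abs_le]
        constructor
        · by_contra! h
          exact hb.2.1 (between hb.1 hb'.1 (by simp; linarith) (by simp; linarith))
        · by_contra! h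
          exact hb'.2.1 (between hb'.1 hb.1 (by simp; linarith) (by simp; linarith))
      · apply subset_toMeasurable
        rcases le_total 0 y with h | h
        · exact Or.inl ⟨by linarith, a, ha⟩
        · exact Or.inr ⟨by linarith, a, ha⟩
  rw [Measure.volume_eq_prod, Measure.prod_apply_symm hSm]
  refine (lintegral_mono hslice).trans ?_
  rw [lintegral_indicator_const (measurableSet_toMeasurable _ _), measure_toMeasurable]
  calc ENNReal.ofReal (2 * w) * volume (Y 1 ∪ Y (-1))
      ≤ ENNReal.ofReal (2 * w) * (ENNReal.ofReal (w / ρ * D) + ENNReal.ofReal (w / ρ * D)) := by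
        gcongr
        exact (measure_union_le _ _).trans
          (add_le_add (hY 1 (Or.inl rfl)) (hY (-1) (Or.inr rfl)))
    _ = ENNReal.ofReal (4 * D / ρ * w ^ 2) := by
        rw [← ENNReal.ofReal_add (by positivity) (by positivity),
          ← ENNReal.ofReal_mul (by positivity)]
        congr 1
        ring

/-- Every unit vector of the plane is the first vector of orthonormal coordinates, and these
coordinates preserve area. -/
lemma exists_measurePreserving_coordinates {u : EuclideanSpace ℝ (Fin 2)} (hu : ‖u‖ = 1) :
    ∃ u' : EuclideanSpace ℝ (Fin 2), ‖u'‖ = 1 ∧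
      (∀ a b : ℝ, ‖a • u + b • u'‖ ^ 2 = a ^ 2 + b ^ 2) ∧
      MeasurePreserving (fun q : ℝ × ℝ => q.1 • u + q.2 • u') volume volume := by
  obtain ⟨b, hb⟩ := Orthonormal.exists_orthonormalBasis_extension_of_card_eq (𝕜 := ℝ)
    (E := EuclideanSpace ℝ (Fin 2)) (ι := Fin 2) (by simp) (v := fun _ => u) (s := {0})
    (by
      constructor
      · intro i; simpa using hu
      · intro i j hij; exact absurd (Subsingleton.elim i j) hij)
  have hb0 : b 0 = u := hb 0 rfl
  refine ⟨b 1, b.orthonormal.1 1, ?_, ?_⟩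
  · intro s t
    have h01 : inner ℝ u (b 1) = 0 := by
      rw [← hb0]; exact b.orthonormal.2 (by decide)
    rw [norm_add_sq_real, norm_smul, norm_smul, hu, b.orthonormal.1 1, inner_smul_left,
      inner_smul_right, h01]
    simp
  · have := b.measurePreserving_repr_symm.comp ((PiLp.volume_preserving_toLp (Fin 2)).comp
      (volume_preserving_finTwoArrow ℝ).symm)
    convert this using 1
    ext1 q
    simp [← b.sum_repr_symm, Fin.sum_univ_two, hb0, MeasurableEquiv.finTwoArrow]

lemma Convex.closedBall_combo_subset {E : Type*} [NormedAddCommGroup E] [NormedSpace ℝ E]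
    {Ω : Set E} (hΩ : Convex ℝ Ω) {p y : E} {ρ s : ℝ} (hp : closedBall p ρ ⊆ Ω) (hy : y ∈ Ω)
    (hs0 : 0 ≤ s) (hs1 : s ≤ 1) :
    closedBall ((1 - s) • y + s • p) (s * ρ) ⊆ Ω := by
  intro z hz
  rcases hs0.eq_or_lt with rfl | hs
  · have : z = y := by simpa using hz
    rwa [this]
  · have hq : s⁻¹ • (z - (1 - s) • y) ∈ Ω := by
      apply hp
      rw [mem_closedBall, dist_eq_norm] at hz ⊢
      have : s⁻¹ • (z - (1 - s) • y) - p = s⁻¹ • (z - ((1 - s) • y + s • p)) := by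
        match_scalars <;> field_simp
      rw [this, norm_smul, norm_inv, Real.norm_of_nonneg hs0, inv_mul_le_iff₀ hs]
      exact hz
    have := hΩ hy hq (a := 1 - s) (b := s) (by linarith) hs0 (by ring)
    rw [smul_inv_smul₀ hs.ne'] at this
    simpa using this

lemma Convex.midpoint_combo_mem {E : Type*} [NormedAddCommGroup E] [NormedSpace ℝ E]
    {Ω : Set E} (hΩ : Convex ℝ Ω) {x v w : E} (hv : x + v ∈ Ω) (hw : x + w ∈ Ω) :
    x + (1 / 2 : ℝ) • (v + w) ∈ Ω := by
  have := hΩ hv hw (a := 1 / 2) (b := 1 / 2) (by norm_num) (by norm_num) (by norm_num)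
  convert this using 1
  match_scalars <;> norm_num

lemma closedBall_infDist_compl_subset {E : Type*} [NormedAddCommGroup E] [NormedSpace ℝ E]
    {Ω : Set E} (hΩ : IsClosed Ω) {x : E} (hx : x ∈ Ω) :
    closedBall x (infDist x Ωᶜ) ⊆ Ω := by
  rcases (infDist_nonneg (x := x) (s := Ωᶜ)).eq_or_lt with h | h
  · rw [← h]; simpa using hx
  · rw [← closure_ball x h.ne']
    exact hΩ.closure_subset_iff.2 ball_infDist_compl_subset

lemma le_infDist_compl {E : Type*} [PseudoMetricSpace E] {Ω : Set E} (hΩ : Ωᶜ.Nonempty) {x : E}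
    {s : ℝ} (h : closedBall x s ⊆ Ω) : s ≤ infDist x Ωᶜ := by
  rw [le_infDist hΩ]
  intro y hy
  by_contra! hlt
  exact hy (h (by rw [mem_closedBall']; exact hlt.le))

lemma nonempty_compl_of_volume_eq_one {Ω : Set (EuclideanSpace ℝ (Fin 2))}
    (hvol : volume Ω = 1) : Ωᶜ.Nonempty := by
  rw [Set.nonempty_compl]
  rintro rfl
  rw [measure_univ_of_isAddLeftInvariant] at hvol
  exact ENNReal.top_ne_one hvol

/-- The part of a convex set of unit area within distance `τ` of its boundary has area `O(τ)`. -/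
lemma volume_boundary_layer_le {Ω : Set (EuclideanSpace ℝ (Fin 2))} (hΩ : Convex ℝ Ω)
    (hvol : volume Ω = 1) {p : EuclideanSpace ℝ (Fin 2)} {ρ τ : ℝ}
    (hρ : 0 < ρ) (hp : closedBall p ρ ⊆ Ω) (hτ : 0 ≤ τ) :
    volume.real {x ∈ Ω | infDist x Ωᶜ < τ} ≤ 2 / ρ * τ := by
  have hne := nonempty_compl_of_volume_eq_one hvol
  have htop : volume Ω ≠ ⊤ := by simp [hvol]
  have hvr : volume.real Ω = 1 := by simp [Measure.real, hvol]
  rcases le_total ρ τ with h | h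
  · calc volume.real {x ∈ Ω | infDist x Ωᶜ < τ} ≤ volume.real Ω :=
        measureReal_mono (Set.sep_subset _ _) htop
      _ = 1 := hvr
      _ ≤ 2 / ρ * τ := by
        rw [div_mul_eq_mul_div, le_div_iff₀ hρ]; linarith
  set s := τ / ρ with hs
  have hs0 : 0 ≤ s := by positivity
  have hs1 : s ≤ 1 := by rw [hs, div_le_one hρ]; exact h
  have hsρ : s * ρ = τ := div_mul_cancel₀ _ hρ.ne'
  set T := AffineMap.homothety p (1 - s) '' Ω with hT
  have hmem : ∀ y ∈ Ω, closedBall (AffineMap.homothety p (1 - s) y) τ ⊆ Ω := by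
    intro y hy
    have := hΩ.closedBall_combo_subset hp hy hs0 hs1
    rw [hsρ] at this
    have e : AffineMap.homothety p (1 - s) y = (1 - s) • y + s • p := by
      rw [AffineMap.homothety_apply, vsub_eq_sub, vadd_eq_add]
      module
    rwa [e]
  have hTΩ : T ⊆ Ω := by
    rintro _ ⟨y, hy, rfl⟩
    exact hmem y hy (mem_closedBall_self hτ)
  have hTv : volume.real T = (1 - s) ^ 2 := by
    rw [hT, Measure.real, Measure.addHaar_image_homothety, hvol, mul_one,
      ENNReal.toReal_ofReal (abs_nonneg _)]
    simp
  have hTvol : volume T ≠ ⊤ := ne_top_of_le_ne_top htop (measure_mono hTΩ)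
  have hsub : {x ∈ Ω | infDist x Ωᶜ < τ} ⊆ Ω \ T := by
    rintro x ⟨hx, hlt⟩
    refine ⟨hx, ?_⟩
    rintro ⟨y, hy, rfl⟩
    exact absurd (le_infDist_compl hne (hmem y hy)) (not_le.2 hlt)
  have hTm : NullMeasurableSet T volume :=
    (hΩ.affine_image _).nullMeasurableSet volume
  calc volume.real {x ∈ Ω | infDist x Ωᶜ < τ} ≤ volume.real (Ω \ T) :=
        measureReal_mono hsub (ne_top_of_le_ne_top htop (measure_mono Set.sdiff_subset))
    _ = 1 - (1 - s) ^ 2 := by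
        rw [measureReal_def, measure_sdiff hTΩ hTm hTvol,
          ENNReal.toReal_sub_of_le (measure_mono hTΩ) htop]
        rw [← measureReal_def, ← measureReal_def, hvr, hTv]
    _ ≤ 2 * s := by nlinarith
    _ = 2 / ρ * τ := by rw [hs]; ring

/-- Points of a convex set all of whose translates by `± v` leave the set. -/
lemma volume_short_chords_le {Ω : Set (EuclideanSpace ℝ (Fin 2))} (hΩ : Convex ℝ Ω)
    (hcl : IsClosed Ω) {p : EuclideanSpace ℝ (Fin 2)} {ρ D : ℝ} (hρ : 0 < ρ)
    (hp : closedBall p ρ ⊆ Ω) (hD : Ω ⊆ closedBall p D) (v : EuclideanSpace ℝ (Fin 2)) :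
    volume {x | x ∈ Ω ∧ x + v ∉ Ω ∧ x - v ∉ Ω} ≤ ENNReal.ofReal (4 * D / ρ * ‖v‖ ^ 2) := by
  rcases eq_or_ne v 0 with rfl | hv
  · have : {x | x ∈ Ω ∧ x + 0 ∉ Ω ∧ x - 0 ∉ Ω} = ∅ := by
      ext x; simp
    rw [this]; simp
  have hv0 : 0 < ‖v‖ := norm_pos_iff.2 hv
  have hu : ‖‖v‖⁻¹ • v‖ = 1 := by
    rw [norm_smul, norm_inv, norm_norm, inv_mul_cancel₀ hv0.ne']
  set u := ‖v‖⁻¹ • v with hudef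
  have hvu : v = ‖v‖ • u := by rw [hudef, smul_inv_smul₀ hv0.ne']
  obtain ⟨u', -, hnorm, hmp⟩ := exists_measurePreserving_coordinates hu
  have hmp' : MeasurePreserving (fun q : ℝ × ℝ => p + (q.1 • u + q.2 • u')) volume volume :=
    (measurePreserving_add_left volume p).comp hmp
  set ψ : ℝ × ℝ → EuclideanSpace ℝ (Fin 2) := fun q => p + (q.1 • u + q.2 • u') with hψ
  have hψc : Continuous ψ := by fun_prop
  set S := {x | x ∈ Ω ∧ x + v ∉ Ω ∧ x - v ∉ Ω} with hS
  have hSm : MeasurableSet S := by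
    refine hcl.measurableSet.inter (MeasurableSet.inter ?_ ?_)
    · exact (hcl.measurableSet.preimage (f := fun x => x + v) (by fun_prop)).compl
    · exact (hcl.measurableSet.preimage (f := fun x => x - v) (by fun_prop)).compl
  rw [← hmp'.measure_preimage hSm.nullMeasurableSet]
  have hD0 : 0 ≤ D := by
    have := hD (hp (mem_closedBall_self hρ.le))
    simpa using this
  have hmemK : ∀ q : ℝ × ℝ, q.1 ^ 2 + q.2 ^ 2 ≤ ρ ^ 2 → q ∈ ψ ⁻¹' Ω := by
    intro q hq
    apply hp
    rw [mem_closedBall, dist_eq_norm, hψ, add_sub_cancel_left]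
    apply le_of_sq_le_sq _ hρ.le
    rw [hnorm]; exact hq
  have := volume_horizontal_short_chords_le (K := ψ ⁻¹' Ω) (ρ := ρ) (D := D) (w := ‖v‖) (by
      intro q hq q' hq' a b ha hb hab
      have := hΩ hq hq' ha hb hab
      rw [Set.mem_preimage]
      convert this using 1
      have : p = (a + b) • p := by rw [hab, one_smul]
      simp only [hψ, Prod.fst_add, Prod.snd_add, Prod.smul_fst, Prod.smul_snd, smul_eq_mul]
      nth_rewrite 1 [this]
      module) (hψc.measurable hcl.measurableSet) hρ hD0 hv0
    (hmemK _ (by simp)) (hmemK _ (by simp)) (by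
      intro q hq
      have := hD hq
      rw [mem_closedBall, dist_eq_norm, hψ, add_sub_cancel_left] at this
      apply abs_le_of_sq_le_sq _ hD0
      have h2 := hnorm q.1 q.2
      have h3 : ‖q.1 • u + q.2 • u'‖ ^ 2 ≤ D ^ 2 := by gcongr
      nlinarith [sq_nonneg q.1])
  convert this using 3
  ext q
  have e1 : ψ (q.1 + ‖v‖, q.2) = ψ q + v := by
    nth_rewrite 2 [hvu]; simp only [hψ]; module
  have e2 : ψ (q.1 - ‖v‖, q.2) = ψ q - v := by
    nth_rewrite 2 [hvu]; simp only [hψ]; module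
  simp only [hS, Set.mem_preimage, Set.mem_ofPred_eq, e1, e2]

/-- A convex set fills a fixed proportion of small disks centered in it. -/
lemma volume_closedBall_inter_ge {Ω : Set (EuclideanSpace ℝ (Fin 2))} (hΩ : Convex ℝ Ω)
    (hvol : volume Ω ≠ ⊤) {p : EuclideanSpace ℝ (Fin 2)} {ρ D r : ℝ} (hρ : 0 < ρ)
    (hp : closedBall p ρ ⊆ Ω) (hD : Ω ⊆ closedBall p D) (hr : 0 ≤ r) (hrρ : r ≤ ρ)
    {x : EuclideanSpace ℝ (Fin 2)} (hx : x ∈ Ω) :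
    (ρ / (D + ρ)) ^ 2 * (π * r ^ 2) ≤ volume.real (closedBall x r ∩ Ω) := by
  have hD0 : 0 ≤ D := by
    have := hD (hp (mem_closedBall_self hρ.le))
    simpa using this
  set s := r / (D + ρ) with hs
  have hs0 : 0 ≤ s := by positivity
  have hs1 : s ≤ 1 := by
    rw [hs, div_le_one (by positivity)]; linarith
  have h1 := hΩ.closedBall_combo_subset hp hx hs0 hs1
  have h2 : closedBall ((1 - s) • x + s • p) (s * ρ) ⊆ closedBall x r := by
    apply closedBall_subset_closedBall'
    rw [dist_eq_norm]
    have : (1 - s) • x + s • p - x = s • (p - x) := by module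
    rw [this, norm_smul, Real.norm_of_nonneg hs0]
    have h3 : ‖p - x‖ ≤ D := by
      have := hD hx
      rwa [mem_closedBall', dist_eq_norm] at this
    have h4 : s * (D + ρ) = r := div_mul_cancel₀ _ (by positivity)
    nlinarith [mul_le_mul_of_nonneg_left h3 hs0]
  have h3 : volume.real (closedBall ((1 - s) • x + s • p) (s * ρ)) ≤
      volume.real (closedBall x r ∩ Ω) :=
    measureReal_mono (Set.subset_inter h2 h1)
      (ne_top_of_le_ne_top hvol (measure_mono Set.inter_subset_right))
  refine le_of_eq_of_le ?_ h3
  rw [Measure.real, EuclideanSpace.volume_closedBall_fin_two, ENNReal.toReal_mul,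
    ENNReal.toReal_pow, ENNReal.toReal_ofReal (by positivity), ENNReal.toReal_ofReal pi_pos.le, hs]
  ring

/-- The vectors of length at most `r` that lead out of `Ω` from `x` in both orientations. -/
def missedPairs (Ω : Set (EuclideanSpace ℝ (Fin 2))) (r : ℝ) (x : EuclideanSpace ℝ (Fin 2)) :
    Set (EuclideanSpace ℝ (Fin 2)) :=
  {v | v ∈ closedBall 0 r ∧ x + v ∉ Ω ∧ x - v ∉ Ω}

lemma measurableSet_missedPairs_graph {Ω : Set (EuclideanSpace ℝ (Fin 2))}
    (hΩ : MeasurableSet Ω) (r : ℝ) :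
    MeasurableSet {q : EuclideanSpace ℝ (Fin 2) × EuclideanSpace ℝ (Fin 2) |
      q.2 ∈ missedPairs Ω r q.1} := by
  refine MeasurableSet.inter ?_ (MeasurableSet.inter ?_ ?_)
  · exact measurableSet_closedBall.preimage measurable_snd
  · exact (hΩ.preimage (f := fun q : EuclideanSpace ℝ (Fin 2) × EuclideanSpace ℝ (Fin 2) =>
      q.1 + q.2) (by fun_prop)).compl
  · exact (hΩ.preimage (f := fun q : EuclideanSpace ℝ (Fin 2) × EuclideanSpace ℝ (Fin 2) =>
      q.1 - q.2) (by fun_prop)).compl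

lemma measurable_volume_missedPairs {Ω : Set (EuclideanSpace ℝ (Fin 2))}
    (hΩ : MeasurableSet Ω) (r : ℝ) : Measurable fun x => volume (missedPairs Ω r x) :=
  measurable_measure_prodMk_left (measurableSet_missedPairs_graph hΩ r)

lemma volume_missedPairs_ne_top (Ω : Set (EuclideanSpace ℝ (Fin 2))) (r : ℝ)
    (x : EuclideanSpace ℝ (Fin 2)) : volume (missedPairs Ω r x) ≠ ⊤ :=
  ne_top_of_le_ne_top (measure_closedBall_lt_top (x := (0 : EuclideanSpace ℝ (Fin 2)))
    (r := r)).ne (measure_mono fun _ hv => hv.1)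

lemma volume_real_closedBall_plane (x : EuclideanSpace ℝ (Fin 2)) {r : ℝ} (hr : 0 ≤ r) :
    volume.real (closedBall x r) = π * r ^ 2 := by
  rw [Measure.real, EuclideanSpace.volume_closedBall_fin_two, ENNReal.toReal_mul,
    ENNReal.toReal_pow, ENNReal.toReal_ofReal hr, ENNReal.toReal_ofReal pi_pos.le]
  ring

/-- On average over a convex set, few pairs of antipodal vectors leave the set. -/
lemma lintegral_volume_missedPairs_le {Ω : Set (EuclideanSpace ℝ (Fin 2))} (hΩ : Convex ℝ Ω)
    (hcl : IsClosed Ω) {p : EuclideanSpace ℝ (Fin 2)} {ρ D r : ℝ} (hρ : 0 < ρ)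
    (hp : closedBall p ρ ⊆ Ω) (hD : Ω ⊆ closedBall p D) (hr : 0 ≤ r) :
    ∫⁻ x in Ω, volume (missedPairs Ω r x) ≤ ENNReal.ofReal (4 * π * D / ρ * r ^ 4) := by
  have hD0 : 0 ≤ D := by
    have := hD (hp (mem_closedBall_self hρ.le))
    simpa using this
  set T := {q : EuclideanSpace ℝ (Fin 2) × EuclideanSpace ℝ (Fin 2) |
      q.2 ∈ missedPairs Ω r q.1} with hT
  have hTm : MeasurableSet T := measurableSet_missedPairs_graph hcl.measurableSet r
  have h1 : ∫⁻ x in Ω, volume (missedPairs Ω r x) = ((volume.restrict Ω).prod volume) T :=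
    (Measure.prod_apply hTm).symm
  rw [h1, Measure.prod_apply_symm hTm]
  have h2 : ∀ v, (volume.restrict Ω) ((fun x => (x, v)) ⁻¹' T) ≤
      (closedBall 0 r).indicator (fun _ => ENNReal.ofReal (4 * D / ρ * r ^ 2)) v := by
    intro v
    by_cases hv : v ∈ closedBall (0 : EuclideanSpace ℝ (Fin 2)) r
    · rw [Set.indicator_of_mem hv, Measure.restrict_apply (hTm.preimage measurable_prodMk_right)]
      have hvr : ‖v‖ ≤ r := by simpa using hv
      refine (measure_mono ?_).trans ((volume_short_chords_le hΩ hcl hρ hp hD v).trans ?_)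
      · rintro x ⟨hx, hxΩ⟩
        exact ⟨hxΩ, hx.2⟩
      · apply ENNReal.ofReal_le_ofReal
        gcongr
    · have : (fun x => (x, v)) ⁻¹' T = ∅ := by
        ext x
        simp only [Set.mem_preimage, Set.mem_empty_iff_false, iff_false]
        exact fun h => hv h.1
      rw [this]; simp
  refine (lintegral_mono h2).trans (le_of_eq ?_)
  rw [lintegral_indicator_const measurableSet_closedBall,
    EuclideanSpace.volume_closedBall_fin_two, ← ENNReal.ofReal_pow hr,
    ← ENNReal.ofReal_mul (by positivity), ← ENNReal.ofReal_mul (by positivity)]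
  congr 1
  ring

/-- The Markov inequality for the area of missed pairs. -/
lemma volume_many_missedPairs_le {Ω : Set (EuclideanSpace ℝ (Fin 2))} (hΩ : Convex ℝ Ω)
    (hcl : IsClosed Ω) {p : EuclideanSpace ℝ (Fin 2)} {ρ D r m : ℝ} (hρ : 0 < ρ)
    (hp : closedBall p ρ ⊆ Ω) (hD : Ω ⊆ closedBall p D) (hr : 0 ≤ r) (hm : 0 < m) :
    volume.real {x ∈ Ω | m ≤ volume.real (missedPairs Ω r x)} ≤
      4 * π * D / ρ * r ^ 4 / m := by
  have hD0 : 0 ≤ D := by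
    have := hD (hp (mem_closedBall_self hρ.le))
    simpa using this
  have h := (mul_meas_ge_le_lintegral (μ := volume.restrict Ω)
    (measurable_volume_missedPairs hcl.measurableSet r) (ENNReal.ofReal m)).trans
    (lintegral_volume_missedPairs_le hΩ hcl hρ hp hD hr)
  have hms : MeasurableSet {x | ENNReal.ofReal m ≤ volume (missedPairs Ω r x)} :=
    measurableSet_le measurable_const (measurable_volume_missedPairs hcl.measurableSet r)
  rw [Measure.restrict_apply hms] at h
  have heq : {x | ENNReal.ofReal m ≤ volume (missedPairs Ω r x)} ∩ Ω =
      {x ∈ Ω | m ≤ volume.real (missedPairs Ω r x)} := by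
    ext x
    simp only [Set.mem_inter_iff, Set.mem_ofPred_eq, Measure.real,
      ENNReal.ofReal_le_iff_le_toReal (volume_missedPairs_ne_top Ω r x)]
    tauto
  rw [heq] at h
  have h2 := ENNReal.toReal_mono ENNReal.ofReal_ne_top h
  rw [ENNReal.toReal_mul, ENNReal.toReal_ofReal hm.le,
    ENNReal.toReal_ofReal (by positivity)] at h2
  rw [le_div_iff₀ hm, mul_comm]
  exact h2

/-- The area of a disk inside `Ω`, by sorting antipodal pairs of points of the disk. -/
lemma two_mul_volume_closedBall_inter {Ω : Set (EuclideanSpace ℝ (Fin 2))}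
    (hΩ : MeasurableSet Ω) {r : ℝ} (hr : 0 ≤ r) (x : EuclideanSpace ℝ (Fin 2)) :
    2 * volume.real (closedBall x r ∩ Ω) = π * r ^ 2 - volume.real (missedPairs Ω r x) +
      volume.real {v | v ∈ closedBall 0 r ∧ x + v ∈ Ω ∧ x - v ∈ Ω} := by
  set P := {v : EuclideanSpace ℝ (Fin 2) | v ∈ closedBall 0 r ∧ x + v ∈ Ω} with hP
  set N := {v : EuclideanSpace ℝ (Fin 2) | v ∈ closedBall 0 r ∧ x - v ∈ Ω} with hN
  have hball : volume (closedBall (0 : EuclideanSpace ℝ (Fin 2)) r) ≠ ⊤ :=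
    (measure_closedBall_lt_top).ne
  have hPm : MeasurableSet P :=
    measurableSet_closedBall.inter (hΩ.preimage (f := fun v => x + v) (by fun_prop))
  have hNm : MeasurableSet N :=
    measurableSet_closedBall.inter (hΩ.preimage (f := fun v => x - v) (by fun_prop))
  have hPv : volume.real P = volume.real (closedBall x r ∩ Ω) := by
    have : P = (fun v => x + v) ⁻¹' (closedBall x r ∩ Ω) := by
      ext v; simp [hP]
    rw [this, Measure.real, measure_preimage_add, Measure.real]
  have hNv : volume.real N = volume.real P := by
    have : N = Neg.neg ⁻¹' P := by
      ext v; simp [hP, hN, sub_eq_add_neg]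
    rw [this, Measure.real, Measure.measure_preimage_neg, Measure.real]
  have hPtop : volume P ≠ ⊤ := ne_top_of_le_ne_top hball (measure_mono fun _ h => h.1)
  have hNtop : volume N ≠ ⊤ := ne_top_of_le_ne_top hball (measure_mono fun _ h => h.1)
  have h1 := measureReal_union_add_inter (μ := volume) (s := P) (t := N) hNm hPtop hNtop
  have h2 : P ∩ N = {v | v ∈ closedBall 0 r ∧ x + v ∈ Ω ∧ x - v ∈ Ω} := by
    ext v
    simp only [hP, hN, Set.mem_inter_iff, Set.mem_ofPred_eq]
    tauto
  have h3 : missedPairs Ω r x = closedBall 0 r \ (P ∪ N) := by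
    ext v
    simp only [missedPairs, hP, hN, Set.mem_sdiff, Set.mem_union, Set.mem_ofPred_eq]
    tauto
  have h4 : volume.real (missedPairs Ω r x) = π * r ^ 2 - volume.real (P ∪ N) := by
    rw [h3, measureReal_sdiff (Set.union_subset (fun _ h => h.1) (fun _ h => h.1))
      (hPm.union hNm) hball, volume_real_closedBall_plane _ hr]
  rw [h2] at h1
  linarith

/-- If few pairs are missed at a point whose distance to the boundary is at least `τ`, then
the set contains a long chord bisected by this point. -/
lemma exists_bisected_chord {Ω : Set (EuclideanSpace ℝ (Fin 2))} (hΩ : Convex ℝ Ω)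
    (hcl : IsClosed Ω) {x : EuclideanSpace ℝ (Fin 2)} {r τ : ℝ} (hτ0 : 0 ≤ τ) (hτr : τ ≤ r / 2)
    (hx : closedBall x τ ⊆ Ω) (hmiss : volume.real (missedPairs Ω r x) < π * τ ^ 2) :
    ∃ u : EuclideanSpace ℝ (Fin 2), ‖u‖ = 1 ∧ x + (r / 4) • u ∈ Ω ∧ x - (r / 4) • u ∈ Ω := by
  have key : ∀ u : EuclideanSpace ℝ (Fin 2), ‖u‖ = 1 → ∀ v ∈ closedBall ((r / 2) • u) τ,
      x + v ∈ Ω → x + (r / 4) • u ∈ Ω := by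
    intro u hu v hv hxv
    have hw : x + ((r / 2) • u - v) ∈ Ω := by
      apply hx
      rw [mem_closedBall', dist_eq_norm] at hv
      simpa using hv
    have := hΩ.midpoint_combo_mem hxv hw
    convert this using 2
    module
  have hcover : ∀ u : EuclideanSpace ℝ (Fin 2), ‖u‖ = 1 →
      x + (r / 4) • u ∈ Ω ∨ x - (r / 4) • u ∈ Ω := by
    intro u hu
    by_contra! hcon
    refine absurd hmiss (not_lt.2 ?_)
    rw [← volume_real_closedBall_plane ((r / 2) • u) hτ0]
    refine measureReal_mono ?_ (volume_missedPairs_ne_top Ω r x)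
    intro v hv
    refine ⟨?_, fun h => hcon.1 (key u hu v hv h), fun h => hcon.2 ?_⟩
    · refine closedBall_subset_closedBall' ?_ hv
      rw [dist_zero_right, norm_smul, hu, Real.norm_of_nonneg (by linarith)]
      linarith
    · have := key (-u) (by simpa using hu) (-v) (by
        rw [mem_closedBall, dist_eq_norm] at hv ⊢
        have e : -v - (r / 2) • (-u) = -(v - (r / 2) • u) := by module
        rwa [e, norm_neg]) (by rwa [← sub_eq_add_neg])
      convert this using 1
      module
  have hconn : IsPreconnected (sphere (0 : EuclideanSpace ℝ (Fin 2)) 1) := by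
    apply isPreconnected_sphere
    rw [← Module.finrank_eq_rank, finrank_euclideanSpace_fin]
    norm_num
  rw [isPreconnected_closed_iff] at hconn
  have hc1 : IsClosed {u : EuclideanSpace ℝ (Fin 2) | x + (r / 4) • u ∈ Ω} :=
    hcl.preimage (by fun_prop : Continuous fun u => x + (r / 4) • u)
  have hc2 : IsClosed {u : EuclideanSpace ℝ (Fin 2) | x - (r / 4) • u ∈ Ω} :=
    hcl.preimage (by fun_prop : Continuous fun u => x - (r / 4) • u)
  obtain ⟨u₀, hu₀⟩ : ∃ u : EuclideanSpace ℝ (Fin 2), ‖u‖ = 1 := exists_norm_eq _ zero_le_one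
  have hflip : ∀ u : EuclideanSpace ℝ (Fin 2), x - (r / 4) • (-u) = x + (r / 4) • u ∧
      x + (r / 4) • (-u) = x - (r / 4) • u := fun u => ⟨by module, by module⟩
  have hex : ∃ u : EuclideanSpace ℝ (Fin 2), ‖u‖ = 1 ∧ x + (r / 4) • u ∈ Ω := by
    rcases hcover u₀ hu₀ with h | h
    · exact ⟨u₀, hu₀, h⟩
    · exact ⟨-u₀, by simpa using hu₀, by rw [(hflip u₀).2]; exact h⟩
  obtain ⟨u₁, hu₁, hu₁Ω⟩ := hex
  obtain ⟨u, hu, h1, h2⟩ := hconn _ _ hc1 hc2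
    (fun u hu => hcover u (by simpa using hu))
    ⟨u₁, by simpa using hu₁, hu₁Ω⟩
    ⟨-u₁, by simpa using hu₁, by rw [Set.mem_ofPred_eq, (hflip u₁).1]; exact hu₁Ω⟩
  exact ⟨u, by simpa using hu, h1, h2⟩

lemma volume_symmetric_part_ge {Ω : Set (EuclideanSpace ℝ (Fin 2))} (hΩ : Convex ℝ Ω)
    {x : EuclideanSpace ℝ (Fin 2)} {r τ : ℝ} (hτ0 : 0 ≤ τ) (hτr : τ ≤ r / 2)
    (hx : closedBall x τ ⊆ Ω) {u : EuclideanSpace ℝ (Fin 2)} (hu : ‖u‖ = 1)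
    (h1 : x + (r / 4) • u ∈ Ω) (h2 : x - (r / 4) • u ∈ Ω) :
    r * τ / 4 ≤ volume.real {v | v ∈ closedBall 0 r ∧ x + v ∈ Ω ∧ x - v ∈ Ω} := by
  obtain ⟨u', hu', -, hmp⟩ := exists_measurePreserving_coordinates hu
  set R := Set.Icc (-(r / 8)) (r / 8) ×ˢ Set.Icc (-(τ / 2)) (τ / 2) with hR
  have hr0 : 0 ≤ r := by linarith
  have mem : ∀ a b : ℝ, |a| ≤ r / 8 → |b| ≤ τ / 2 → x + (a • u + b • u') ∈ Ω := by
    intro a b ha hb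
    have e1 : x + (2 * a) • u ∈ Ω := by
      rw [abs_le] at ha
      rcases hr0.eq_or_lt with h | h
      · have : a = 0 := by linarith
        rw [this]; simpa using hx (mem_closedBall_self hτ0)
      · have := hΩ h1 h2 (a := 1 / 2 + 4 * a / r) (b := 1 / 2 - 4 * a / r)
          (by have : -(1 / 2) ≤ 4 * a / r := by rw [le_div_iff₀ h]; linarith
              linarith)
          (by have : 4 * a / r ≤ 1 / 2 := by rw [div_le_iff₀ h]; linarith
              linarith) (by ring)
        convert this using 1
        match_scalars <;> field_simp <;> ring
    have e2 : x + (2 * b) • u' ∈ Ω := by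
      apply hx
      simp only [mem_closedBall, dist_self_add_left, norm_smul, hu', mul_one, Real.norm_eq_abs,
        abs_mul, abs_two]
      linarith
    have := hΩ.midpoint_combo_mem e1 e2
    convert this using 2
    module
  have hsub : R ⊆ (fun q : ℝ × ℝ => q.1 • u + q.2 • u') ⁻¹'
      {v | v ∈ closedBall 0 r ∧ x + v ∈ Ω ∧ x - v ∈ Ω} := by
    rintro ⟨a, b⟩ ⟨ha, hb⟩
    have ha' : |a| ≤ r / 8 := abs_le.2 ha
    have hb' : |b| ≤ τ / 2 := abs_le.2 hb
    refine ⟨?_, mem a b ha' hb', ?_⟩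
    · rw [mem_closedBall_zero_iff]
      refine (norm_add_le _ _).trans ?_
      rw [norm_smul, norm_smul, hu, hu', Real.norm_eq_abs, Real.norm_eq_abs]
      linarith
    · have := mem (-a) (-b) (by rwa [abs_neg]) (by rwa [abs_neg])
      convert this using 1
      module
  have hRv : volume R = ENNReal.ofReal (r * τ / 4) := by
    rw [hR, Measure.volume_eq_prod, Measure.prod_prod, Real.volume_Icc, Real.volume_Icc,
      ← ENNReal.ofReal_mul (by linarith)]
    congr 1
    ring
  have htop : volume {v : EuclideanSpace ℝ (Fin 2) | v ∈ closedBall 0 r ∧ x + v ∈ Ω ∧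
      x - v ∈ Ω} ≠ ⊤ :=
    ne_top_of_le_ne_top (measure_closedBall_lt_top (x := (0 : EuclideanSpace ℝ (Fin 2)))
      (r := r)).ne (measure_mono fun _ hv => hv.1)
  rw [Measure.real, ← ENNReal.ofReal_le_iff_le_toReal htop, ← hRv]
  exact (measure_mono hsub).trans (hmp.measure_preimage_le _)

/-- Exponential integrals of the distance to the boundary. -/
lemma integral_exp_neg_infDist_le {Ω : Set (EuclideanSpace ℝ (Fin 2))} (hΩ : Convex ℝ Ω)
    (hvol : volume Ω = 1) {p : EuclideanSpace ℝ (Fin 2)} {ρ κ : ℝ}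
    (hρ : 0 < ρ) (hp : closedBall p ρ ⊆ Ω) (hκ : 0 < κ) :
    ∫ x in Ω, exp (-(κ * infDist x Ωᶜ)) ≤ 4 / (ρ * κ) := by
  have hfin : IsFiniteMeasure (volume.restrict Ω) := ⟨by simp [hvol]⟩
  have htop : volume Ω ≠ ⊤ := by simp [hvol]
  have hcont : Continuous fun x => exp (-(κ * infDist x Ωᶜ)) := by
    have := continuous_infDist_pt Ωᶜ
    fun_prop
  have hle : ∀ x, exp (-(κ * infDist x Ωᶜ)) ≤ 1 := fun x => by
    rw [exp_le_one_iff]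
    have : 0 ≤ κ * infDist x Ωᶜ := mul_nonneg hκ.le infDist_nonneg
    linarith
  have hint : Integrable (fun x => exp (-(κ * infDist x Ωᶜ))) (volume.restrict Ω) :=
    Integrable.of_bound hcont.aestronglyMeasurable 1 (ae_of_all _ fun x => by
      rw [Real.norm_of_nonneg (exp_pos _).le]; exact hle x)
  rw [hint.integral_eq_integral_Ioc_meas_le (ae_of_all _ fun x => (exp_pos _).le)
    (ae_of_all _ hle)]
  have hlog : IntervalIntegrable (fun u => 2 / (ρ * κ) * (1 - log u)) volume 0 1 :=
    ((intervalIntegrable_const (c := (1 : ℝ))).sub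
      intervalIntegral.intervalIntegrable_log').const_mul _
  have hval : ∫ u in (0 : ℝ)..1, 2 / (ρ * κ) * (1 - log u) = 4 / (ρ * κ) := by
    rw [intervalIntegral.integral_const_mul, intervalIntegral.integral_sub
      intervalIntegrable_const intervalIntegral.intervalIntegrable_log', integral_log]
    simp
    ring
  rw [← hval, intervalIntegral.integral_of_le zero_le_one]
  refine integral_mono_of_nonneg (ae_of_all _ fun u => measureReal_nonneg)
    ((intervalIntegrable_iff_integrableOn_Ioc_of_le zero_le_one).1 hlog) ?_
  filter_upwards [ae_restrict_mem measurableSet_Ioc] with u hu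
  have hlu : log u ≤ 0 := log_nonpos hu.1.le hu.2
  rw [measureReal_restrict_apply (measurableSet_le measurable_const hcont.measurable)]
  calc volume.real ({x | u ≤ exp (-(κ * infDist x Ωᶜ))} ∩ Ω)
      ≤ volume.real {x ∈ Ω | infDist x Ωᶜ < (1 - log u) / κ} := by
        refine measureReal_mono ?_ (ne_top_of_le_ne_top htop (measure_mono (Set.sep_subset _ _)))
        rintro x ⟨hx, hxΩ⟩
        refine ⟨hxΩ, ?_⟩
        rw [lt_div_iff₀ hκ]
        have := (log_le_iff_le_exp hu.1).2 hx
        linarith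
    _ ≤ 2 / ρ * ((1 - log u) / κ) :=
        volume_boundary_layer_le hΩ hvol hρ hp (div_nonneg (by linarith) hκ.le)
    _ = 2 / (ρ * κ) * (1 - log u) := by field_simp

/-- Lower bound for the area of a disk inside `Ω` when few pairs of points are missed: half a
disk, up to a small error, plus a term that is linear in the distance to the boundary. -/
lemma volume_closedBall_inter_ge_of_few_missedPairs {Ω : Set (EuclideanSpace ℝ (Fin 2))}
    (hΩ : Convex ℝ Ω) (hcl : IsClosed Ω) {x : EuclideanSpace ℝ (Fin 2)} (hx : x ∈ Ω) {r L : ℝ}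
    (hr : 0 < r) (hL : 2 ≤ L) (htr : infDist x Ωᶜ < r) (hrt : r / L ≤ infDist x Ωᶜ)
    (hmiss : volume.real (missedPairs Ω r x) < π * (r / L) ^ 2) :
    π * r ^ 2 / 2 - π * (r / L) ^ 2 / 2 + r * infDist x Ωᶜ / 16 ≤
      volume.real (closedBall x r ∩ Ω) := by
  set t := infDist x Ωᶜ with ht
  have hL0 : 0 < L := by linarith
  have hball := closedBall_infDist_compl_subset hcl hx
  set τ := min t (r / 2) with hτ
  have hτt : τ ≤ t := min_le_left _ _
  have hτr : τ ≤ r / 2 := min_le_right _ _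
  have hτL : r / L ≤ τ := by
    refine le_min hrt ?_
    gcongr
  have htτ : t / 2 ≤ τ := le_min (by linarith [div_nonneg hr.le hL0.le]) (by linarith)
  have hτ0 : 0 ≤ τ := (div_nonneg hr.le hL0.le).trans hτL
  have hsub : closedBall x τ ⊆ Ω := (closedBall_subset_closedBall hτt).trans hball
  obtain ⟨u, hu, h1, h2⟩ := exists_bisected_chord hΩ hcl hτ0 hτr hsub
    (hmiss.trans_le (by gcongr))
  have ha := volume_symmetric_part_ge hΩ hτ0 hτr hsub hu h1 h2
  have hA := two_mul_volume_closedBall_inter hcl.measurableSet hr.le x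
  nlinarith [mul_le_mul_of_nonneg_left htτ hr.le]

lemma measurable_volume_closedBall_inter {Ω : Set (EuclideanSpace ℝ (Fin 2))}
    (hΩ : MeasurableSet Ω) (r : ℝ) : Measurable fun x => volume.real (closedBall x r ∩ Ω) := by
  have hm : MeasurableSet {q : EuclideanSpace ℝ (Fin 2) × EuclideanSpace ℝ (Fin 2) |
      dist q.2 q.1 ≤ r ∧ q.2 ∈ Ω} :=
    (measurableSet_le (measurable_snd.dist measurable_fst) measurable_const).inter
      (hΩ.preimage measurable_snd)
  exact (measurable_measure_prodMk_left hm).ennreal_toReal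

lemma integrable_exp_neg_volume {Ω : Set (EuclideanSpace ℝ (Fin 2))}
    (hΩ : MeasurableSet Ω) (hvol : volume Ω = 1) (r : ℝ) {N : ℝ} (hN : 0 ≤ N) :
    IntegrableOn (fun x => exp (-(N * volume.real (closedBall x r ∩ Ω)))) Ω := by
  have hfin : IsFiniteMeasure (volume.restrict Ω) := ⟨by simp [hvol]⟩
  refine Integrable.of_bound
    ((measurable_volume_closedBall_inter hΩ r).const_mul N).neg.exp.aestronglyMeasurable 1
    (ae_of_all _ fun x => ?_)
  rw [Real.norm_of_nonneg (exp_pos _).le, exp_le_one_iff, neg_nonpos]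
  exact mul_nonneg hN measureReal_nonneg

lemma integral_exp_neg_volume_ge {Ω : Set (EuclideanSpace ℝ (Fin 2))}
    (hΩ : MeasurableSet Ω) (hvol : volume Ω = 1) {r N : ℝ} (hr : 0 ≤ r) (hN : 0 ≤ N) :
    exp (-(N * (π * r ^ 2))) ≤ ∫ x in Ω, exp (-(N * volume.real (closedBall x r ∩ Ω))) := by
  have hvr : volume.real Ω = 1 := by simp [Measure.real, hvol]
  have htop : volume Ω ≠ ⊤ := by simp [hvol]
  calc exp (-(N * (π * r ^ 2))) = ∫ x in Ω, exp (-(N * (π * r ^ 2))) := by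
        rw [setIntegral_const, hvr]; simp
    _ ≤ _ := by
        refine setIntegral_mono_on (integrableOn_const htop)
          (integrable_exp_neg_volume hΩ hvol r hN) hΩ fun x _ => ?_
        have : volume.real (closedBall x r ∩ Ω) ≤ π * r ^ 2 := by
          rw [← volume_real_closedBall_plane x hr]
          exact measureReal_mono Set.inter_subset_left (measure_closedBall_lt_top).ne
        gcongr

/-- Upper bound for the integral, where the three error terms come from the points that miss many
pairs, from those very close to the boundary, and from the remaining boundary layer. -/
lemma integral_exp_neg_volume_le {Ω : Set (EuclideanSpace ℝ (Fin 2))} (hΩ : Convex ℝ Ω)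
    (hcl : IsClosed Ω) (hvol : volume Ω = 1) {p : EuclideanSpace ℝ (Fin 2)} {ρ D r N L : ℝ}
    (hρ : 0 < ρ) (hp : closedBall p ρ ⊆ Ω) (hD : Ω ⊆ closedBall p D) (hr : 0 < r) (hrρ : r ≤ ρ)
    (hN : 0 < N) (hL : L = N * (π * r ^ 2)) (hL2 : 2 ≤ L) :
    ∫ x in Ω, exp (-(N * volume.real (closedBall x r ∩ Ω))) ≤
      exp (-L) + exp (-((ρ / (D + ρ)) ^ 2 * L)) * (4 * D / ρ * r ^ 2 * L ^ 2) +
        exp (1 - L / 2) * (2 / ρ * (r / L) + 64 / (ρ * (N * r))) := by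
  have hvr : volume.real Ω = 1 := by simp [Measure.real, hvol]
  have htop : volume Ω ≠ ⊤ := by simp [hvol]
  have hfin : IsFiniteMeasure (volume.restrict Ω) := ⟨by simp [hvol]⟩
  have hL0 : 0 < L := by linarith
  have hpi := pi_pos
  set t : EuclideanSpace ℝ (Fin 2) → ℝ := fun x => infDist x Ωᶜ with ht
  have htc : Continuous t := continuous_infDist_pt Ωᶜ
  set B := {x | π * (r / L) ^ 2 ≤ volume.real (missedPairs Ω r x)} with hB
  set T := {x | t x < r / L} with hT
  have hBm : MeasurableSet B := measurableSet_le measurable_const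
    (measurable_volume_missedPairs hcl.measurableSet r).ennreal_toReal
  have hTm : MeasurableSet T := measurableSet_lt htc.measurable measurable_const
  have hexp : Integrable (fun x => exp (-(N * r / 16 * t x))) (volume.restrict Ω) := by
    refine Integrable.of_bound (by fun_prop) 1 (ae_of_all _ fun x => ?_)
    rw [Real.norm_of_nonneg (exp_pos _).le, exp_le_one_iff, neg_nonpos]
    exact mul_nonneg (by positivity) infDist_nonneg
  have hpt : ∀ x ∈ Ω, exp (-(N * volume.real (closedBall x r ∩ Ω))) ≤
      exp (-L) + B.indicator (fun _ => exp (-((ρ / (D + ρ)) ^ 2 * L))) x +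
        (T.indicator (fun _ => exp (1 - L / 2)) x +
          exp (1 - L / 2) * exp (-(N * r / 16 * t x))) := by
    intro x hx
    have p1 := (exp_pos (-L)).le
    have p2 : 0 ≤ B.indicator (fun _ => exp (-((ρ / (D + ρ)) ^ 2 * L))) x :=
      Set.indicator_nonneg (fun _ _ => (exp_pos _).le) x
    have p3 : 0 ≤ T.indicator (fun _ => exp (1 - L / 2)) x :=
      Set.indicator_nonneg (fun _ _ => (exp_pos _).le) x
    have p4 : 0 ≤ exp (1 - L / 2) * exp (-(N * r / 16 * t x)) := by positivity
    have hsmall : N * (π * (r / L) ^ 2 / 2) ≤ 1 := by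
      have : N * (π * (r / L) ^ 2 / 2) = (N * (π * r ^ 2)) / L / L / 2 := by
        field_simp
      rw [this, ← hL, div_self hL0.ne', div_div, div_le_one (by positivity)]
      linarith
    rcases le_or_gt r (t x) with hrt | htr
    · have hsub : closedBall x r ⊆ Ω :=
        (closedBall_subset_closedBall hrt).trans (closedBall_infDist_compl_subset hcl hx)
      rw [Set.inter_eq_left.2 hsub, volume_real_closedBall_plane x hr.le, ← hL]
      linarith
    by_cases hxB : x ∈ B
    · have h := volume_closedBall_inter_ge hΩ htop hρ hp hD hr.le hrρ hx
      rw [Set.indicator_of_mem hxB] at p2 ⊢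
      have : exp (-(N * volume.real (closedBall x r ∩ Ω))) ≤
          exp (-((ρ / (D + ρ)) ^ 2 * L)) := by
        rw [exp_le_exp, neg_le_neg_iff, hL]
        calc (ρ / (D + ρ)) ^ 2 * (N * (π * r ^ 2))
            = N * ((ρ / (D + ρ)) ^ 2 * (π * r ^ 2)) := by ring
          _ ≤ _ := by gcongr
      linarith
    have hmiss : volume.real (missedPairs Ω r x) < π * (r / L) ^ 2 := not_le.1 hxB
    by_cases hxT : x ∈ T
    · have h := two_mul_volume_closedBall_inter hcl.measurableSet hr.le x
      have h0 : 0 ≤ volume.real {v | v ∈ closedBall 0 r ∧ x + v ∈ Ω ∧ x - v ∈ Ω} :=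
        measureReal_nonneg
      rw [Set.indicator_of_mem hxT] at p3 ⊢
      have : exp (-(N * volume.real (closedBall x r ∩ Ω))) ≤ exp (1 - L / 2) := by
        rw [exp_le_exp]
        have : N * (π * r ^ 2 / 2 - π * (r / L) ^ 2 / 2) ≤
            N * volume.real (closedBall x r ∩ Ω) := by
          gcongr; linarith
        linarith
      linarith
    · have h := volume_closedBall_inter_ge_of_few_missedPairs hΩ hcl hx hr hL2 htr
        (not_lt.1 hxT) hmiss
      have : exp (-(N * volume.real (closedBall x r ∩ Ω))) ≤
          exp (1 - L / 2) * exp (-(N * r / 16 * t x)) := by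
        rw [← exp_add, exp_le_exp]
        have := mul_le_mul_of_nonneg_left h hN.le
        have e : N * (r * infDist x Ωᶜ / 16) = N * r / 16 * t x := by simp only [ht]; ring
        linarith
      linarith
  have iB : Integrable (B.indicator fun _ => exp (-((ρ / (D + ρ)) ^ 2 * L)))
      (volume.restrict Ω) := (integrable_const _).indicator hBm
  have iT : Integrable (T.indicator fun _ => exp (1 - L / 2))
      (volume.restrict Ω) := (integrable_const _).indicator hTm
  have iE := hexp.const_mul (exp (1 - L / 2))
  have i1 : Integrable (fun _ : EuclideanSpace ℝ (Fin 2) => exp (-L)) (volume.restrict Ω) :=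
    integrable_const _
  refine (setIntegral_mono_on (integrable_exp_neg_volume hcl.measurableSet hvol r hN.le)
    ((i1.add iB).add (iT.add iE)) hcl.measurableSet hpt).trans ?_
  have hsum : ∫ x in Ω, (exp (-L) + B.indicator (fun _ => exp (-((ρ / (D + ρ)) ^ 2 * L))) x +
        (T.indicator (fun _ => exp (1 - L / 2)) x +
          exp (1 - L / 2) * exp (-(N * r / 16 * t x)))) =
      exp (-L) + volume.real (B ∩ Ω) * exp (-((ρ / (D + ρ)) ^ 2 * L)) +
        (volume.real (T ∩ Ω) * exp (1 - L / 2) +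
          exp (1 - L / 2) * ∫ x in Ω, exp (-(N * r / 16 * t x))) := by
    have s1 : ∫ x in Ω, exp (-L) = exp (-L) := by rw [setIntegral_const, hvr]; simp
    have s2 := integral_add (i1.add iB) (iT.add iE)
    simp only [Pi.add_apply] at s2
    rw [s2, integral_add i1 iB, integral_add iT iE,
      integral_indicator_const _ hBm, integral_indicator_const _ hTm, integral_const_mul, s1,
      measureReal_restrict_apply hBm, measureReal_restrict_apply hTm, smul_eq_mul, smul_eq_mul]
  have hBv : volume.real (B ∩ Ω) ≤ 4 * D / ρ * r ^ 2 * L ^ 2 := by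
    have := volume_many_missedPairs_le hΩ hcl hρ hp hD hr.le (m := π * (r / L) ^ 2)
      (by positivity)
    rw [Set.inter_comm]
    refine this.trans_eq ?_
    field_simp
  have hTv : volume.real (T ∩ Ω) ≤ 2 / ρ * (r / L) := by
    rw [Set.inter_comm]
    exact volume_boundary_layer_le hΩ hvol hρ hp (by positivity)
  have hEv : ∫ x in Ω, exp (-(N * r / 16 * t x)) ≤ 64 / (ρ * (N * r)) := by
    refine (integral_exp_neg_infDist_le hΩ hvol hρ hp (by positivity)).trans_eq ?_
    field_simp
    norm_num
  refine hsum.le.trans ?_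
  have q1 := mul_le_mul_of_nonneg_right hBv (exp_pos (-((ρ / (D + ρ)) ^ 2 * L))).le
  have q2 := mul_le_mul_of_nonneg_right hTv (exp_pos (1 - L / 2)).le
  have q3 := mul_le_mul_of_nonneg_left hEv (exp_pos (1 - L / 2)).le
  linarith

/-- The previous upper bound when the radius is at the connectivity threshold. -/
lemma mul_integral_exp_neg_volume_le {Ω : Set (EuclideanSpace ℝ (Fin 2))} (hΩ : Convex ℝ Ω)
    (hcl : IsClosed Ω) (hvol : volume Ω = 1) {p : EuclideanSpace ℝ (Fin 2)} {ρ D r N L c : ℝ}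
    (hρ : 0 < ρ) (hp : closedBall p ρ ⊆ Ω) (hD : Ω ⊆ closedBall p D) (hr : 0 < r) (hrρ : r ≤ ρ)
    (hN : 0 < N) (hc : 0 ≤ c) (hLN : L = log N + c) (hL : L = N * (π * r ^ 2)) (hL2 : 2 ≤ L) :
    N * ∫ x in Ω, exp (-(N * volume.real (closedBall x r ∩ Ω))) ≤
      exp (-c) + 4 * D / (π * ρ) * (L ^ 3 * exp (-((ρ / (D + ρ)) ^ 2 * L))) +
        exp 1 * (2 / π + 64) / ρ * (√(L / π))⁻¹ := by
  have hL0 : 0 < L := by linarith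
  have hpi := pi_pos
  have hNL : N = exp (L - c) := by rw [hLN, add_sub_cancel_right, exp_log hN]
  set q := √(L / π) with hq
  have hq0 : 0 < q := by positivity
  have hqL : L = π * q ^ 2 := by rw [hq, sq_sqrt (by positivity)]; field_simp
  have hs0 : 0 < √N := sqrt_pos.2 hN
  have hss : √N * √N = N := mul_self_sqrt hN.le
  have hqr : √N * r = q := by
    rw [hq, hL]
    have : N * (π * r ^ 2) / π = N * r ^ 2 := by field_simp
    rw [this, sqrt_mul hN.le, sqrt_sq hr.le]
  have hr' : r = q / √N := by rw [← hqr]; field_simp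
  have h1 : N * exp (-L) = exp (-c) := by
    rw [hNL, ← exp_add]; congr 1; ring
  have h2 : √N * exp (1 - L / 2) ≤ exp 1 := by
    have : √N = exp ((L - c) / 2) := by
      rw [hNL, exp_half]
    rw [this, ← exp_add, exp_le_exp]
    linarith
  have hmain := mul_le_mul_of_nonneg_left
    (integral_exp_neg_volume_le hΩ hcl hvol hρ hp hD hr hrρ hN hL hL2) hN.le
  refine hmain.trans ?_
  have h3 : N * (exp (-((ρ / (D + ρ)) ^ 2 * L)) * (4 * D / ρ * r ^ 2 * L ^ 2)) =
      4 * D / (π * ρ) * (L ^ 3 * exp (-((ρ / (D + ρ)) ^ 2 * L))) := by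
    have : N * r ^ 2 = L / π := by rw [hL]; field_simp
    calc _ = (N * r ^ 2) * (exp (-((ρ / (D + ρ)) ^ 2 * L)) * (4 * D / ρ * L ^ 2)) := by ring
      _ = _ := by rw [this]; field_simp
  have h4 : N * (exp (1 - L / 2) * (2 / ρ * (r / L) + 64 / (ρ * (N * r)))) =
      (√N * exp (1 - L / 2)) * ((2 / π + 64) / ρ * q⁻¹) := by
    have e1 : √N * (2 / ρ * (r / L) + 64 / (ρ * (N * r))) = (2 / π + 64) / ρ * q⁻¹ := by
      rw [← hss, hqL, hr']
      field_simp
      rw [sqrt_sq hs0.le]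
    calc _ = (√N * √N) * (exp (1 - L / 2) * (2 / ρ * (r / L) + 64 / (ρ * (N * r)))) := by
          rw [hss]
      _ = (√N * exp (1 - L / 2)) * (√N * (2 / ρ * (r / L) + 64 / (ρ * (N * r)))) := by ring
      _ = _ := by rw [e1]
  have h5 : (√N * exp (1 - L / 2)) * ((2 / π + 64) / ρ * q⁻¹) ≤
      exp 1 * ((2 / π + 64) / ρ * q⁻¹) := by gcongr
  have h6 : exp 1 * (2 / π + 64) / ρ * q⁻¹ = exp 1 * ((2 / π + 64) / ρ * q⁻¹) := by ring
  rw [h6, mul_add, mul_add, h1, h3, h4]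
  linarith

theorem isolated_vertex_integral_limit_2d_k0
    (Ω : Set (EuclideanSpace ℝ (Fin 2)))
    (hconv : Convex ℝ Ω) (hcomp : IsCompact Ω) (hint : (interior Ω).Nonempty)
    (hvol : volume Ω = 1)
    (c : ℝ) (hc : 0 < c)
    (r : ℕ → ℝ)
    (hr : ∀ n : ℕ, r n = Real.sqrt ((Real.log n + c) / (π * n))) :
    Tendsto (fun n : ℕ =>
        (n : ℝ) * ∫ x in Ω,
          Real.exp (-((n : ℝ) * (volume (closedBall x (r n) ∩ Ω)).toReal)))
      atTop (𝓝 (Real.exp (-c))) := by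
  have hpi := pi_pos
  obtain ⟨p, hpint⟩ := hint
  obtain ⟨ρ, hρ, hp⟩ := nhds_basis_closedBall.mem_iff.1 (mem_interior_iff_mem_nhds.1 hpint)
  obtain ⟨D, hD⟩ := hcomp.isBounded.subset_closedBall p
  have hD0 : 0 ≤ D := by
    have := hD (hp (mem_closedBall_self hρ.le))
    simpa using this
  set L : ℕ → ℝ := fun n => log n + c with hL
  have hLtop : Tendsto L atTop atTop :=
    tendsto_atTop_add_const_right _ _ (tendsto_log_atTop.comp tendsto_natCast_atTop_atTop)
  have hr0 : Tendsto r atTop (𝓝 0) := by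
    have h1 : Tendsto (fun x : ℝ => log x / x) atTop (𝓝 0) :=
      isLittleO_log_id_atTop.tendsto_div_nhds_zero
    have h2 : Tendsto (fun x : ℝ => c / x) atTop (𝓝 0) := tendsto_id.const_div_atTop c
    have h3 := (((h1.add h2).div_const π).comp tendsto_natCast_atTop_atTop (α := ℕ)).sqrt
    simp only [add_zero, zero_div, sqrt_zero] at h3
    refine h3.congr fun n => ?_
    rw [hr, Function.comp_apply]
    congr 1
    rw [← add_div, div_div, mul_comm]
  have hev : ∀ᶠ n : ℕ in atTop, 0 < (n : ℝ) ∧ 2 ≤ L n ∧ r n ≤ ρ ∧ 0 < r n ∧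
      L n = n * (π * r n ^ 2) := by
    filter_upwards [eventually_gt_atTop 0, hLtop.eventually_ge_atTop 2,
      hr0.eventually_le_const hρ] with n hn hL2 hrn
    have hn0 : (0 : ℝ) < n := by exact_mod_cast hn
    have hLn : 0 < log n + c := lt_of_lt_of_le two_pos hL2
    refine ⟨hn0, hL2, hrn, ?_, ?_⟩
    · rw [hr]; positivity
    · rw [hr, sq_sqrt (by positivity)]
      simp only [hL]
      field_simp
  have hupp : Tendsto (fun n => exp (-c) +
      4 * D / (π * ρ) * (L n ^ 3 * exp (-((ρ / (D + ρ)) ^ 2 * L n))) +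
        exp 1 * (2 / π + 64) / ρ * (√(L n / π))⁻¹) atTop (𝓝 (exp (-c))) := by
    have hδ : 0 < (ρ / (D + ρ)) ^ 2 := by positivity
    have h1 : Tendsto (fun n => L n ^ 3 * exp (-((ρ / (D + ρ)) ^ 2 * L n))) atTop (𝓝 0) := by
      have := (tendsto_rpow_mul_exp_neg_mul_atTop_nhds_zero 3 _ hδ).comp hLtop
      refine this.congr fun n => ?_
      simp only [Function.comp_apply, neg_mul]
      norm_cast
    have h2 : Tendsto (fun n => (√(L n / π))⁻¹) atTop (𝓝 0) :=
      tendsto_inv_atTop_zero.comp (tendsto_sqrt_atTop.comp (hLtop.atTop_div_const hpi))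
    have := ((h1.const_mul (4 * D / (π * ρ))).const_add (exp (-c))).add
      (h2.const_mul (exp 1 * (2 / π + 64) / ρ))
    simpa using this
  refine tendsto_of_tendsto_of_tendsto_of_le_of_le' tendsto_const_nhds hupp ?_ ?_
  · filter_upwards [hev] with n hn
    obtain ⟨hn0, hL2, hrρ, hrn, hLn⟩ := hn
    have := mul_le_mul_of_nonneg_left
      (integral_exp_neg_volume_ge hcomp.measurableSet hvol hrn.le hn0.le) hn0.le
    rw [← hLn] at this
    have e : (n : ℝ) * exp (-L n) = exp (-c) := by
      simp only [hL]
      rw [neg_add, exp_add, exp_neg, exp_log hn0, mul_inv_cancel_left₀ hn0.ne']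
    rw [e] at this
    exact this
  · filter_upwards [hev] with n hn
    obtain ⟨hn0, hL2, hrρ, hrn, hLn⟩ := hn
    exact mul_integral_exp_neg_volume_le hconv hcomp.isClosed hvol hρ hp hD hrn hrρ hn0 hc.le
      rfl hLn hL2
end
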